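/- arXiv:2509.15898 — 7 statements merged into one kernel-verified Lean document; each statement's English description precedes it below -/
import Mathlib

section
/- Let (T, 𝒯, λ) be an atomless probability space and let ℱ be a sub-σ-algebra of 𝒯. The following three conditions are equivalent: (i) 𝒯 is nowhere equivalent to ℱ; (ii) 𝒯 is conditionally atomless over ℱ; (iii) ℱ admits an atomless independent supplement in 𝒯. -/
open MeasureTheory Set Filter Topology

namespace NowhereEquivalence

variable {T : Type*}

lemma measureReal_pos_iff {_ : MeasurableSpace T} {μ : Measure T} [IsFiniteMeasure μ]
    {s : Set T} : 0 < μ.real s ↔ 0 < μ s := by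
  rw [measureReal_def, ENNReal.toReal_pos_iff]
  exact and_iff_left (measure_lt_top μ s)

/-- Hahn decomposition of two finite measures restricted to a sub-σ-algebra. -/
lemma exists_hahn_set {ℱ 𝒯 : MeasurableSpace T} (α β : Measure T) [IsFiniteMeasure α]
    [IsFiniteMeasure β] (hℱ : ℱ ≤ 𝒯) :
    ∃ s, MeasurableSet[ℱ] s ∧
      (∀ E, MeasurableSet[ℱ] E → E ⊆ s → β.real E ≤ α.real E) ∧
      (∀ E, MeasurableSet[ℱ] E → E ⊆ sᶜ → α.real E ≤ β.real E) := by
  obtain ⟨s, hs, h₁, h₂⟩ := @hahn_decomposition T ℱ (α.trim hℱ) (β.trim hℱ) _ _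
  refine ⟨s, hs, fun E hE hEs => ?_, fun E hE hEs => ?_⟩
  · have := h₁ E hE hEs
    rw [trim_measurableSet_eq hℱ hE, trim_measurableSet_eq hℱ hE] at this
    exact ENNReal.toReal_mono (measure_ne_top _ _) this
  · have := h₂ E hE hEs
    rw [trim_measurableSet_eq hℱ hE, trim_measurableSet_eq hℱ hE] at this
    exact ENNReal.toReal_mono (measure_ne_top _ _) this

/-- Exhaustion: a property stable under increasing countable unions has a set of locally maximal
measure. -/
lemma exists_maximal_measure [MeasurableSpace T] (μ : Measure T) [IsFiniteMeasure μ]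
    (Q : Set T → Prop) (A₀ : Set T) (h₀ : Q A₀)
    (hQ : ∀ f : ℕ → Set T, Monotone f → (∀ n, Q (f n)) → Q (⋃ n, f n)) :
    ∃ A, Q A ∧ ∀ B, A ⊆ B → Q B → μ.real B ≤ μ.real A := by
  have key : ∀ (n : ℕ) (A : {A // Q A}), ∃ B : {A // Q A}, A.1 ⊆ B.1 ∧
      ∀ C, A.1 ⊆ C → Q C → μ.real C ≤ μ.real B.1 + 1 / ((n : ℝ) + 1) := by
    intro n A
    let S : Set ℝ := {x | ∃ C, A.1 ⊆ C ∧ Q C ∧ μ.real C = x}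
    have hne : S.Nonempty := ⟨_, A.1, Subset.rfl, A.2, rfl⟩
    have hbdd : BddAbove S := by
      refine ⟨μ.real univ, ?_⟩
      rintro x ⟨C, -, -, rfl⟩
      exact measureReal_mono (subset_univ _)
    have hpos : (0 : ℝ) < 1 / ((n : ℝ) + 1) := Nat.one_div_pos_of_nat
    obtain ⟨x, ⟨B, hAB, hB, rfl⟩, hx⟩ := exists_lt_of_lt_csSup hne (sub_lt_self (sSup S) hpos)
    refine ⟨⟨B, hB⟩, hAB, fun C hAC hC => ?_⟩
    have := le_csSup hbdd (show μ.real C ∈ S from ⟨C, hAC, hC, rfl⟩)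
    dsimp only
    linarith
  choose next hnext hmax using key
  let f : ℕ → {A // Q A} := fun n => Nat.rec ⟨A₀, h₀⟩ (fun n A => next n A) n
  have hsucc : ∀ n, f (n + 1) = next n (f n) := fun n => rfl
  have hmono : Monotone fun n => (f n).1 :=
    monotone_nat_of_le_succ fun n => by rw [hsucc]; exact hnext n (f n)
  refine ⟨⋃ n, (f n).1, hQ _ hmono fun n => (f n).2, fun B hB hQB => ?_⟩
  refine le_of_forall_pos_le_add fun ε hε => ?_
  obtain ⟨n, hn⟩ := exists_nat_one_div_lt hε
  have h₁ := hmax n (f n) B ((subset_iUnion (fun n => (f n).1) n).trans hB) hQB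
  have h₂ : μ.real (next n (f n)).1 ≤ μ.real (⋃ n, (f n).1) :=
    measureReal_mono (subset_iUnion (fun n => (f n).1) (n + 1))
  linarith

/-- `𝒯` is nowhere equivalent to `ℱ`. -/
def NowhereEquiv (𝒯 : MeasurableSpace T) (μ : @Measure T 𝒯) (ℱ : MeasurableSpace T) : Prop :=
  ∀ D : Set T, MeasurableSet[𝒯] D → 0 < μ D →
    ∃ D₀ ⊆ D, MeasurableSet[𝒯] D₀ ∧
      ∀ E : Set T, MeasurableSet[ℱ] E → 0 < μ (symmDiff D₀ (D ∩ E))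

section Halving

variable {ℱ 𝒯 : MeasurableSpace T} {μ : Measure T} [IsFiniteMeasure μ]

/-- A set of positive measure contains one of positive measure and at most half the conditional
probability. -/
lemma NowhereEquiv.exists_le_half (h : NowhereEquiv 𝒯 μ ℱ) (hℱ : ℱ ≤ 𝒯) {D : Set T}
    (hD : MeasurableSet D) (hpos : 0 < μ.real D) :
    ∃ D₁ ⊆ D, MeasurableSet D₁ ∧ 0 < μ.real D₁ ∧
      ∀ E, MeasurableSet[ℱ] E → 2 * μ.real (E ∩ D₁) ≤ μ.real (E ∩ D) := by
  obtain ⟨D₀, hD₀D, hD₀, hne⟩ := h D hD (measureReal_pos_iff.1 hpos)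
  obtain ⟨s, hs, h₁, h₂⟩ := exists_hahn_set (μ.restrict D₀) (μ.restrict (D \ D₀)) hℱ
  have hs' := hℱ _ hs
  have hsplit : ∀ E, MeasurableSet E →
      μ.real (E ∩ D) = μ.real (E ∩ D₀) + μ.real (E ∩ (D \ D₀)) := by
    intro E hE
    rw [← measureReal_inter_add_sdiff (s := E ∩ D) hD₀]
    congr 2
    · rw [inter_assoc, inter_eq_self_of_subset_right hD₀D]
    · rw [inter_sdiff_assoc]
  refine ⟨(D₀ \ s) ∪ ((D \ D₀) ∩ s), ?_, (hD₀.diff hs').union ((hD.diff hD₀).inter hs'), ?_, ?_⟩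
  · intro t ht
    rcases ht with ht | ht
    exacts [hD₀D ht.1, ht.1.1]
  · refine measureReal_pos_iff.2 ((hne s hs).trans_le (measure_mono ?_))
    intro t ht
    have := @hD₀D t
    simp only [Set.mem_symmDiff, mem_inter_iff, mem_union, Set.mem_sdiff] at ht ⊢
    tauto
  · intro E hE
    have hE' := hℱ _ hE
    have a₁ := h₁ (E ∩ s) (hE.inter hs) inter_subset_right
    have a₂ := h₂ (E \ s) (hE.diff hs) (fun t ht => ht.2)
    rw [measureReal_restrict_apply (hE'.inter hs'),
      measureReal_restrict_apply (hE'.inter hs')] at a₁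
    rw [measureReal_restrict_apply (hE'.diff hs'),
      measureReal_restrict_apply (hE'.diff hs')] at a₂
    have b₁ := hsplit (E ∩ s) (hE'.inter hs')
    have b₂ := hsplit (E \ s) (hE'.diff hs')
    have c₁ := measureReal_inter_add_sdiff (μ := μ) (s := E ∩ D) hs'
    rw [inter_right_comm, inter_sdiff_right_comm] at c₁
    have c₂ := measureReal_inter_add_sdiff (μ := μ) (s := E ∩ ((D₀ \ s) ∪ ((D \ D₀) ∩ s))) hs'
    have e₁ : E ∩ ((D₀ \ s) ∪ ((D \ D₀) ∩ s)) ∩ s = E ∩ s ∩ (D \ D₀) := by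
      ext t; simp only [mem_inter_iff, mem_union, Set.mem_sdiff]; tauto
    have e₂ : (E ∩ ((D₀ \ s) ∪ ((D \ D₀) ∩ s))) \ s = E \ s ∩ D₀ := by
      ext t; simp only [mem_inter_iff, mem_union, Set.mem_sdiff]; tauto
    rw [e₁, e₂] at c₂
    linarith

lemma NowhereEquiv.exists_le_two_pow (h : NowhereEquiv 𝒯 μ ℱ) (hℱ : ℱ ≤ 𝒯) {D : Set T}
    (hD : MeasurableSet D) (hpos : 0 < μ.real D) (n : ℕ) :
    ∃ D₁ ⊆ D, MeasurableSet D₁ ∧ 0 < μ.real D₁ ∧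
      ∀ E, MeasurableSet[ℱ] E → 2 ^ n * μ.real (E ∩ D₁) ≤ μ.real (E ∩ D) := by
  induction n with
  | zero => exact ⟨D, Subset.rfl, hD, hpos, fun E _ => by simp⟩
  | succ n ih =>
    obtain ⟨D₁, hD₁D, hD₁, hpos₁, h₁⟩ := ih
    obtain ⟨D₂, hD₂D, hD₂, hpos₂, h₂⟩ := h.exists_le_half hℱ hD₁ hpos₁
    refine ⟨D₂, hD₂D.trans hD₁D, hD₂, hpos₂, fun E hE => ?_⟩
    calc 2 ^ (n + 1) * μ.real (E ∩ D₂) = 2 ^ n * (2 * μ.real (E ∩ D₂)) := by ring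
      _ ≤ 2 ^ n * μ.real (E ∩ D₁) := by gcongr; exact h₂ E hE
      _ ≤ _ := h₁ E hE

/-- Every measurable set can be split in two halves of equal conditional probability. -/
lemma NowhereEquiv.exists_half (h : NowhereEquiv 𝒯 μ ℱ) (hℱ : ℱ ≤ 𝒯) {P : Set T}
    (hP : MeasurableSet P) :
    ∃ H ⊆ P, MeasurableSet H ∧
      ∀ E, MeasurableSet[ℱ] E → 2 * μ.real (E ∩ H) = μ.real (E ∩ P) := by
  obtain ⟨A, ⟨hAP, hA, hle⟩, hmax⟩ := exists_maximal_measure μ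
    (fun A => A ⊆ P ∧ MeasurableSet A ∧
      ∀ E, MeasurableSet[ℱ] E → 2 * μ.real (E ∩ A) ≤ μ.real (E ∩ P)) ∅
    ⟨empty_subset _, MeasurableSet.empty, fun E _ => by simp⟩ (by
      intro f hf hQ
      refine ⟨iUnion_subset fun n => (hQ n).1, MeasurableSet.iUnion fun n => (hQ n).2.1,
        fun E hE => ?_⟩
      have hlim : Tendsto (fun n => μ (E ∩ f n)) atTop (𝓝 (μ (E ∩ ⋃ n, f n))) := by
        rw [inter_iUnion]
        exact tendsto_measure_iUnion_atTop fun m n hmn => inter_subset_inter_right _ (hf hmn)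
      have hlim' := (ENNReal.tendsto_toReal (measure_ne_top μ _)).comp hlim
      exact le_of_tendsto (hlim'.const_mul 2) (Eventually.of_forall fun n => (hQ n).2.2 E hE))
  refine ⟨A, hAP, hA, fun E₀ hE₀ => le_antisymm (hle E₀ hE₀) ?_⟩
  by_contra! hlt
  -- pick `n` such that the gap on `E₀` exceeds `2 * 2⁻ⁿ * μ univ`
  obtain ⟨n, hn⟩ : ∃ n : ℕ, 2 * (1 / 2 : ℝ) ^ n * μ.real univ <
      μ.real (E₀ ∩ P) - 2 * μ.real (E₀ ∩ A) := by
    have hlim : Tendsto (fun n : ℕ => 2 * (1 / 2 : ℝ) ^ n * μ.real univ) atTop (𝓝 0) := by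
      have := (tendsto_pow_atTop_nhds_zero_of_lt_one (r := (1 / 2 : ℝ)) (by norm_num)
        (by norm_num)).const_mul 2 |>.mul_const (μ.real univ)
      simpa using this
    exact (hlim.eventually_lt_const (sub_pos.2 hlt)).exists
  set c : ℝ := (1 / 2 : ℝ) ^ n with hc
  have hc₀ : 0 ≤ c := by positivity
  obtain ⟨s, hs, h₁, h₂⟩ := exists_hahn_set (μ.restrict P)
    ((2 : NNReal) • μ.restrict A + (2 * (1 / 2 : NNReal) ^ n) • μ) hℱ
  have hs' := hℱ _ hs
  have hval : ∀ E, MeasurableSet[ℱ] E →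
      ((2 : NNReal) • μ.restrict A + (2 * (1 / 2 : NNReal) ^ n) • μ).real E
        = 2 * μ.real (E ∩ A) + 2 * c * μ.real E := by
    intro E hE
    rw [measureReal_add_apply, measureReal_nnreal_smul_apply, measureReal_nnreal_smul_apply,
      measureReal_restrict_apply (hℱ _ hE)]
    simp [hc]
  have h₁' : ∀ E, MeasurableSet[ℱ] E → E ⊆ s →
      2 * μ.real (E ∩ A) + 2 * c * μ.real E ≤ μ.real (E ∩ P) := by
    intro E hE hEs
    have := h₁ E hE hEs
    rwa [hval E hE, measureReal_restrict_apply (hℱ _ hE)] at this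
  have h₂' : ∀ E, MeasurableSet[ℱ] E → E ⊆ sᶜ →
      μ.real (E ∩ P) ≤ 2 * μ.real (E ∩ A) + 2 * c * μ.real E := by
    intro E hE hEs
    have := h₂ E hE hEs
    rwa [hval E hE, measureReal_restrict_apply (hℱ _ hE)] at this
  have hsplit : ∀ E B, μ.real (E ∩ B) = μ.real (E ∩ s ∩ B) + μ.real (E \ s ∩ B) := by
    intro E B
    have := measureReal_inter_add_sdiff (μ := μ) (s := E ∩ B) hs'
    rw [inter_right_comm, inter_sdiff_right_comm] at this
    exact this.symm
  have hpos : 0 < μ.real (s ∩ (P \ A)) := by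
    refine lt_of_le_of_ne measureReal_nonneg fun h0 => ?_
    have e₁ : μ.real (E₀ ∩ s ∩ P) ≤ μ.real (E₀ ∩ s ∩ A) := by
      have : μ.real (E₀ ∩ s ∩ P) ≤ μ.real ((E₀ ∩ s ∩ A) ∪ (s ∩ (P \ A))) := by
        refine measureReal_mono fun t ht => ?_
        simp only [mem_inter_iff, mem_union, Set.mem_sdiff] at ht ⊢
        tauto
      have := this.trans (measureReal_union_le _ _)
      linarith
    have e₂ := h₂' (E₀ \ s) (hE₀.diff hs) (fun t ht => ht.2)
    have e₃ : 2 * c * μ.real (E₀ \ s) ≤ 2 * c * μ.real univ := by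
      exact mul_le_mul_of_nonneg_left (measureReal_mono (subset_univ _)) (by positivity)
    have := hsplit E₀ P
    have := hsplit E₀ A
    have : 0 ≤ μ.real (E₀ ∩ s ∩ A) := measureReal_nonneg
    linarith
  obtain ⟨D, hDsub, hD, hDpos, hDle⟩ :=
    h.exists_le_two_pow hℱ (hs'.inter (hP.diff hA)) hpos n
  have hdisj : Disjoint A D :=
    Set.disjoint_left.2 fun t htA htD => (hDsub htD).2.2 htA
  have hunion : μ.real (A ∪ D) ≤ μ.real A := by
    refine hmax _ subset_union_left ⟨union_subset hAP fun t ht => (hDsub ht).2.1,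
      hA.union hD, fun E hE => ?_⟩
    have e₁ : μ.real (E ∩ (A ∪ D)) ≤ μ.real (E ∩ A) + μ.real (E ∩ D) := by
      rw [inter_union_distrib_left]
      exact measureReal_union_le _ _
    have e₂ : μ.real (E ∩ D) ≤ c * μ.real (E ∩ s) := by
      have h₃ : μ.real (E ∩ (s ∩ (P \ A))) ≤ μ.real (E ∩ s) :=
        measureReal_mono (inter_subset_inter_right _ inter_subset_left)
      have h₄ : c * 2 ^ n = 1 := by rw [hc, ← mul_pow]; norm_num
      calc μ.real (E ∩ D) = c * (2 ^ n * μ.real (E ∩ D)) := by rw [← mul_assoc, h₄, one_mul]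
        _ ≤ c * μ.real (E ∩ s) := by gcongr; exact (hDle E hE).trans h₃
    have e₃ := h₁' (E ∩ s) (hE.inter hs) inter_subset_right
    have e₄ := hle (E \ s) (hE.diff hs)
    have := hsplit E P
    have := hsplit E A
    linarith
  rw [measureReal_union hdisj hD] at hunion
  linarith

end Halving

section Tree

/-- The dyadic tree of sets obtained from `univ` by splitting each set `B` into `half B` and
`B \ half B`. -/
def tree (half : Set T → Set T) : List Bool → Set T
  | [] => univ
  | true :: l => half (tree half l)
  | false :: l => tree half l \ half (tree half l)

variable {half : Set T → Set T}

lemma tree_cons_subset (hsub : ∀ P, half P ⊆ P) (b : Bool) (l : List Bool) :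
    tree half (b :: l) ⊆ tree half l := by
  cases b
  exacts [sdiff_subset, hsub _]

lemma suffix_of_mem_tree (hsub : ∀ P, half P ⊆ P) {t : T} {l l' : List Bool}
    (hl : t ∈ tree half l) (hl' : t ∈ tree half l') (hlen : l.length ≤ l'.length) :
    l <:+ l' := by
  induction l' generalizing l with
  | nil => simp_all
  | cons b m ih =>
    have hm := tree_cons_subset hsub b m hl'
    rcases hlen.eq_or_lt with heq | hlt
    · cases l with
      | nil => simp
      | cons c k =>
        have hk := tree_cons_subset hsub c k hl
        simp only [List.length_cons, add_left_inj] at heq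
        obtain rfl := (ih hk hm heq.le).eq_of_length heq
        cases b <;> cases c
        · exact List.suffix_rfl
        · exact absurd hl hl'.2
        · exact absurd hl' hl.2
        · exact List.suffix_rfl
    · exact (ih hl hm (Nat.lt_succ_iff.1 hlt)).trans (List.suffix_cons b m)

lemma tree_subset_of_suffix (hsub : ∀ P, half P ⊆ P) {l l' : List Bool} (h : l <:+ l') :
    tree half l' ⊆ tree half l := by
  obtain ⟨k, rfl⟩ := h
  induction k with
  | nil => exact Subset.rfl
  | cons b k ih => exact (tree_cons_subset hsub b _).trans ih

lemma isPiSystem_range_tree (hsub : ∀ P, half P ⊆ P) : IsPiSystem (range (tree half)) := by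
  rintro _ ⟨l, rfl⟩ _ ⟨l', rfl⟩ ⟨t, ht, ht'⟩
  rcases le_total l.length l'.length with h | h
  · refine ⟨l', (inter_eq_self_of_subset_right ?_).symm⟩
    exact tree_subset_of_suffix hsub (suffix_of_mem_tree hsub ht ht' h)
  · refine ⟨l, (inter_eq_self_of_subset_left ?_).symm⟩
    exact tree_subset_of_suffix hsub (suffix_of_mem_tree hsub ht' ht h)

variable {ℱ 𝒯 : MeasurableSpace T} {μ : Measure T}

lemma measurableSet_tree (hmeas : ∀ P, MeasurableSet P → MeasurableSet (half P)) (l : List Bool) :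
    MeasurableSet (tree half l) := by
  induction l with
  | nil => exact MeasurableSet.univ
  | cons b l ih =>
    cases b
    exacts [ih.diff (hmeas _ ih), hmeas _ ih]

lemma measureReal_inter_tree_add [IsFiniteMeasure μ] (hsub : ∀ P, half P ⊆ P)
    (hmeas : ∀ P, MeasurableSet P → MeasurableSet (half P)) (C : Set T) (l : List Bool) :
    μ.real (C ∩ tree half (true :: l)) + μ.real (C ∩ tree half (false :: l))
      = μ.real (C ∩ tree half l) := by
  rw [← measureReal_inter_add_sdiff (s := C ∩ tree half l) (measurableSet_tree hmeas (true :: l))]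
  congr 2
  · rw [inter_assoc, inter_eq_self_of_subset_right (tree_cons_subset hsub true l)]
  · rw [inter_sdiff_assoc]; rfl

lemma measureReal_inter_tree [IsFiniteMeasure μ] (hsub : ∀ P, half P ⊆ P)
    (hmeas : ∀ P, MeasurableSet P → MeasurableSet (half P))
    (hhalf : ∀ P, MeasurableSet P → ∀ E, MeasurableSet[ℱ] E →
      2 * μ.real (E ∩ half P) = μ.real (E ∩ P)) {E : Set T} (hE : MeasurableSet[ℱ] E)
    (l : List Bool) :
    μ.real (E ∩ tree half l) = μ.real E * (1 / 2) ^ l.length := by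
  induction l with
  | nil => simp [tree]
  | cons b l ih =>
    have h₁ : 2 * μ.real (E ∩ tree half (true :: l)) = μ.real (E ∩ tree half l) :=
      hhalf _ (measurableSet_tree hmeas l) E hE
    have h₂ := measureReal_inter_tree_add (μ := μ) hsub hmeas E l
    rw [List.length_cons, pow_succ, ← mul_assoc, ← ih]
    cases b <;> linarith

end Tree

/-- A σ-algebra nowhere equivalent to `ℱ` contains an atomless supplement independent of `ℱ`. -/
lemma NowhereEquiv.exists_supplement {ℱ 𝒯 : MeasurableSpace T} {μ : Measure T}
    [IsProbabilityMeasure μ] (h : NowhereEquiv 𝒯 μ ℱ) (hℱ : ℱ ≤ 𝒯) :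
    ∃ ℋ : MeasurableSpace T, ℋ ≤ 𝒯 ∧
      (∀ C : Set T, MeasurableSet[ℋ] C → 0 < μ C →
        ∃ C₀ ⊆ C, MeasurableSet[ℋ] C₀ ∧ 0 < μ C₀ ∧ μ C₀ < μ C) ∧
      (∀ C₁ C₂ : Set T, MeasurableSet[ℱ] C₁ → MeasurableSet[ℋ] C₂ →
        μ (C₁ ∩ C₂) = μ C₁ * μ C₂) := by
  have key : ∀ P : Set T, ∃ H ⊆ P, MeasurableSet P → MeasurableSet H ∧
      ∀ E, MeasurableSet[ℱ] E → 2 * μ.real (E ∩ H) = μ.real (E ∩ P) := by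
    intro P
    by_cases hP : MeasurableSet P
    · obtain ⟨H, h₁, h₂⟩ := h.exists_half hℱ hP
      exact ⟨H, h₁, fun _ => h₂⟩
    · exact ⟨∅, empty_subset _, fun hP' => absurd hP' hP⟩
  choose half hsub hboth using key
  have hmeas : ∀ P, MeasurableSet P → MeasurableSet (half P) := fun P hP => (hboth P hP).1
  have hhalf : ∀ P, MeasurableSet P → ∀ E, MeasurableSet[ℱ] E →
      2 * μ.real (E ∩ half P) = μ.real (E ∩ P) := fun P hP => (hboth P hP).2
  have htree : ∀ l, μ.real (tree half l) = (1 / 2) ^ l.length := fun l => by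
    simpa using measureReal_inter_tree hsub hmeas hhalf (@MeasurableSet.univ T ℱ) l
  have hle : MeasurableSpace.generateFrom (range (tree half)) ≤ 𝒯 :=
    MeasurableSpace.generateFrom_le (by rintro _ ⟨l, rfl⟩; exact measurableSet_tree hmeas l)
  refine ⟨MeasurableSpace.generateFrom (range (tree half)), hle, fun C hC hpos => ?_, ?_⟩
  · have hCpos : 0 < μ.real C := measureReal_pos_iff.2 hpos
    by_contra! hcon
    have hdich : ∀ l, 0 < μ.real (C ∩ tree half l) → μ.real C ≤ μ.real (C ∩ tree half l) := by
      intro l hl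
      exact ENNReal.toReal_mono (measure_ne_top _ _) (hcon _ inter_subset_left
        (MeasurableSet.inter hC (MeasurableSpace.measurableSet_generateFrom ⟨l, rfl⟩))
        (measureReal_pos_iff.1 hl))
    have hex : ∀ n : ℕ, ∃ l : List Bool, l.length = n ∧ 0 < μ.real (C ∩ tree half l) := by
      intro n
      induction n with
      | zero => exact ⟨[], rfl, by simpa [tree] using hCpos⟩
      | succ n ih =>
        obtain ⟨l, hl, hlpos⟩ := ih
        rw [← measureReal_inter_tree_add hsub hmeas] at hlpos
        by_cases h0 : 0 < μ.real (C ∩ tree half (true :: l))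
        · exact ⟨true :: l, by simp [hl], h0⟩
        · exact ⟨false :: l, by simp [hl], by linarith⟩
    obtain ⟨n, hn⟩ := exists_pow_lt_of_lt_one hCpos (show (1 / 2 : ℝ) < 1 by norm_num)
    obtain ⟨l, rfl, hlpos⟩ := hex n
    have h₁ := hdich l hlpos
    have h₂ : μ.real (C ∩ tree half l) ≤ μ.real (tree half l) := measureReal_mono inter_subset_right
    rw [htree] at h₂
    linarith
  · intro C₁ C₂ h₁ h₂
    have hC₁ := hℱ _ h₁
    have hC₂ := hle _ h₂
    let ν₁ : Measure T := μ.restrict C₁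
    let ν₂ : Measure T := μ C₁ • μ
    have : ν₁ C₂ = ν₂ C₂ := by
      have : IsFiniteMeasure ν₂ := Measure.smul_finite _ (measure_ne_top _ _)
      rw [← trim_measurableSet_eq hle h₂, ← trim_measurableSet_eq hle h₂]
      refine congrArg (fun ν => ν C₂) (ext_of_generate_finite
        (m0 := MeasurableSpace.generateFrom (range (tree half))) (μ := ν₁.trim hle)
        (ν := ν₂.trim hle) (range (tree half)) rfl (isPiSystem_range_tree hsub) ?_ ?_)
      · rintro _ ⟨l, rfl⟩
        have hl : MeasurableSet[MeasurableSpace.generateFrom (range (tree half))] (tree half l) :=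
          MeasurableSpace.measurableSet_generateFrom ⟨l, rfl⟩
        rw [trim_measurableSet_eq hle hl, trim_measurableSet_eq hle hl]
        simp only [ν₁, ν₂]
        rw [Measure.restrict_apply (hle _ hl), inter_comm, Measure.smul_apply, smul_eq_mul,
          ← ENNReal.toReal_eq_toReal_iff' (measure_ne_top _ _)
            (ENNReal.mul_ne_top (measure_ne_top _ _) (measure_ne_top _ _)), ENNReal.toReal_mul]
        change μ.real (C₁ ∩ tree half l) = μ.real C₁ * μ.real (tree half l)
        rw [measureReal_inter_tree hsub hmeas hhalf h₁, htree]
      · rw [trim_measurableSet_eq hle MeasurableSet.univ, trim_measurableSet_eq hle MeasurableSet.univ]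
        simp [ν₁, ν₂]
    simp only [ν₁, ν₂] at this
    rwa [Measure.restrict_apply hC₂, inter_comm, Measure.smul_apply, smul_eq_mul] at this

/-- Atomlessness is nowhere equivalence to the trivial σ-algebra. -/
lemma nowhereEquiv_bot {𝒯 : MeasurableSpace T} {μ : Measure T} [IsFiniteMeasure μ]
    (h : ∀ D : Set T, MeasurableSet[𝒯] D → 0 < μ D →
      ∃ D₀ ⊆ D, MeasurableSet[𝒯] D₀ ∧ 0 < μ D₀ ∧ μ D₀ < μ D) :
    NowhereEquiv 𝒯 μ ⊥ := by
  intro D hD hpos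
  obtain ⟨D₀, hsub, hD₀, hpos₀, hlt⟩ := h D hD hpos
  refine ⟨D₀, hsub, hD₀, fun E hE => ?_⟩
  rcases MeasurableSpace.measurableSet_bot_iff.1 hE with rfl | rfl
  · simpa [symmDiff_def] using hpos₀
  · have hz : D₀ \ D = ∅ := sdiff_eq_bot_iff.2 hsub
    rw [inter_univ, Set.symmDiff_def, hz, empty_union,
      measure_sdiff hsub hD₀.nullMeasurableSet (measure_ne_top _ _)]
    exact tsub_pos_of_lt hlt

/-- In an atomless σ-algebra every set can be halved. -/
lemma exists_half_of_atomless {ℋ 𝒯 : MeasurableSpace T} {μ : Measure T} [IsFiniteMeasure μ]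
    (hℋ : ℋ ≤ 𝒯) (h : ∀ D : Set T, MeasurableSet[ℋ] D → 0 < μ D →
      ∃ D₀ ⊆ D, MeasurableSet[ℋ] D₀ ∧ 0 < μ D₀ ∧ μ D₀ < μ D)
    {C : Set T} (hC : MeasurableSet[ℋ] C) :
    ∃ C' ⊆ C, MeasurableSet[ℋ] C' ∧ 2 * μ.real C' = μ.real C := by
  have hne : NowhereEquiv ℋ (μ.trim hℋ) ⊥ := by
    refine nowhereEquiv_bot fun D hD hpos => ?_
    rw [trim_measurableSet_eq hℋ hD] at hpos
    obtain ⟨D₀, hsub, hD₀, hpos₀, hlt⟩ := h D hD hpos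
    refine ⟨D₀, hsub, hD₀, ?_⟩
    rw [trim_measurableSet_eq hℋ hD, trim_measurableSet_eq hℋ hD₀]
    exact ⟨hpos₀, hlt⟩
  obtain ⟨C', hsub, hC', hhalf⟩ := hne.exists_half bot_le hC
  refine ⟨C', hsub, hC', ?_⟩
  have := hhalf univ MeasurableSet.univ
  simpa only [univ_inter, measureReal_def, trim_measurableSet_eq hℋ hC,
    trim_measurableSet_eq hℋ hC'] using this

/-- A σ-algebra containing an atomless independent supplement of `ℱ` is nowhere equivalent
to `ℱ`. -/
lemma nowhereEquiv_of_supplement {ℱ ℋ 𝒯 : MeasurableSpace T} {μ : Measure T}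
    [IsProbabilityMeasure μ] (hℱ : ℱ ≤ 𝒯) (hℋ : ℋ ≤ 𝒯)
    (hatomless : ∀ C : Set T, MeasurableSet[ℋ] C → 0 < μ C →
      ∃ C₀ ⊆ C, MeasurableSet[ℋ] C₀ ∧ 0 < μ C₀ ∧ μ C₀ < μ C)
    (hind : ∀ C₁ C₂ : Set T, MeasurableSet[ℱ] C₁ → MeasurableSet[ℋ] C₂ →
      μ (C₁ ∩ C₂) = μ C₁ * μ C₂) : NowhereEquiv 𝒯 μ ℱ := by
  intro D hD hpos
  by_contra! hcon
  have hagree : ∀ C, MeasurableSet[ℋ] C → ∃ E, MeasurableSet[ℱ] E ∧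
      (D ∩ C : Set T) =ᵐ[μ] (D ∩ E : Set T) := by
    intro C hC
    obtain ⟨E, hE, h0⟩ := hcon (D ∩ C) inter_subset_left (hD.inter (hℋ _ hC))
    exact ⟨E, hE, measure_symmDiff_eq_zero_iff.1 (nonpos_iff_eq_zero.1 h0)⟩
  have hbound : ∀ n : ℕ, ∀ C E, MeasurableSet[ℋ] C → MeasurableSet[ℱ] E →
      (D ∩ C : Set T) =ᵐ[μ] (D ∩ E : Set T) →
      2 ^ n * μ.real (D ∩ C) ≤ μ.real E * μ.real C := by
    intro n
    induction n with
    | zero =>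
      intro C E hC hE hCE
      have h₁ : (D ∩ C : Set T) ≤ᵐ[μ] (E ∩ C : Set T) := by
        filter_upwards [hCE.mem_iff] with t ht htC
        exact ⟨(ht.1 htC).2, htC.2⟩
      have h₂ : μ.real (E ∩ C) = μ.real E * μ.real C := by
        simp only [measureReal_def, hind E C hE hC, ENNReal.toReal_mul]
      rw [pow_zero, one_mul, ← h₂]
      exact ENNReal.toReal_mono (measure_ne_top _ _) (measure_mono_ae h₁)
    | succ n ih =>
      intro C E hC hE hCE
      obtain ⟨C', hsub, hC', hhalf⟩ := exists_half_of_atomless hℋ hatomless hC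
      obtain ⟨E', hE', hCE'⟩ := hagree C' hC'
      have h₁ := ih C' (E ∩ E') hC' (hE.inter hE') (by
        refine eventuallyEq_set.2 ?_
        filter_upwards [hCE.mem_iff, hCE'.mem_iff] with t ht ht'
        have := @hsub t
        simp only [mem_inter_iff] at ht ht' ⊢
        tauto)
      have h₂ := ih (C \ C') (E \ E') (hC.diff hC') (hE.diff hE') (by
        refine eventuallyEq_set.2 ?_
        filter_upwards [hCE.mem_iff, hCE'.mem_iff] with t ht ht'
        simp only [mem_inter_iff, Set.mem_sdiff] at ht ht' ⊢
        tauto)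
      have h₃ := measureReal_inter_add_sdiff (μ := μ) (s := D ∩ C) (hℋ _ hC')
      rw [inter_assoc, inter_eq_self_of_subset_right hsub, inter_sdiff_assoc] at h₃
      have h₄ := measureReal_inter_add_sdiff (μ := μ) (s := C) (hℋ _ hC')
      rw [inter_eq_self_of_subset_right hsub] at h₄
      have h₅ := measureReal_inter_add_sdiff (μ := μ) (s := E) (hℱ _ hE')
      have h₆ : μ.real (C \ C') = μ.real C' := by linarith
      rw [h₆] at h₂
      calc 2 ^ (n + 1) * μ.real (D ∩ C)
          = 2 * (2 ^ n * μ.real (D ∩ C') + 2 ^ n * μ.real (D ∩ (C \ C'))) := by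
            rw [← h₃]; ring
        _ ≤ 2 * (μ.real (E ∩ E') * μ.real C' + μ.real (E \ E') * μ.real C') := by gcongr
        _ = (μ.real (E ∩ E') + μ.real (E \ E')) * (2 * μ.real C') := by ring
        _ = μ.real E * μ.real C := by rw [h₅, hhalf]
  have hDpos : 0 < μ.real D := measureReal_pos_iff.2 hpos
  obtain ⟨n, hn⟩ := exists_pow_lt_of_lt_one hDpos (show (1 / 2 : ℝ) < 1 by norm_num)
  have h₁ := hbound n univ univ MeasurableSet.univ MeasurableSet.univ EventuallyEq.rfl
  simp only [inter_univ, probReal_univ, mul_one] at h₁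
  have h₂ : (2 : ℝ) ^ n * (1 / 2) ^ n = 1 := by rw [← mul_pow]; norm_num
  have h₃ : (2 : ℝ) ^ n * (1 / 2) ^ n < 2 ^ n * μ.real D := by gcongr
  linarith

section CondExp

variable {ℱ 𝒯 : MeasurableSpace T} {μ : Measure T} [IsFiniteMeasure μ]

lemma setIntegral_condExp_indicator (hℱ : ℱ ≤ 𝒯) {A E : Set T} (hA : MeasurableSet A)
    (hE : MeasurableSet[ℱ] E) :
    ∫ t in E, (μ[A.indicator (fun _ => (1 : ℝ))|ℱ]) t ∂μ = μ.real (A ∩ E) := by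
  rw [setIntegral_condExp hℱ ((integrable_const _).indicator hA) hE, integral_indicator hA,
    Measure.restrict_restrict hA]
  simp

lemma NowhereEquiv.condAtomless (h : NowhereEquiv 𝒯 μ ℱ) (hℱ : ℱ ≤ 𝒯) {D : Set T}
    (hD : MeasurableSet D) (hpos : 0 < μ D) :
    ∃ D₀ ⊆ D, MeasurableSet[𝒯] D₀ ∧
      0 < μ {t | 0 < (μ[D₀.indicator (fun _ => (1 : ℝ))|ℱ]) t ∧
        (μ[D₀.indicator (fun _ => (1 : ℝ))|ℱ]) t
          < (μ[D.indicator (fun _ => (1 : ℝ))|ℱ]) t} := by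
  obtain ⟨D₀, hsub, hD₀, hne⟩ := h D hD hpos
  refine ⟨D₀, hsub, hD₀, pos_iff_ne_zero.2 fun h0 => ?_⟩
  set g := μ[D₀.indicator (fun _ => (1 : ℝ))|ℱ] with hg
  set f := μ[D.indicator (fun _ => (1 : ℝ))|ℱ] with hf
  have hgm : Measurable[ℱ] g := stronglyMeasurable_condExp.measurable
  have hE : MeasurableSet[ℱ] {t | 0 < g t} := hgm measurableSet_Ioi
  set E := {t | 0 < g t} with hEdef
  have hE' := hℱ _ hE
  have hae : ∀ᵐ t ∂μ, 0 < g t → f t ≤ g t := by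
    have := measure_eq_zero_iff_ae_notMem.1 h0
    filter_upwards [this] with t ht hpos
    by_contra! hlt
    exact ht ⟨hpos, hlt⟩
  have h₁ : μ.real (D₀ ∩ Eᶜ) ≤ 0 := by
    rw [← setIntegral_condExp_indicator hℱ hD₀ hE.compl]
    exact setIntegral_nonpos hE'.compl fun t ht => not_lt.1 ht
  have h₂ : μ.real (D ∩ E) ≤ μ.real (D₀ ∩ E) := by
    rw [← setIntegral_condExp_indicator hℱ hD₀ hE, ← setIntegral_condExp_indicator hℱ hD hE]
    refine setIntegral_mono_on_ae integrable_condExp.integrableOn integrable_condExp.integrableOn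
      hE' ?_
    filter_upwards [hae] with t ht htE
    exact ht htE
  have h₃ := measureReal_inter_add_sdiff (μ := μ) (s := D ∩ E) hD₀
  rw [inter_right_comm, inter_eq_self_of_subset_right hsub] at h₃
  have h₄ : μ.real (symmDiff D₀ (D ∩ E)) ≤ 0 := by
    calc μ.real (symmDiff D₀ (D ∩ E)) ≤ μ.real ((D₀ ∩ Eᶜ) ∪ ((D ∩ E) \ D₀)) := by
          refine measureReal_mono fun t ht => ?_
          have := @hsub t
          simp only [Set.mem_symmDiff, mem_inter_iff, mem_union, Set.mem_sdiff, mem_compl_iff] at ht ⊢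
          tauto
      _ ≤ μ.real (D₀ ∩ Eᶜ) + μ.real ((D ∩ E) \ D₀) := measureReal_union_le _ _
      _ ≤ 0 := by linarith
  exact h₄.not_gt (measureReal_pos_iff.2 (hne E hE))

lemma nowhereEquiv_of_condAtomless
    (h : ∀ D : Set T, MeasurableSet[𝒯] D → 0 < μ D →
      ∃ D₀ ⊆ D, MeasurableSet[𝒯] D₀ ∧
        0 < μ {t | 0 < (μ[D₀.indicator (fun _ => (1 : ℝ))|ℱ]) t ∧
          (μ[D₀.indicator (fun _ => (1 : ℝ))|ℱ]) t
            < (μ[D.indicator (fun _ => (1 : ℝ))|ℱ]) t}) :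
    NowhereEquiv 𝒯 μ ℱ := by
  intro D hD hpos
  obtain ⟨D₀, hsub, hD₀, hlt⟩ := h D hD hpos
  refine ⟨D₀, hsub, hD₀, fun E hE => pos_iff_ne_zero.2 fun h0 => hlt.ne' ?_⟩
  have hae : D₀ =ᵐ[μ] (D ∩ E : Set T) := measure_symmDiff_eq_zero_iff.1 h0
  have h₁ : D₀.indicator (fun _ => (1 : ℝ)) =ᵐ[μ]
      E.indicator (D.indicator (fun _ => (1 : ℝ))) := by
    rw [indicator_indicator, inter_comm E D]
    exact indicator_ae_eq_of_ae_eq_set hae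
  have h₂ := (condExp_congr_ae (m := ℱ) h₁).trans
    (condExp_indicator ((integrable_const (1 : ℝ)).indicator hD) hE)
  refine measure_eq_zero_iff_ae_notMem.2 ?_
  filter_upwards [h₂] with t ht htmem
  obtain ⟨ha, hb⟩ := htmem
  rw [ht] at ha hb
  by_cases htE : t ∈ E
  · simp [htE] at hb
  · simp [htE] at ha

end CondExp

end NowhereEquivalence

/-- Equivalence of nowhere equivalence, conditional atomlessness, and the existence of an
atomless independent supplement, for an atomless probability space `(T, 𝒯, μ)` with
sub-σ-algebra `ℱ ⊆ 𝒯`. -/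
theorem nowhereEquivalent_iff_condAtomless_iff_supplement
    {T : Type*} [𝒯 : MeasurableSpace T] (μ : Measure T) [IsProbabilityMeasure μ]
    (hatomless : ∀ D : Set T, MeasurableSet[𝒯] D → 0 < μ D →
      ∃ D₀ ⊆ D, MeasurableSet[𝒯] D₀ ∧ 0 < μ D₀ ∧ μ D₀ < μ D)
    (ℱ : MeasurableSpace T) (hℱ : ℱ ≤ 𝒯) :
    List.TFAE
      [ -- (i) 𝒯 is nowhere equivalent to ℱ
        (∀ D : Set T, MeasurableSet[𝒯] D → 0 < μ D →
          ∃ D₀ ⊆ D, MeasurableSet[𝒯] D₀ ∧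
            ∀ E : Set T, MeasurableSet[ℱ] E → 0 < μ (symmDiff D₀ (D ∩ E))),
        -- (ii) 𝒯 is conditionally atomless over ℱ
        (∀ D : Set T, MeasurableSet[𝒯] D → 0 < μ D →
          ∃ D₀ ⊆ D, MeasurableSet[𝒯] D₀ ∧
            0 < μ {t | 0 < (μ[D₀.indicator (fun _ => (1 : ℝ))|ℱ]) t ∧
              (μ[D₀.indicator (fun _ => (1 : ℝ))|ℱ]) t
                < (μ[D.indicator (fun _ => (1 : ℝ))|ℱ]) t}),
        -- (iii) ℱ admits an atomless independent supplement in 𝒯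
        (∃ ℋ : MeasurableSpace T, ℋ ≤ 𝒯 ∧
          (∀ C : Set T, MeasurableSet[ℋ] C → 0 < μ C →
            ∃ C₀ ⊆ C, MeasurableSet[ℋ] C₀ ∧ 0 < μ C₀ ∧ μ C₀ < μ C) ∧
          (∀ C₁ C₂ : Set T, MeasurableSet[ℱ] C₁ → MeasurableSet[ℋ] C₂ →
            μ (C₁ ∩ C₂) = μ C₁ * μ C₂)) ] := by
  tfae_have 1 → 2 := fun h D hD hpos =>
    NowhereEquivalence.NowhereEquiv.condAtomless h hℱ hD hpos
  tfae_have 2 → 1 := fun h =>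
    NowhereEquivalence.nowhereEquiv_of_condAtomless h
  tfae_have 1 → 3 := fun h =>
    NowhereEquivalence.NowhereEquiv.exists_supplement h hℱ
  tfae_have 3 → 1 := fun ⟨_, hℋ, hat, hind⟩ =>
    NowhereEquivalence.nowhereEquiv_of_supplement hℱ hℋ hat hind
  tfae_finish
end

section
/- Let (T, 𝒯, λ) be an atomless probability space and let ℱ be a sub-σ-algebra of 𝒯. If 𝒯 is conditionally atomless over ℱ, then ℱ admits an atomless independent supplement in 𝒯; in fact, there exists a 𝒯-measurable random variable U : T → [0,1] whose conditional law given ℱ is almost surely Lebesgue measure on [0,1], and the σ-algebra generated by U is atomless and independent of ℱ. -/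
open MeasureTheory Set Filter Topology

/-- A nonempty subset of the unit ball of a real Hilbert space which is cut out by closed
conditions on inner products has an extreme point. -/
theorem extremePoints_nonempty_of_inner_mem {E ι : Type*} [NormedAddCommGroup E]
    [InnerProductSpace ℝ E] [CompleteSpace E] (u : ι → E) (I : ι → Set ℝ)
    (hI : ∀ i, IsClosed (I i))
    (hne : {g : E | ‖g‖ ≤ 1 ∧ ∀ i, inner ℝ (u i) g ∈ I i}.Nonempty) :
    ({g : E | ‖g‖ ≤ 1 ∧ ∀ i, inner ℝ (u i) g ∈ I i}.extremePoints ℝ).Nonempty := by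
  set K := {g : E | ‖g‖ ≤ 1 ∧ ∀ i, inner ℝ (u i) g ∈ I i} with hK
  let e : E ≃ₗ[ℝ] WeakDual ℝ E :=
    (InnerProductSpace.toDual ℝ E).toLinearEquiv.trans StrongDual.toWeakDual
  have he : ∀ g x, e g x = inner ℝ g x := fun g x => rfl
  have hKe : e '' K = (WeakDual.toStrongDual ⁻¹' Metric.closedBall (0 : StrongDual ℝ E) 1) ∩
      ⋂ i, {φ : WeakDual ℝ E | φ (u i) ∈ I i} := by
    ext φ
    obtain ⟨g, rfl⟩ := e.surjective φ
    rw [e.injective.mem_set_image]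
    have h1 : ‖WeakDual.toStrongDual (e g)‖ = ‖g‖ :=
      (InnerProductSpace.toDual ℝ E).norm_map g
    simp only [hK, mem_ofPred_eq, mem_inter_iff, mem_preimage, mem_closedBall_zero_iff, h1,
      mem_iInter, he, real_inner_comm]
  have hcomp : IsCompact (e '' K) := by
    rw [hKe]
    refine (WeakDual.isCompact_closedBall (𝕜 := ℝ) (0 : StrongDual ℝ E) 1).inter_right
      (isClosed_iInter fun i => ?_)
    exact (hI i).preimage (WeakDual.eval_continuous (u i))
  have hloc : LocallyConvexSpace ℝ (WeakDual ℝ E) :=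
    inferInstanceAs (LocallyConvexSpace ℝ (WeakBilin (topDualPairing ℝ E)))
  obtain ⟨φ, hφ⟩ := hcomp.extremePoints_nonempty (hne.image e)
  rw [← image_extremePoints e] at hφ
  obtain ⟨g, hg, -⟩ := hφ
  exact ⟨g, hg⟩

/-- On a nontrivial event, conditional atomlessness yields a nonzero bounded function supported
there that integrates to zero over every event of `ℱ`. -/
theorem exists_bounded_perturbation {T : Type*} {ℱ 𝒯 : MeasurableSpace T} (hℱ : ℱ ≤ 𝒯)
    (μ : Measure T) [IsProbabilityMeasure μ] {E D₀ : Set T} (hE : MeasurableSet E)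
    (hD₀ : MeasurableSet D₀) (hsub : D₀ ⊆ E)
    (hpos : 0 < μ {t | 0 < (μ[D₀.indicator (fun _ => (1 : ℝ))|ℱ]) t ∧
          (μ[D₀.indicator (fun _ => (1 : ℝ))|ℱ]) t
            < (μ[E.indicator (fun _ => (1 : ℝ))|ℱ]) t}) :
    ∃ h : T → ℝ, Measurable h ∧ (∀ᵐ t ∂μ, |h t| ≤ E.indicator (fun _ => (1 : ℝ)) t) ∧
      (∀ A, MeasurableSet[ℱ] A → ∫ t in A, h t ∂μ = 0) ∧ ¬ h =ᵐ[μ] 0 := by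
  have h_ind : ∀ {A : Set T}, MeasurableSet A →
      Integrable (A.indicator fun _ => (1 : ℝ)) μ :=
    fun hA => (integrable_const 1).indicator hA
  have hD₁ : MeasurableSet (E \ D₀) := hE.diff hD₀
  set p := μ[D₀.indicator (fun _ => (1 : ℝ))|ℱ] with hp
  set q := μ[(E \ D₀).indicator (fun _ => (1 : ℝ))|ℱ] with hq
  have hbd : ∀ {A : Set T}, MeasurableSet A →
      ∀ᵐ t ∂μ, |(μ[A.indicator (fun _ => (1 : ℝ))|ℱ]) t| ≤ 1 := by
    intro A hA
    refine ae_bdd_abs_condExp_of_ae_bdd_abs (R := 1) (ae_of_all _ fun t => ?_)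
    by_cases h : t ∈ A <;> simp [h]
  have hpq : μ[E.indicator (fun _ => (1 : ℝ))|ℱ] =ᵐ[μ] p + q := by
    refine EventuallyEq.trans (condExp_congr_ae (ae_of_all _ fun t => ?_))
      (condExp_add (h_ind hD₀) (h_ind hD₁) ℱ)
    by_cases h : t ∈ D₀
    · simp [h, hsub h]
    · by_cases h' : t ∈ E <;> simp [h, h']
  have hpm : StronglyMeasurable[ℱ] p := stronglyMeasurable_condExp
  have hqm : StronglyMeasurable[ℱ] q := stronglyMeasurable_condExp
  have hbint : ∀ {f : T → ℝ} {A : Set T}, StronglyMeasurable[ℱ] f → (∀ᵐ t ∂μ, |f t| ≤ 1) →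
      MeasurableSet A → Integrable (f * A.indicator (fun _ => (1 : ℝ))) μ := by
    intro f A hf hfb hA
    exact (h_ind hA).bdd_mul (hf.mono hℱ).aestronglyMeasurable hfb
  have hqi := hbint hqm (hbd hD₁) hD₀
  have hpi := hbint hpm (hbd hD₀) hD₁
  have hce1 : μ[q * D₀.indicator (fun _ => (1 : ℝ))|ℱ] =ᵐ[μ] q * p :=
    condExp_mul_of_stronglyMeasurable_left hqm hqi (h_ind hD₀)
  have hce2 : μ[p * (E \ D₀).indicator (fun _ => (1 : ℝ))|ℱ] =ᵐ[μ] p * q :=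
    condExp_mul_of_stronglyMeasurable_left hpm hpi (h_ind hD₁)
  refine ⟨q * D₀.indicator (fun _ => (1 : ℝ)) - p * (E \ D₀).indicator (fun _ => (1 : ℝ)),
    ?_, ?_, ?_, ?_⟩
  · exact ((hqm.mono hℱ).measurable.mul (measurable_const.indicator hD₀)).sub
      ((hpm.mono hℱ).measurable.mul (measurable_const.indicator hD₁))
  · filter_upwards [hbd hD₀, hbd hD₁] with t h0 h1
    by_cases h : t ∈ D₀
    · simpa [h, hsub h] using h1
    · by_cases h' : t ∈ E
      · simpa [h, h'] using h0
      · simp [h, h']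
  · intro A hA
    rw [integral_sub' hqi.integrableOn hpi.integrableOn,
      ← setIntegral_condExp hℱ hqi hA, ← setIntegral_condExp hℱ hpi hA,
      sub_eq_zero]
    refine integral_congr_ae (ae_restrict_of_ae ?_)
    filter_upwards [hce1, hce2] with t h1 h2
    rw [h1, h2, mul_comm]
  · intro h0
    have hz : q * D₀.indicator (fun _ => (1 : ℝ)) =ᵐ[μ] 0 := by
      filter_upwards [h0] with t ht
      by_cases h : t ∈ D₀
      · simpa [h] using ht
      · simp [h]
    have hqp : q * p =ᵐ[μ] 0 := by
      refine hce1.symm.trans ((condExp_congr_ae hz).trans ?_)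
      rw [condExp_zero]
    refine hpos.ne' (measure_mono_null (t := {t | ¬ ((q * p) t = 0 ∧
      (μ[E.indicator (fun _ => (1 : ℝ))|ℱ]) t = (p + q) t)}) ?_ (hqp.and hpq))
    rintro t ⟨h1, h2⟩ ⟨h3, h4⟩
    rw [h4, Pi.add_apply] at h2
    rw [Pi.mul_apply] at h3
    exact (mul_pos (by linarith : 0 < q t) h1).ne' h3

/-- An event can be halved conditionally on `ℱ`. -/
theorem exists_conditional_half {T : Type*} {ℱ 𝒯 : MeasurableSpace T} (hℱ : ℱ ≤ 𝒯)
    (μ : Measure T) [IsProbabilityMeasure μ]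
    (hCA : ∀ D : Set T, MeasurableSet[𝒯] D → 0 < μ D →
      ∃ D₀ ⊆ D, MeasurableSet[𝒯] D₀ ∧
        0 < μ {t | 0 < (μ[D₀.indicator (fun _ => (1 : ℝ))|ℱ]) t ∧
          (μ[D₀.indicator (fun _ => (1 : ℝ))|ℱ]) t
            < (μ[D.indicator (fun _ => (1 : ℝ))|ℱ]) t})
    {D : Set T} (hD : MeasurableSet[𝒯] D) :
    ∃ D' ⊆ D, MeasurableSet[𝒯] D' ∧
      ∀ A, MeasurableSet[ℱ] A → μ.real (A ∩ D') = μ.real (A ∩ D) / 2 := by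
  let u : {A : Set T // MeasurableSet[𝒯] A} → Lp ℝ 2 μ :=
    fun A => indicatorConstLp 2 A.2 (measure_ne_top μ _) (1 : ℝ)
  let I : {A : Set T // MeasurableSet[𝒯] A} → Set ℝ := fun A =>
    Icc 0 (μ.real (A ∩ D)) ∩ {x | MeasurableSet[ℱ] A.1 → x = μ.real (A ∩ D) / 2}
  have hI : ∀ A, IsClosed (I A) := by
    intro A
    refine isClosed_Icc.inter ?_
    by_cases h : MeasurableSet[ℱ] A.1
    · simp only [h, forall_const, ← mem_singleton_iff, ofPred_mem_eq]
      exact isClosed_singleton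
    · simp [h]
  have hinner : ∀ A (g : Lp ℝ 2 μ), inner ℝ (u A) g = ∫ t in A.1, g t ∂μ :=
    fun A g => L2.inner_indicatorConstLp_one A.2 (measure_ne_top μ _) g
  set K := {g : Lp ℝ 2 μ | ‖g‖ ≤ 1 ∧ ∀ A, inner ℝ (u A) g ∈ I A} with hK
  have hDint : Integrable (D.indicator fun _ => (1 : ℝ)) μ := (integrable_const 1).indicator hD
  have hDset : ∀ A, ∫ t in A, D.indicator (fun _ => (1 : ℝ)) t ∂μ = μ.real (A ∩ D) := by
    intro A
    rw [setIntegral_indicator hD]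
    simp
  have hmemK : ∀ (f : T → ℝ) (hf : AEStronglyMeasurable f μ)
      (_ : ∀ᵐ t ∂μ, 0 ≤ f t ∧ f t ≤ D.indicator (fun _ => (1 : ℝ)) t)
      (_ : ∀ A, MeasurableSet[ℱ] A → ∫ t in A, f t ∂μ = μ.real (A ∩ D) / 2),
      ∀ g : Lp ℝ 2 μ, g =ᵐ[μ] f → g ∈ K := by
    intro f hf hfb hfA g hgf
    have hfi : Integrable f μ := by
      refine hDint.mono' hf (hfb.mono fun t ht => ?_)
      rw [Real.norm_of_nonneg ht.1]
      exact ht.2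
    refine ⟨?_, fun A => ?_⟩
    · refine (Lp.norm_le_of_ae_bound (C := 1) zero_le_one ?_).trans (by simp [measureUnivNNReal])
      filter_upwards [hgf, hfb] with t h1 h2
      rw [h1, Real.norm_of_nonneg h2.1]
      exact h2.2.trans (indicator_le_self' (fun _ _ => zero_le_one) t)
    · rw [hinner, setIntegral_congr_ae A.2 (hgf.mono fun t ht _ => ht)]
      refine ⟨⟨setIntegral_nonneg_of_ae (hfb.mono fun t h => h.1), ?_⟩, fun hA => hfA A hA⟩
      rw [← hDset]
      exact setIntegral_mono_ae hfi.integrableOn hDint.integrableOn (hfb.mono fun t h => h.2)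
  have hKspec : ∀ g ∈ K, (∀ᵐ t ∂μ, 0 ≤ g t ∧ g t ≤ D.indicator (fun _ => (1 : ℝ)) t) ∧
      ∀ A, MeasurableSet[ℱ] A → ∫ t in A, g t ∂μ = μ.real (A ∩ D) / 2 := by
    rintro g ⟨-, hg⟩
    have hgi : Integrable g μ := (Lp.memLp g).integrable one_le_two
    simp only [hinner] at hg
    refine ⟨?_, fun A hA => (hg ⟨A, hℱ A hA⟩).2 hA⟩
    filter_upwards [ae_nonneg_of_forall_setIntegral_nonneg hgi
        fun s hs _ => (hg ⟨s, hs⟩).1.1,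
      ae_le_of_forall_setIntegral_le hgi hDint
        fun s hs _ => by rw [hDset]; exact (hg ⟨s, hs⟩).1.2] with t h1 h2
    exact ⟨h1, h2⟩
  have hne : K.Nonempty := by
    have hm : MemLp (fun t => D.indicator (fun _ => (1 : ℝ)) t / 2) 2 μ :=
      by
      simpa only [div_eq_mul_inv] using
        (MemLp.indicator hD (memLp_const (1 : ℝ))).mul_const (2 : ℝ)⁻¹
    refine ⟨hm.toLp _, hmemK _ hm.1 (ae_of_all _ fun t => ?_) (fun A _ => ?_) _ hm.coeFn_toLp⟩
    · by_cases h : t ∈ D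
      · simp only [h, indicator_of_mem]; norm_num
      · simp [h]
    · rw [integral_div, hDset]
  obtain ⟨g, hg⟩ := extremePoints_nonempty_of_inner_mem u I hI hne
  rw [mem_extremePoints] at hg
  obtain ⟨hgK, hgext⟩ := hg
  obtain ⟨hgb, hgA⟩ := hKspec g hgK
  have hgi : Integrable g μ := (Lp.memLp g).integrable one_le_two
  have hgm : Measurable g := (Lp.stronglyMeasurable g).measurable
  have hmid : ∀ ε : ℝ, 0 < ε → μ {t | ε ≤ g t ∧ g t ≤ 1 - ε} = 0 := by
    intro ε hε
    by_contra hμ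
    set E := {t | ε ≤ g t ∧ g t ≤ 1 - ε} with hEdef
    have hEm : MeasurableSet E :=
      (measurableSet_le measurable_const hgm).inter (measurableSet_le hgm measurable_const)
    obtain ⟨D₀, hsub, hD₀, hpos⟩ := hCA E hEm (pos_iff_ne_zero.2 hμ)
    obtain ⟨h, hhm, hhb, hhA, hh0⟩ := exists_bounded_perturbation hℱ μ hEm hD₀ hsub hpos
    have hhle : ∀ᵐ t ∂μ, ‖h t‖ ≤ 1 := hhb.mono fun t ht =>
      ht.trans (indicator_le_self' (fun _ _ => zero_le_one) t)
    have hh2 : MemLp h 2 μ := MemLp.of_bound hhm.aestronglyMeasurable 1 hhle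
    have hhi : Integrable h μ := hh2.integrable one_le_two
    have key : ∀ c : ℝ, |c| ≤ ε → g + c • hh2.toLp h ∈ K := by
      intro c hc
      refine hmemK (fun t => g t + c * h t)
        (hgm.add (hhm.const_mul c)).aestronglyMeasurable ?_ ?_ _ ?_
      · filter_upwards [hhb, hgb] with t h1 h2
        by_cases ht : t ∈ E
        · have h3 : |c * h t| ≤ ε := by
            rw [abs_mul]
            simp only [ht, indicator_of_mem] at h1
            nlinarith [abs_nonneg c, abs_nonneg (h t)]
          have h4 : t ∈ D := by
            by_contra h4
            simp only [h4, not_false_eq_true, indicator_of_notMem] at h2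
            linarith [ht.1]
          simp only [h4, indicator_of_mem]
          rw [abs_le] at h3
          constructor <;> linarith [ht.1, ht.2]
        · simp only [ht, not_false_eq_true, indicator_of_notMem] at h1
          rw [abs_nonpos_iff.1 h1, mul_zero, add_zero]
          exact h2
      · intro A hA
        rw [integral_add hgi.integrableOn (hhi.const_mul c).integrableOn, integral_const_mul,
          hhA A hA, hgA A hA, mul_zero, add_zero]
      · filter_upwards [Lp.coeFn_add g (c • hh2.toLp h), Lp.coeFn_smul c (hh2.toLp h),
          hh2.coeFn_toLp] with t h1 h2 h3
        rw [h1, Pi.add_apply, h2, Pi.smul_apply, h3, smul_eq_mul]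
    have hseg : g ∈ openSegment ℝ (g + ε • hh2.toLp h) (g + (-ε) • hh2.toLp h) := by
      refine ⟨1 / 2, 1 / 2, by norm_num, by norm_num, by norm_num, ?_⟩
      module
    have := (hgext _ (key ε (abs_of_pos hε).le) _
      (key (-ε) (by rw [abs_neg, abs_of_pos hε])) hseg).1
    rw [add_eq_left, smul_eq_zero, or_iff_right hε.ne'] at this
    apply hh0
    refine hh2.coeFn_toLp.symm.trans ?_
    rw [this]
    exact Lp.coeFn_zero _ _ _
  have h01 : ∀ᵐ t ∂μ, g t ≤ 0 ∨ 1 ≤ g t := by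
    have : ∀ᵐ t ∂μ, ∀ n : ℕ, ¬ (1 / ((n : ℝ) + 1) ≤ g t ∧ g t ≤ 1 - 1 / ((n : ℝ) + 1)) :=
      ae_all_iff.2 fun n => by
        simpa [ae_iff] using hmid (1 / ((n : ℝ) + 1)) (by positivity)
    filter_upwards [this] with t ht
    by_contra! hc
    obtain ⟨n, hn⟩ := exists_nat_one_div_lt (lt_min hc.1 (sub_pos.2 hc.2))
    exact ht n ⟨(hn.le.trans (min_le_left _ _)), by linarith [hn.le.trans (min_le_right _ _)]⟩
  have hD'm : MeasurableSet (D ∩ {t | 1 ≤ g t}) :=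
    hD.inter (measurableSet_le measurable_const hgm)
  refine ⟨D ∩ {t | 1 ≤ g t}, inter_subset_left, hD'm, fun A hA => ?_⟩
  rw [← hgA A hA]
  have : g =ᵐ[μ] (D ∩ {t | 1 ≤ g t}).indicator fun _ => (1 : ℝ) := by
    filter_upwards [h01, hgb] with t h1 h2
    by_cases ht : t ∈ D
    · simp only [ht, indicator_of_mem] at h2
      rcases h1 with h1 | h1
      · have h3 : g t = 0 := le_antisymm h1 h2.1
        simp [h3]
      · have h3 : g t = 1 := le_antisymm h2.2 h1
        simp [h3, ht]
    · simp only [ht, not_false_eq_true, indicator_of_notMem] at h2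
      simp [ht, le_antisymm h2.2 h2.1]
  rw [setIntegral_congr_ae (hℱ A hA) (this.mono fun t ht _ => ht), setIntegral_indicator hD'm]
  simp

/-- Appending one conditionally fair binary digit to an integer-valued random variable. -/
theorem exists_conditional_binary_digit {T : Type*} {ℱ 𝒯 : MeasurableSpace T}
    (hℱ : ℱ ≤ 𝒯) (μ : Measure T) [IsProbabilityMeasure μ]
    (hhalf : ∀ D : Set T, MeasurableSet[𝒯] D → ∃ D' ⊆ D, MeasurableSet[𝒯] D' ∧
      ∀ A, MeasurableSet[ℱ] A → μ.real (A ∩ D') = μ.real (A ∩ D) / 2)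
    (X : T → ℕ) (hX : Measurable[𝒯] X) :
    ∃ Y : T → ℕ, Measurable[𝒯] Y ∧ (∀ t, Y t = 2 * X t ∨ Y t = 2 * X t + 1) ∧
      ∀ A, MeasurableSet[ℱ] A → ∀ k,
        μ.real (A ∩ Y ⁻¹' {k}) = μ.real (A ∩ X ⁻¹' {k / 2}) / 2 := by
  classical
  have hfib : ∀ k, MeasurableSet[𝒯] (X ⁻¹' {k}) := fun k => hX (measurableSet_singleton k)
  choose H hHsub hHm hH using fun k => hhalf _ (hfib k)
  have hHX : ∀ k t, t ∈ H k → X t = k := fun k t ht => hHsub k ht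
  let Y : T → ℕ := fun t => if t ∈ H (X t) then 2 * X t + 1 else 2 * X t
  have hodd : ∀ k, Y ⁻¹' {2 * k + 1} = H k := by
    intro k
    ext t
    simp only [Y, mem_preimage, mem_singleton_iff]
    constructor
    · intro h
      split_ifs at h with h'
      · have : X t = k := by omega
        rwa [this] at h'
      · omega
    · intro h
      have h2 := hHX k t h
      rw [h2, if_pos h]
  have heven : ∀ k, Y ⁻¹' {2 * k} = X ⁻¹' {k} \ H k := by
    intro k
    ext t
    simp only [Y, mem_preimage, mem_singleton_iff, Set.mem_sdiff]
    constructor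
    · intro h
      split_ifs at h with h'
      · omega
      · have : X t = k := by omega
        rw [this] at h'
        exact ⟨this, h'⟩
    · rintro ⟨h, h'⟩
      rw [h, if_neg h']
  refine ⟨Y, ?_, fun t => ?_, fun A hA k => ?_⟩
  · refine measurable_to_countable' fun k => ?_
    rcases Nat.even_or_odd' k with ⟨j, rfl | rfl⟩
    · rw [heven]; exact (hfib j).diff (hHm j)
    · rw [hodd]; exact hHm j
  · by_cases h : t ∈ H (X t) <;> simp [Y, h]
  · rcases Nat.even_or_odd' k with ⟨j, rfl | rfl⟩
    · rw [heven, Nat.mul_div_cancel_left _ two_pos, inter_sdiff_distrib_left,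
        measureReal_sdiff (inter_subset_inter_right A (hHsub j)) ((hℱ A hA).inter (hHm j)),
        hH j A hA]
      ring
    · rw [hodd, hH j A hA, (by omega : (2 * j + 1) / 2 = j)]

/-- If events can be halved conditionally on `ℱ`, there is a `[0,1]`-valued random variable which
is uniformly distributed and independent of `ℱ`. -/
theorem exists_uniform_of_conditional_half {T : Type*} {ℱ 𝒯 : MeasurableSpace T}
    (hℱ : ℱ ≤ 𝒯) (μ : Measure T) [IsProbabilityMeasure μ]
    (hhalf : ∀ D : Set T, MeasurableSet[𝒯] D → ∃ D' ⊆ D, MeasurableSet[𝒯] D' ∧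
      ∀ A, MeasurableSet[ℱ] A → μ.real (A ∩ D') = μ.real (A ∩ D) / 2) :
    ∃ U : T → ℝ, Measurable[𝒯] U ∧ (∀ t, U t ∈ Icc (0 : ℝ) 1) ∧
      ∀ A B, MeasurableSet[ℱ] A → MeasurableSet B →
        μ (A ∩ U ⁻¹' B) = μ A * (volume.restrict (Icc (0 : ℝ) 1)) B := by
  choose! step hnm hnext hnlaw using exists_conditional_binary_digit hℱ μ hhalf
  obtain ⟨X, hX0, hXs⟩ : ∃ X : ℕ → T → ℕ, X 0 = (fun _ => 0) ∧ ∀ n, X (n + 1) = step (X n) :=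
    ⟨fun n => n.rec (fun _ => 0) fun _ => step, rfl, fun _ => rfl⟩
  have hXm : ∀ n, Measurable[𝒯] (X n) := by
    intro n
    induction n with
    | zero => rw [hX0]; exact measurable_const
    | succ n ih => rw [hXs]; exact hnm _ ih
  have hXrec : ∀ n t, X (n + 1) t = 2 * X n t ∨ X (n + 1) t = 2 * X n t + 1 :=
    fun n t => by rw [hXs]; exact hnext _ (hXm n) t
  have hfib : ∀ A, MeasurableSet[ℱ] A → ∀ n k, k < 2 ^ n →
      μ.real (A ∩ X n ⁻¹' {k}) = μ.real A / 2 ^ n := by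
    intro A hA n
    induction n with
    | zero =>
      intro k hk
      have : X 0 ⁻¹' {k} = univ := by
        ext t
        simp only [hX0, mem_preimage, mem_singleton_iff, mem_univ, iff_true]
        omega
      simp [this]
    | succ n ih =>
      intro k hk
      rw [hXs, hnlaw _ (hXm n) A hA k, ih _ (by omega), pow_succ]
      ring
  have hlt : ∀ A, MeasurableSet[ℱ] A → ∀ n k, k ≤ 2 ^ n →
      μ.real (A ∩ {t | X n t < k}) = μ.real A * k / 2 ^ n := by
    intro A hA n k
    induction k with
    | zero => simp
    | succ k ih =>
      intro hk
      have hs : A ∩ {t | X n t < k + 1} = (A ∩ {t | X n t < k}) ∪ (A ∩ X n ⁻¹' {k}) := by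
        ext t
        simp only [mem_inter_iff, mem_ofPred_eq, mem_union, mem_preimage, mem_singleton_iff,
          Nat.lt_succ_iff_lt_or_eq]
        tauto
      rw [hs, measureReal_union, ih (by omega), hfib A hA n k (by omega)]
      · push_cast; ring
      · rw [disjoint_left]
        rintro t ⟨-, h1⟩ ⟨-, h2⟩
        simp only [mem_ofPred_eq, mem_preimage, mem_singleton_iff] at h1 h2
        omega
      · exact (hℱ A hA).inter (hXm n (measurableSet_singleton k))
  have hXlt : ∀ n t, X n t + 1 ≤ 2 ^ n := by
    intro n t
    induction n with
    | zero => simp [hX0]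
    | succ n ih => rcases hXrec n t with h | h <;> rw [h, pow_succ] <;> omega
  let a : ℕ → T → ℝ := fun n t => X n t / 2 ^ n
  let b : ℕ → T → ℝ := fun n t => (X n t + 1) / 2 ^ n
  have hmono : ∀ t, Monotone fun n => a n t := by
    refine fun t => monotone_nat_of_le_succ fun n => ?_
    simp only [a]
    rw [div_le_div_iff₀ (by positivity) (by positivity), pow_succ]
    have : (2 * X n t : ℝ) ≤ X (n + 1) t := by
      exact_mod_cast (by rcases hXrec n t with h | h <;> omega : 2 * X n t ≤ X (n + 1) t)
    nlinarith [pow_pos (two_pos : (0 : ℝ) < 2) n]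
  have hanti : ∀ t, Antitone fun n => b n t := by
    refine fun t => antitone_nat_of_succ_le fun n => ?_
    simp only [b]
    rw [div_le_div_iff₀ (by positivity) (by positivity), pow_succ]
    have : (X (n + 1) t : ℝ) ≤ 2 * X n t + 1 := by
      exact_mod_cast (by rcases hXrec n t with h | h <;> omega : X (n + 1) t ≤ 2 * X n t + 1)
    nlinarith [pow_pos (two_pos : (0 : ℝ) < 2) n]
  have hab : ∀ n m t, a n t ≤ b m t := by
    intro n m t
    calc a n t ≤ a (max n m) t := hmono t (le_max_left _ _)
      _ ≤ b (max n m) t := by simp only [a, b]; gcongr; linarith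
      _ ≤ b m t := hanti t (le_max_right _ _)
  let U : T → ℝ := fun t => ⨆ n, a n t
  have hbdd : ∀ t, BddAbove (range fun n => a n t) := by
    refine fun t => ⟨b 0 t, ?_⟩
    rintro _ ⟨n, rfl⟩
    exact hab n 0 t
  have haU : ∀ n t, a n t ≤ U t := fun n t => le_ciSup (hbdd t) n
  have hUb : ∀ n t, U t ≤ b n t := fun n t => ciSup_le fun m => hab m n t
  have hUm : Measurable[𝒯] U := by
    refine Measurable.iSup fun n => ?_
    exact ((measurable_from_top (f := fun k : ℕ => (k : ℝ))).comp (hXm n)).div_const _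
  have hU01 : ∀ t, U t ∈ Icc (0 : ℝ) 1 := by
    refine fun t => ⟨?_, ?_⟩
    · simpa [a, hX0] using haU 0 t
    · simpa [b, hX0] using hUb 0 t
  refine ⟨U, hUm, hU01, ?_⟩
  have hcdf : ∀ A, MeasurableSet[ℱ] A → ∀ x, 0 ≤ x → x < 1 →
      μ.real (A ∩ U ⁻¹' Iic x) = μ.real A * x := by
    intro A hA x hx0 hx1
    have hA1 : μ.real A ≤ 1 := measureReal_le_one
    have hclose : ∀ n : ℕ, |μ.real (A ∩ U ⁻¹' Iic x) - μ.real A * x| ≤ (1 / 2) ^ n := by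
      intro n
      have h2 : (0 : ℝ) < 2 ^ n := by positivity
      set k := ⌊x * 2 ^ n⌋₊ with hk
      have hk1 : (k : ℝ) ≤ x * 2 ^ n := Nat.floor_le (by positivity)
      have hk2 : x * 2 ^ n < k + 1 := Nat.lt_floor_add_one _
      have hkn : k + 1 ≤ 2 ^ n := by
        have : (k : ℝ) < 2 ^ n := by nlinarith
        exact_mod_cast this
      have hlow : μ.real (A ∩ {t | X n t < k}) ≤ μ.real (A ∩ U ⁻¹' Iic x) := by
        refine measureReal_mono (inter_subset_inter_right A fun t ht => ?_)
        have h3 : ((X n t : ℝ) + 1) ≤ k := by exact_mod_cast ht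
        refine (hUb n t).trans ?_
        simp only [b]
        rw [div_le_iff₀ h2]
        linarith
      have hup : μ.real (A ∩ U ⁻¹' Iic x) ≤ μ.real (A ∩ {t | X n t < k + 1}) := by
        refine measureReal_mono (inter_subset_inter_right A fun t ht => ?_)
        have h3 : a n t ≤ x := (haU n t).trans ht
        simp only [a] at h3
        rw [div_le_iff₀ h2] at h3
        have : (X n t : ℝ) < k + 1 := by linarith
        exact_mod_cast this
      rw [hlt A hA n k (by omega), div_le_iff₀ h2] at hlow
      rw [hlt A hA n (k + 1) hkn, le_div_iff₀ h2] at hup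
      push_cast at hup
      have hA0 : 0 ≤ μ.real A := measureReal_nonneg
      have h3 := mul_le_mul_of_nonneg_left hk1 hA0
      have h4 := mul_le_mul_of_nonneg_left hk2.le hA0
      rw [one_div_pow, abs_sub_le_iff, le_div_iff₀ h2, le_div_iff₀ h2]
      constructor <;> linarith
    have h0 : Tendsto (fun n : ℕ => ((1 : ℝ) / 2) ^ n) atTop (𝓝 0) :=
      tendsto_pow_atTop_nhds_zero_of_lt_one (by norm_num) (by norm_num)
    have := abs_nonpos_iff.1 (ge_of_tendsto' h0 hclose)
    linarith
  intro A B hA hB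
  have hmeas : (μ.restrict A).map U = μ A • volume.restrict (Icc (0 : ℝ) 1) := by
    have : IsFiniteMeasure (μ A • volume.restrict (Icc (0 : ℝ) 1)) :=
      Measure.smul_finite _ (measure_ne_top μ A)
    refine Measure.ext_of_Iic _ _ fun x => ?_
    rw [Measure.map_apply hUm measurableSet_Iic,
      Measure.restrict_apply (hUm measurableSet_Iic), Measure.smul_apply,
      Measure.restrict_apply measurableSet_Iic, smul_eq_mul, inter_comm]
    rcases lt_or_ge x 0 with hx0 | hx0
    · have h1 : U ⁻¹' Iic x = ∅ := by
        ext t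
        simpa using hx0.trans_le (hU01 t).1
      have h2 : Iic x ∩ Icc (0 : ℝ) 1 = ∅ := by
        ext y
        simp only [mem_inter_iff, mem_Iic, mem_Icc, mem_empty_iff_false, iff_false]
        intro h
        linarith [h.1, h.2.1]
      simp [h1, h2]
    · rcases lt_or_ge x 1 with hx1 | hx1
      · have h2 : Iic x ∩ Icc (0 : ℝ) 1 = Icc 0 x := by
          ext y
          simp only [mem_inter_iff, mem_Iic, mem_Icc]
          constructor
          · exact fun h => ⟨h.2.1, h.1⟩
          · exact fun h => ⟨h.2, h.1, h.2.trans hx1.le⟩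
        rw [h2, Real.volume_Icc, sub_zero, ← ofReal_measureReal (μ := μ) (s := A),
          ← ENNReal.ofReal_mul measureReal_nonneg, ← hcdf A hA x hx0 hx1, ofReal_measureReal]
      · have h1 : U ⁻¹' Iic x = univ := by
          ext t
          simpa using (hU01 t).2.trans hx1
        have h2 : Iic x ∩ Icc (0 : ℝ) 1 = Icc 0 1 :=
          inter_eq_right.2 fun y hy => hy.2.trans hx1
        simp [h1, h2]
  have := congrArg (fun ν => ν B) hmeas
  simpa [Measure.map_apply hUm hB, Measure.restrict_apply (hUm hB), inter_comm] using this

/-- Lebesgue measure on the unit interval is atomless. -/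
theorem exists_subset_volume_restrict_Icc_lt {B : Set ℝ} (hB : MeasurableSet B)
    (hpos : 0 < (volume.restrict (Icc (0 : ℝ) 1)) B) :
    ∃ B₀ ⊆ B, MeasurableSet B₀ ∧ 0 < (volume.restrict (Icc (0 : ℝ) 1)) B₀ ∧
      (volume.restrict (Icc (0 : ℝ) 1)) B₀ < (volume.restrict (Icc (0 : ℝ) 1)) B := by
  set ν := volume.restrict (Icc (0 : ℝ) 1) with hν
  obtain ⟨δ, hδ0, hδ⟩ := ENNReal.lt_iff_exists_nnreal_btwn.1 hpos
  have hδ0' : (0 : ℝ) < δ := by exact_mod_cast hδ0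
  have hcover : B ⊆ ⋃ z : ℤ, B ∩ Ico (z • (δ : ℝ)) ((z + 1) • (δ : ℝ)) := by
    rw [← inter_iUnion, iUnion_Ico_zsmul hδ0', inter_univ]
  obtain ⟨z, hz⟩ : ∃ z : ℤ, ν (B ∩ Ico (z • (δ : ℝ)) ((z + 1) • (δ : ℝ))) ≠ 0 := by
    by_contra! h
    exact hpos.ne' (measure_mono_null hcover (measure_iUnion_null h))
  refine ⟨_, inter_subset_left, hB.inter measurableSet_Ico, pos_iff_ne_zero.2 hz,
    lt_of_le_of_lt ?_ hδ⟩
  calc ν (B ∩ Ico (z • (δ : ℝ)) ((z + 1) • (δ : ℝ)))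
      ≤ volume (Ico (z • (δ : ℝ)) ((z + 1) • (δ : ℝ))) :=
        (measure_mono inter_subset_right).trans (Measure.restrict_apply_le _ _)
    _ = δ := by
        rw [Real.volume_Ico, add_zsmul, one_zsmul, add_sub_cancel_left,
          ENNReal.ofReal_coe_nnreal]

/-- If `𝒯` is conditionally atomless over `ℱ`, then `ℱ` admits an atomless independent
supplement in `𝒯`; in fact there is a `𝒯`-measurable `U : T → [0,1]` whose conditional
law given `ℱ` is a.s. Lebesgue measure on `[0,1]`, and the σ-algebra generated by `U`
is atomless and independent of `ℱ`. -/
theorem condAtomless_implies_supplement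
    {T : Type*} [𝒯 : MeasurableSpace T] (μ : Measure T) [IsProbabilityMeasure μ]
    (hatomless : ∀ D : Set T, MeasurableSet[𝒯] D → 0 < μ D →
      ∃ D₀ ⊆ D, MeasurableSet[𝒯] D₀ ∧ 0 < μ D₀ ∧ μ D₀ < μ D)
    (ℱ : MeasurableSpace T) (hℱ : ℱ ≤ 𝒯)
    (hCA : ∀ D : Set T, MeasurableSet[𝒯] D → 0 < μ D →
      ∃ D₀ ⊆ D, MeasurableSet[𝒯] D₀ ∧
        0 < μ {t | 0 < (μ[D₀.indicator (fun _ => (1 : ℝ))|ℱ]) t ∧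
          (μ[D₀.indicator (fun _ => (1 : ℝ))|ℱ]) t
            < (μ[D.indicator (fun _ => (1 : ℝ))|ℱ]) t}) :
    ∃ U : T → ℝ, Measurable[𝒯] U ∧ (∀ t, U t ∈ Set.Icc (0 : ℝ) 1) ∧
      -- the conditional law of `U` given `ℱ` is a.s. Lebesgue measure on `[0,1]`
      (∀ B : Set ℝ, MeasurableSet B →
        μ[(U ⁻¹' B).indicator (fun _ => (1 : ℝ))|ℱ]
          =ᵐ[μ] fun _ => ((volume.restrict (Set.Icc (0 : ℝ) 1)) B).toReal) ∧
      -- the σ-algebra generated by `U` is atomless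
      (∀ C : Set T, MeasurableSet[MeasurableSpace.comap U inferInstance] C → 0 < μ C →
        ∃ C₀ ⊆ C, MeasurableSet[MeasurableSpace.comap U inferInstance] C₀ ∧
          0 < μ C₀ ∧ μ C₀ < μ C) ∧
      -- the σ-algebra generated by `U` is independent of `ℱ`
      (∀ C₁ C₂ : Set T, MeasurableSet[ℱ] C₁ →
        MeasurableSet[MeasurableSpace.comap U inferInstance] C₂ →
        μ (C₁ ∩ C₂) = μ C₁ * μ C₂) := by
  obtain ⟨U, hUm, hU01, hU⟩ := exists_uniform_of_conditional_half hℱ μ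
    fun D hD => exists_conditional_half hℱ μ hCA hD
  have hlaw : ∀ B, MeasurableSet B → μ (U ⁻¹' B) = (volume.restrict (Icc (0 : ℝ) 1)) B := by
    intro B hB
    simpa using hU univ B MeasurableSet.univ hB
  refine ⟨U, hUm, hU01, fun B hB => ?_, ?_, ?_⟩
  · have hi : Integrable ((U ⁻¹' B).indicator fun _ => (1 : ℝ)) μ :=
      (integrable_const 1).indicator (hUm hB)
    refine (ae_eq_condExp_of_forall_setIntegral_eq hℱ hi
      (fun A _ _ => (integrable_const _).integrableOn) (fun A hA _ => ?_)
      stronglyMeasurable_const.aestronglyMeasurable).symm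
    rw [setIntegral_indicator (hUm hB)]
    simp [Measure.real, hU A B hA hB]
  · rintro _ ⟨B, hB, rfl⟩ hpos
    rw [hlaw B hB] at hpos
    obtain ⟨B₀, hsub, hB₀, h0, hlt⟩ := exists_subset_volume_restrict_Icc_lt hB hpos
    refine ⟨U ⁻¹' B₀, preimage_mono hsub, ⟨B₀, hB₀, rfl⟩, ?_⟩
    rw [hlaw B hB, hlaw B₀ hB₀]
    exact ⟨h0, hlt⟩
  · rintro A _ hA ⟨B, hB, rfl⟩
    rw [hU A B hA hB, hlaw B hB]
end

section
/- Let (T, 𝒯, λ) be an atomless probability space and let ℱ be a sub-σ-algebra of 𝒯. If 𝒯 is nowhere equivalent to ℱ, then there exists a 𝒯-measurable function U : T → [0,1] whose law λ ∘ U⁻¹ is Lebesgue measure on [0,1] and such that the σ-algebra generated by U is independent of ℱ (i.e., λ(C₁ ∩ U⁻¹(B)) = λ(C₁)·m(B) for all C₁ ∈ ℱ and Borel B ⊆ [0,1], where m is Lebesgue measure). -/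
open MeasureTheory Set Filter Topology

/-- Hahn decomposition of two finite measures relative to a sub-σ-algebra. -/
lemma exists_hahn_of_le {T : Type*} {ℱ 𝒯 : MeasurableSpace T} (hℱ : ℱ ≤ 𝒯)
    (α β : Measure T) [IsFiniteMeasure α] [IsFiniteMeasure β] :
    ∃ S, MeasurableSet[ℱ] S ∧
      (∀ C, MeasurableSet[ℱ] C → C ⊆ S → α.real C ≤ β.real C) ∧
      ∀ C, MeasurableSet[ℱ] C → Disjoint C S → β.real C ≤ α.real C := by
  obtain ⟨S, hS, h₁, h₂⟩ := @hahn_decomposition T ℱ (β.trim hℱ) (α.trim hℱ)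
    (isFiniteMeasure_trim hℱ) (isFiniteMeasure_trim hℱ)
  refine ⟨S, hS, fun C hC hCS ↦ ?_, fun C hC hCS ↦ ?_⟩
  · have := h₁ C hC hCS
    rw [trim_measurableSet_eq hℱ hC, trim_measurableSet_eq hℱ hC] at this
    exact ENNReal.toReal_mono (measure_ne_top _ _) this
  · have := h₂ C hC hCS.subset_compl_right
    rw [trim_measurableSet_eq hℱ hC, trim_measurableSet_eq hℱ hC] at this
    exact ENNReal.toReal_mono (measure_ne_top _ _) this

/-- A family of sets that contains `∅` and is closed under countable increasing unions has a
member that cannot be enlarged inside the family by a set of positive measure. -/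
lemma exists_maximal_measureReal {T : Type*} [MeasurableSpace T] (μ : Measure T)
    [IsFiniteMeasure μ] (P : Set T → Prop) (h_empty : P ∅)
    (h_union : ∀ f : ℕ → Set T, Monotone f → (∀ n, P (f n)) → P (⋃ n, f n)) :
    ∃ B, P B ∧ ∀ B', B ⊆ B' → P B' → μ.real B' ≤ μ.real B := by
  have step : ∀ B : {B // P B}, ∃ B' : {B // P B}, B.1 ⊆ B'.1 ∧ ∀ B'', B.1 ⊆ B'' → P B'' →
      μ.real B'' - μ.real B'.1 ≤ μ.real B'.1 - μ.real B.1 := by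
    rintro ⟨B, hB⟩
    by_cases h : ∃ B', B ⊆ B' ∧ P B' ∧ μ.real B < μ.real B'
    · obtain ⟨B₁, hB₁, hPB₁, hlt⟩ := h
      set V : Set ℝ := μ.real '' {B' | B ⊆ B' ∧ P B'}
      have hV : BddAbove V := by
        refine ⟨μ.real univ, ?_⟩
        rintro _ ⟨B', -, rfl⟩
        exact measureReal_mono (subset_univ _)
      have hle : ∀ B', B ⊆ B' → P B' → μ.real B' ≤ sSup V :=
        fun B' h h' ↦ le_csSup hV ⟨B', ⟨h, h'⟩, rfl⟩
      have hlt' : (sSup V + μ.real B) / 2 < sSup V := by linarith [hle B₁ hB₁ hPB₁]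
      obtain ⟨_, ⟨B', ⟨hBB', hPB'⟩, rfl⟩, h'⟩ :=
        exists_lt_of_lt_csSup (show V.Nonempty from ⟨_, B, ⟨subset_rfl, hB⟩, rfl⟩) hlt'
      refine ⟨⟨B', hPB'⟩, hBB', fun B'' h hP ↦ ?_⟩
      have := hle B'' h hP
      dsimp only
      linarith
    · push Not at h
      refine ⟨⟨B, hB⟩, subset_rfl, fun B'' h' hP ↦ ?_⟩
      have := h B'' h' hP
      dsimp only
      linarith
  choose g hg hg' using step
  let f : ℕ → {B // P B} := fun n ↦ g^[n] ⟨∅, h_empty⟩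
  have hf : ∀ n, f (n + 1) = g (f n) := fun n ↦ Function.iterate_succ_apply' _ _ _
  have hmono : Monotone fun n ↦ (f n).1 := monotone_nat_of_le_succ fun n ↦ by
    rw [hf]; exact hg _
  refine ⟨⋃ n, (f n).1, h_union _ hmono fun n ↦ (f n).2, fun B' hB' hP ↦ ?_⟩
  have hlim : Tendsto (fun n ↦ μ.real (f n).1) atTop (𝓝 (μ.real (⋃ n, (f n).1))) :=
    (ENNReal.tendsto_toReal (measure_ne_top _ _)).comp (tendsto_measure_iUnion_atTop hmono)
  have hlim' := hlim.comp (tendsto_add_atTop_nat 1)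
  have := le_of_tendsto_of_tendsto' (tendsto_const_nhds.sub hlim') (hlim'.sub hlim)
    fun n ↦ (by
      have := hg' (f n) B' ((subset_iUnion (fun n ↦ (f n).1) n).trans hB') hP
      rw [← hf] at this
      exact this)
  linarith

section Halving

variable {T : Type*} {ℱ 𝒯 : MeasurableSpace T} {μ : Measure T} [IsFiniteMeasure μ]

lemma exists_subset_two_mul_le (hℱ : ℱ ≤ 𝒯)
    (hNE : ∀ D : Set T, MeasurableSet D → 0 < μ D →
      ∃ D₀ ⊆ D, MeasurableSet D₀ ∧
        ∀ E : Set T, MeasurableSet[ℱ] E → 0 < μ (symmDiff D₀ (D ∩ E)))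
    {D : Set T} (hD : MeasurableSet D) (hμD : 0 < μ D) :
    ∃ D₁ ⊆ D, MeasurableSet D₁ ∧ 0 < μ D₁ ∧
      ∀ C, MeasurableSet[ℱ] C → 2 * μ.real (C ∩ D₁) ≤ μ.real (C ∩ D) := by
  obtain ⟨D₀, hD₀D, hD₀, hpos⟩ := hNE D hD hμD
  obtain ⟨S, hS, h₁, h₂⟩ := exists_hahn_of_le hℱ (μ.restrict D₀) (μ.restrict (D \ D₀))
  have hS' := hℱ _ hS
  refine ⟨symmDiff D₀ (D ∩ Sᶜ), ?_, hD₀.symmDiff (hD.inter hS'.compl), hpos _ hS.compl,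
    fun C hC ↦ ?_⟩
  · rintro x (hx | hx)
    exacts [hD₀D hx.1, hx.1.1]
  have hC' := hℱ _ hC
  have e₁ := h₁ (C ∩ S) (hC.inter hS) inter_subset_right
  have e₂ := h₂ (C \ S) (hC.diff hS) disjoint_sdiff_left
  simp only [measureReal_restrict_apply (hC'.inter hS'),
    measureReal_restrict_apply (hC'.diff hS')] at e₁ e₂
  have a₁ := measureReal_inter_add_sdiff (μ := μ) (s := C ∩ symmDiff D₀ (D ∩ Sᶜ)) hS'
  have a₂ := measureReal_inter_add_sdiff (μ := μ) (s := C ∩ D) hS'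
  have a₃ := measureReal_inter_add_sdiff (μ := μ) (s := (C ∩ D) ∩ S) hD₀
  have a₄ := measureReal_inter_add_sdiff (μ := μ) (s := (C ∩ D) \ S) hD₀
  have s₁ : C ∩ symmDiff D₀ (D ∩ Sᶜ) ∩ S = C ∩ S ∩ D₀ := by
    ext x; simp only [mem_inter_iff, mem_symmDiff, mem_compl_iff]; tauto
  have s₂ : (C ∩ symmDiff D₀ (D ∩ Sᶜ)) \ S = C \ S ∩ (D \ D₀) := by
    ext x; have := @hD₀D x
    simp only [mem_inter_iff, mem_symmDiff, mem_compl_iff, Set.mem_sdiff]; tauto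
  have s₃ : C ∩ D ∩ S ∩ D₀ = C ∩ S ∩ D₀ := by
    ext x; have := @hD₀D x
    simp only [mem_inter_iff]; tauto
  have s₄ : (C ∩ D ∩ S) \ D₀ = C ∩ S ∩ (D \ D₀) := by
    ext x; simp only [mem_inter_iff, Set.mem_sdiff]; tauto
  have s₅ : (C ∩ D) \ S ∩ D₀ = C \ S ∩ D₀ := by
    ext x; have := @hD₀D x
    simp only [mem_inter_iff, Set.mem_sdiff]; tauto
  have s₆ : ((C ∩ D) \ S) \ D₀ = C \ S ∩ (D \ D₀) := by
    ext x; simp only [mem_inter_iff, Set.mem_sdiff]; tauto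
  rw [s₁, s₂] at a₁
  rw [s₃, s₄] at a₃
  rw [s₅, s₆] at a₄
  linarith

lemma exists_subset_two_pow_mul_le (hℱ : ℱ ≤ 𝒯)
    (hNE : ∀ D : Set T, MeasurableSet D → 0 < μ D →
      ∃ D₀ ⊆ D, MeasurableSet D₀ ∧
        ∀ E : Set T, MeasurableSet[ℱ] E → 0 < μ (symmDiff D₀ (D ∩ E)))
    {D : Set T} (hD : MeasurableSet D) (hμD : 0 < μ D) (n : ℕ) :
    ∃ D₁ ⊆ D, MeasurableSet D₁ ∧ 0 < μ D₁ ∧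
      ∀ C, MeasurableSet[ℱ] C → 2 ^ n * μ.real (C ∩ D₁) ≤ μ.real (C ∩ D) := by
  induction n with
  | zero => exact ⟨D, subset_rfl, hD, hμD, fun C _ ↦ by simp⟩
  | succ n ih =>
    obtain ⟨D₁, hD₁D, hD₁, hpos, h⟩ := ih
    obtain ⟨D₂, hD₂D, hD₂, hpos₂, h₂⟩ := exists_subset_two_mul_le hℱ hNE hD₁ hpos
    refine ⟨D₂, hD₂D.trans hD₁D, hD₂, hpos₂, fun C hC ↦ ?_⟩
    calc 2 ^ (n + 1) * μ.real (C ∩ D₂) = 2 ^ n * (2 * μ.real (C ∩ D₂)) := by ring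
      _ ≤ 2 ^ n * μ.real (C ∩ D₁) := by gcongr; exact h₂ C hC
      _ ≤ _ := h C hC

/-- Every measurable set splits into two pieces with the same conditional probability. -/
lemma exists_subset_two_mul_eq (hℱ : ℱ ≤ 𝒯)
    (hNE : ∀ D : Set T, MeasurableSet D → 0 < μ D →
      ∃ D₀ ⊆ D, MeasurableSet D₀ ∧
        ∀ E : Set T, MeasurableSet[ℱ] E → 0 < μ (symmDiff D₀ (D ∩ E)))
    {D : Set T} (hD : MeasurableSet D) :
    ∃ B ⊆ D, MeasurableSet B ∧
      ∀ C, MeasurableSet[ℱ] C → 2 * μ.real (C ∩ B) = μ.real (C ∩ D) := by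
  obtain ⟨B, ⟨hBD, hB, hle⟩, hmax⟩ := exists_maximal_measureReal μ
    (fun B ↦ B ⊆ D ∧ MeasurableSet B ∧
      ∀ C, MeasurableSet[ℱ] C → 2 * μ.real (C ∩ B) ≤ μ.real (C ∩ D))
    ⟨empty_subset _, MeasurableSet.empty, fun C _ ↦ by simp⟩ fun f hf h ↦ by
      refine ⟨iUnion_subset fun n ↦ (h n).1, MeasurableSet.iUnion fun n ↦ (h n).2.1,
        fun C hC ↦ ?_⟩
      have hlim : Tendsto (fun n ↦ μ.real (C ∩ f n)) atTop (𝓝 (μ.real (C ∩ ⋃ n, f n))) := by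
        rw [inter_iUnion]
        exact (ENNReal.tendsto_toReal (measure_ne_top _ _)).comp
          (tendsto_measure_iUnion_atTop fun i j hij ↦ inter_subset_inter_right _ (hf hij))
      exact le_of_tendsto' (hlim.const_mul 2) fun n ↦ (h n).2.2 C hC
  refine ⟨B, hBD, hB, fun C₀ hC₀ ↦ (hle C₀ hC₀).antisymm ?_⟩
  by_contra! hlt
  obtain ⟨n, hn⟩ : ∃ n : ℕ, 2 * μ.real univ / 2 ^ n < μ.real (C₀ ∩ D) - 2 * μ.real (C₀ ∩ B) := by
    have h₀ : Tendsto (fun n : ℕ ↦ 2 * μ.real univ * (1 / 2) ^ n) atTop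
        (𝓝 (2 * μ.real univ * 0)) :=
      (tendsto_pow_atTop_nhds_zero_of_lt_one (by norm_num) (by norm_num)).const_mul _
    rw [mul_zero] at h₀
    obtain ⟨n, hn⟩ := (h₀.eventually_lt_const (sub_pos.2 hlt)).exists
    exact ⟨n, by simpa [div_eq_mul_inv] using hn⟩
  let c : NNReal := 2 / 2 ^ n
  obtain ⟨S, hS, h₁, h₂⟩ := exists_hahn_of_le hℱ
    ((2 : NNReal) • μ.restrict B + c • μ) (μ.restrict D)
  have hα : ∀ C, MeasurableSet[ℱ] C → ((2 : NNReal) • μ.restrict B + c • μ).real C =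
      2 * μ.real (C ∩ B) + 2 / 2 ^ n * μ.real C := fun C hC ↦ by
    rw [measureReal_add_apply, measureReal_nnreal_smul_apply, measureReal_nnreal_smul_apply,
      measureReal_restrict_apply (hℱ _ hC)]
    simp [c]
  have hβ : ∀ C, MeasurableSet[ℱ] C → (μ.restrict D).real C = μ.real (C ∩ D) :=
    fun C hC ↦ measureReal_restrict_apply (hℱ _ hC)
  have hS' := hℱ _ hS
  have split : ∀ C A, μ.real (C ∩ A) = μ.real (C ∩ S ∩ A) + μ.real (C \ S ∩ A) := fun C A ↦ by
    rw [← measureReal_inter_add_sdiff (s := C ∩ A) hS', inter_right_comm, ← inter_sdiff_right_comm]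
  have hpos : 0 < μ ((D \ B) ∩ S) := by
    have e := h₂ (C₀ \ S) (hC₀.diff hS) disjoint_sdiff_left
    rw [hα _ (hC₀.diff hS), hβ _ (hC₀.diff hS)] at e
    have m₁ : 2 / 2 ^ n * μ.real (C₀ \ S) ≤ 2 * μ.real univ / 2 ^ n := by
      rw [div_mul_eq_mul_div]; gcongr <;> simp
    have m₂ : μ.real (C₀ ∩ S ∩ D) ≤ μ.real (C₀ ∩ S ∩ B) + μ.real ((D \ B) ∩ S) := by
      refine (measureReal_mono ?_).trans (measureReal_union_le _ _)
      rintro x ⟨⟨h, h'⟩, h''⟩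
      by_cases hx : x ∈ B
      exacts [Or.inl ⟨⟨h, h'⟩, hx⟩, Or.inr ⟨⟨h'', hx⟩, h'⟩]
    have p₁ : 0 ≤ μ.real (C₀ ∩ S ∩ B) := measureReal_nonneg
    have := split C₀ D
    have := split C₀ B
    exact (ENNReal.toReal_pos_iff.1 (show 0 < μ.real ((D \ B) ∩ S) by linarith)).1
  obtain ⟨D', hD'sub, hD', hD'pos, hD'le⟩ :=
    exists_subset_two_pow_mul_le hℱ hNE ((hD.diff hB).inter hS') hpos n
  have hdisj : Disjoint B D' := disjoint_left.2 fun x hx hx' ↦ (hD'sub hx').1.2 hx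
  have hadd : ∀ C, MeasurableSet C → μ.real (C ∩ (B ∪ D')) = μ.real (C ∩ B) + μ.real (C ∩ D') :=
    fun C hC ↦ by
      rw [inter_union_distrib_left, measureReal_union
        (hdisj.mono inter_subset_right inter_subset_right) (hC.inter hD')]
  have key := hmax (B ∪ D') subset_union_left ⟨union_subset hBD fun x hx ↦ (hD'sub hx).1.1,
    hB.union hD', fun C hC ↦ by
      have hC' := hℱ _ hC
      have h1 := hadd C hC'
      have h2 := h₁ (C ∩ S) (hC.inter hS) inter_subset_right
      rw [hα _ (hC.inter hS), hβ _ (hC.inter hS)] at h2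
      have h3 := hle (C \ S) (hC.diff hS)
      have h4 : C \ S ∩ D' = ∅ := by
        ext x; simp only [mem_inter_iff, Set.mem_sdiff, mem_empty_iff_false, iff_false]
        exact fun h ↦ h.1.2 (hD'sub h.2).2
      have h5 := hD'le (C ∩ S) (hC.inter hS)
      have h6 : μ.real (C ∩ S ∩ (D \ B ∩ S)) ≤ μ.real (C ∩ S) := measureReal_mono inter_subset_left
      have h7 : μ.real (C ∩ S ∩ D') ≤ μ.real (C ∩ S) / 2 ^ n := by
        rw [le_div_iff₀ (by positivity)]; linarith
      have h8 : 2 / 2 ^ n * μ.real (C ∩ S) = 2 * (μ.real (C ∩ S) / 2 ^ n) := by ring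
      have h9 := split C D'
      rw [h4, measureReal_empty] at h9
      have := split C B
      have := split C D
      linarith⟩
  have := hadd univ MeasurableSet.univ
  simp only [univ_inter] at this
  have : 0 < μ.real D' := ENNReal.toReal_pos hD'pos.ne' (measure_ne_top _ _)
  linarith

end Halving

section Dyadic

variable {T : Type*} {ℱ 𝒯 : MeasurableSpace T} {μ : Measure T} [IsFiniteMeasure μ]

/-- Refining halvings: the `n`-th map splits the space into `2 ^ n` pieces, each of conditional
probability `2⁻ⁿ` given `ℱ`. -/
lemma exists_dyadic_refinement (h_half : ∀ D : Set T, MeasurableSet D → ∃ B ⊆ D, MeasurableSet B ∧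
      ∀ C, MeasurableSet[ℱ] C → 2 * μ.real (C ∩ B) = μ.real (C ∩ D)) :
    ∃ X : ℕ → T → ℕ, (∀ n, Measurable (X n)) ∧ (∀ t, X 0 t = 0) ∧
      (∀ n t, X (n + 1) t = 2 * X n t ∨ X (n + 1) t = 2 * X n t + 1) ∧
      ∀ n k, k < 2 ^ n → ∀ C, MeasurableSet[ℱ] C →
        2 ^ n * μ.real (C ∩ X n ⁻¹' {k}) = μ.real C := by
  classical
  have h_half' : ∀ D : Set T, ∃ B, MeasurableSet D → B ⊆ D ∧ MeasurableSet B ∧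
      ∀ C, MeasurableSet[ℱ] C → 2 * μ.real (C ∩ B) = μ.real (C ∩ D) := fun D ↦ by
    by_cases hD : MeasurableSet D
    · obtain ⟨B, hB⟩ := h_half D hD
      exact ⟨B, fun _ ↦ hB⟩
    · exact ⟨∅, fun h ↦ absurd h hD⟩
  choose H hH using h_half'
  let X : ℕ → T → ℕ := fun n ↦ Nat.rec (fun _ ↦ 0)
    (fun _ x t ↦ if t ∈ H (x ⁻¹' {x t}) then 2 * x t else 2 * x t + 1) n
  have hX : ∀ n t, X (n + 1) t =
      if t ∈ H (X n ⁻¹' {X n t}) then 2 * X n t else 2 * X n t + 1 := fun _ _ ↦ rfl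
  have h_even : ∀ n k, Measurable (X n) → X (n + 1) ⁻¹' {2 * k} = H (X n ⁻¹' {k}) := by
    intro n k hn
    have hsub := (hH (X n ⁻¹' {k}) (hn (measurableSet_singleton k))).1
    ext t
    simp only [mem_preimage, mem_singleton_iff, hX]
    constructor
    · intro h
      split_ifs at h with h'
      · rwa [show X n t = k by omega] at h'
      · omega
    · intro h
      have hk : X n t = k := hsub h
      rw [hk, if_pos h]
  have h_odd : ∀ n k, X (n + 1) ⁻¹' {2 * k + 1} = X n ⁻¹' {k} \ H (X n ⁻¹' {k}) := by
    intro n k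
    ext t
    simp only [mem_preimage, mem_singleton_iff, hX, Set.mem_sdiff]
    constructor
    · intro h
      split_ifs at h with h'
      · omega
      · have hk : X n t = k := by omega
        rw [hk] at h'
        exact ⟨hk, h'⟩
    · rintro ⟨hk, h'⟩
      rw [hk, if_neg h']
  have hmeas : ∀ n, Measurable (X n) := by
    intro n
    induction n with
    | zero => exact measurable_const
    | succ n ih =>
      refine measurable_to_countable' fun j ↦ ?_
      obtain ⟨k, rfl | rfl⟩ := Nat.even_or_odd' j
      · rw [h_even n k ih]
        exact (hH _ (ih (measurableSet_singleton k))).2.1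
      · rw [h_odd]
        exact (ih (measurableSet_singleton k)).diff (hH _ (ih (measurableSet_singleton k))).2.1
  refine ⟨X, hmeas, fun _ ↦ rfl, fun n t ↦ ?_, fun n ↦ ?_⟩
  · rw [hX]
    split_ifs <;> simp
  induction n with
  | zero =>
    intro k hk C _
    obtain rfl : k = 0 := by omega
    have : X 0 ⁻¹' {0} = univ := eq_univ_of_forall fun _ ↦ rfl
    simp [this]
  | succ n ih =>
    intro j hj C hC
    obtain ⟨k, hjk⟩ := Nat.even_or_odd' j
    have hk : k < 2 ^ n := by rw [pow_succ] at hj; omega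
    obtain ⟨hsub, hHm, heq⟩ := hH _ (hmeas n (measurableSet_singleton k))
    have h₁ := ih k hk C hC
    have h₂ := heq C hC
    rcases hjk with rfl | rfl
    · rw [h_even n k (hmeas n), pow_succ, mul_assoc, h₂, h₁]
    · have h₃ := measureReal_inter_add_sdiff (μ := μ) (s := C ∩ X n ⁻¹' {k}) hHm
      rw [inter_assoc, inter_eq_right.2 hsub, inter_sdiff_assoc] at h₃
      rw [h_odd, pow_succ, mul_assoc, ← h₁]
      congr 1
      linarith

/-- If every measurable set can be halved conditionally on `ℱ`, there is a uniform variable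
independent of `ℱ`. -/
lemma exists_uniform_of_halving (hℱ : ℱ ≤ 𝒯)
    (h_half : ∀ D : Set T, MeasurableSet D → ∃ B ⊆ D, MeasurableSet B ∧
      ∀ C, MeasurableSet[ℱ] C → 2 * μ.real (C ∩ B) = μ.real (C ∩ D)) :
    ∃ U : T → ℝ, Measurable U ∧ (∀ t, U t ∈ Icc (0 : ℝ) 1) ∧
      ∀ C, MeasurableSet[ℱ] C →
        (μ.restrict C).map U = μ C • volume.restrict (Icc (0 : ℝ) 1) := by
  obtain ⟨X, hX, hX₀, hX_succ, hX_meas⟩ := exists_dyadic_refinement h_half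
  have hlow : ∀ t, Monotone fun n ↦ (X n t : ℝ) / 2 ^ n := fun t ↦
    monotone_nat_of_le_succ fun n ↦ by
      rw [div_le_div_iff₀ (by positivity) (by positivity), pow_succ]
      have : 2 * (X n t : ℝ) ≤ X (n + 1) t := by
        exact_mod_cast (by rcases hX_succ n t with h | h <;> omega : 2 * X n t ≤ X (n + 1) t)
      nlinarith [show (0 : ℝ) < 2 ^ n by positivity]
  have hupp : ∀ t, Antitone fun n ↦ ((X n t : ℝ) + 1) / 2 ^ n := fun t ↦
    antitone_nat_of_succ_le fun n ↦ by
      rw [div_le_div_iff₀ (by positivity) (by positivity), pow_succ]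
      have : (X (n + 1) t : ℝ) ≤ 2 * X n t + 1 := by
        exact_mod_cast (by rcases hX_succ n t with h | h <;> omega : X (n + 1) t ≤ 2 * X n t + 1)
      nlinarith [show (0 : ℝ) < 2 ^ n by positivity]
  have hle : ∀ t m n, (X m t : ℝ) / 2 ^ m ≤ ((X n t : ℝ) + 1) / 2 ^ n := fun t m n ↦
    calc (X m t : ℝ) / 2 ^ m ≤ (X (max m n) t : ℝ) / 2 ^ (max m n) := hlow t (le_max_left _ _)
      _ ≤ ((X (max m n) t : ℝ) + 1) / 2 ^ (max m n) := by gcongr; simp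
      _ ≤ _ := hupp t (le_max_right _ _)
  let U : T → ℝ := fun t ↦ ⨆ n, (X n t : ℝ) / 2 ^ n
  have hbdd : ∀ t, BddAbove (range fun n ↦ (X n t : ℝ) / 2 ^ n) := fun t ↦
    ⟨_, by rintro _ ⟨m, rfl⟩; exact hle t m 0⟩
  have hU_ge : ∀ n t, (X n t : ℝ) / 2 ^ n ≤ U t := fun n t ↦ le_ciSup (hbdd t) n
  have hU_le : ∀ n t, U t ≤ ((X n t : ℝ) + 1) / 2 ^ n := fun n t ↦ ciSup_le fun m ↦ hle t m n
  have hU_meas : Measurable U :=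
    Measurable.iSup fun n ↦ (measurable_from_top.comp (hX n)).div_const _
  have hU_mem : ∀ t, U t ∈ Icc (0 : ℝ) 1 := fun t ↦
    ⟨by simpa [hX₀] using hU_ge 0 t, by simpa [hX₀] using hU_le 0 t⟩
  refine ⟨U, hU_meas, hU_mem, fun C hC ↦ ?_⟩
  have hC' := hℱ _ hC
  have hcdf : ∀ n k, k ≤ 2 ^ n → 2 ^ n * μ.real (C ∩ X n ⁻¹' Iio k) = k * μ.real C := by
    intro n k
    induction k with
    | zero => simp
    | succ k ih =>
      intro hk
      have hsplit : C ∩ X n ⁻¹' Iio (k + 1) = C ∩ X n ⁻¹' Iio k ∪ C ∩ X n ⁻¹' {k} := by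
        rw [← inter_union_distrib_left, ← preimage_union]
        congr 2
        ext j
        simp
      have hdisj : Disjoint (C ∩ X n ⁻¹' Iio k) (C ∩ X n ⁻¹' {k}) :=
        ((show Disjoint (Iio k) {k} by simp).preimage _).mono inter_subset_right inter_subset_right
      rw [hsplit, measureReal_union hdisj (hC'.inter (hX n (measurableSet_singleton k))), mul_add,
        ih (by omega), hX_meas n k (by omega) C hC]
      push_cast
      ring
  refine Measure.ext_of_Iic _ _ fun x ↦ ?_
  rw [Measure.map_apply hU_meas measurableSet_Iic,
    Measure.restrict_apply (hU_meas measurableSet_Iic), Measure.smul_apply,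
    Measure.restrict_apply measurableSet_Iic, smul_eq_mul]
  rcases lt_or_ge x 0 with hx₀ | hx₀
  · have h₁ : U ⁻¹' Iic x = ∅ := eq_empty_of_forall_notMem fun t ht ↦
      absurd ((hU_mem t).1.trans ht) hx₀.not_ge
    have h₂ : Iic x ∩ Icc (0 : ℝ) 1 = ∅ := eq_empty_of_forall_notMem fun y hy ↦
      absurd (hy.2.1.trans hy.1) hx₀.not_ge
    simp [h₁, h₂]
  rcases le_or_gt 1 x with hx₁ | hx₁
  · have h₁ : U ⁻¹' Iic x = univ := eq_univ_of_forall fun t ↦ (hU_mem t).2.trans hx₁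
    have h₂ : Iic x ∩ Icc (0 : ℝ) 1 = Icc 0 1 := inter_eq_right.2 fun y hy ↦ hy.2.trans hx₁
    simp [h₁, h₂]
  have h₂ : Iic x ∩ Icc (0 : ℝ) 1 = Icc 0 x := by
    ext y
    simp only [mem_inter_iff, mem_Iic, mem_Icc]
    exact ⟨fun h ↦ ⟨h.2.1, h.1⟩, fun h ↦ ⟨h.2, h.1, h.2.trans hx₁.le⟩⟩
  rw [h₂, Real.volume_Icc, sub_zero, inter_comm]
  have hbounds : ∀ n : ℕ, (x - (1 / 2) ^ n) * μ.real C ≤ μ.real (C ∩ U ⁻¹' Iic x) ∧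
      μ.real (C ∩ U ⁻¹' Iic x) ≤ (x + (1 / 2) ^ n) * μ.real C := by
    intro n
    have hpow : (0 : ℝ) < 2 ^ n := by positivity
    have hpow' : (2 : ℝ) ^ n * (1 / 2) ^ n = 1 := by rw [← mul_pow]; norm_num
    have hk₁ : (⌊x * 2 ^ n⌋₊ : ℝ) ≤ x * 2 ^ n := Nat.floor_le (by positivity)
    have hk₂ : x * 2 ^ n < ⌊x * 2 ^ n⌋₊ + 1 := Nat.lt_floor_add_one _
    set k := ⌊x * 2 ^ n⌋₊
    have hk : k + 1 ≤ 2 ^ n := by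
      have : (k : ℝ) < 2 ^ n := by nlinarith
      exact_mod_cast this
    have hsub₁ : C ∩ X n ⁻¹' Iio k ⊆ C ∩ U ⁻¹' Iic x := inter_subset_inter_right _ fun t ht ↦ by
      have ht' : (X n t : ℝ) + 1 ≤ k := by exact_mod_cast (show X n t + 1 ≤ k from ht)
      refine (hU_le n t).trans ?_
      rw [div_le_iff₀ hpow]
      linarith
    have hsub₂ : C ∩ U ⁻¹' Iic x ⊆ C ∩ X n ⁻¹' Iio (k + 1) :=
      inter_subset_inter_right _ fun t ht ↦ by
        have ht' := (hU_ge n t).trans ht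
        rw [div_le_iff₀ hpow] at ht'
        have : (X n t : ℝ) < (k + 1 : ℕ) := by push_cast; linarith
        exact_mod_cast this
    have e₁ := hcdf n k (by omega)
    have e₂ := hcdf n (k + 1) hk
    push_cast at e₂
    have m₁ : μ.real (C ∩ X n ⁻¹' Iio k) ≤ μ.real (C ∩ U ⁻¹' Iic x) := measureReal_mono hsub₁
    have m₂ : μ.real (C ∩ U ⁻¹' Iic x) ≤ μ.real (C ∩ X n ⁻¹' Iio (k + 1)) := measureReal_mono hsub₂
    have hC₀ : 0 ≤ μ.real C := measureReal_nonneg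
    constructor <;> refine le_of_mul_le_mul_left ?_ hpow
    · calc 2 ^ n * ((x - (1 / 2) ^ n) * μ.real C)
          = (x * 2 ^ n - 2 ^ n * (1 / 2) ^ n) * μ.real C := by ring
        _ ≤ k * μ.real C := by rw [hpow']; gcongr; linarith
        _ ≤ _ := by rw [← e₁]; gcongr
    · calc 2 ^ n * μ.real (C ∩ U ⁻¹' Iic x) ≤ (k + 1) * μ.real C := by rw [← e₂]; gcongr
        _ ≤ (x * 2 ^ n + 2 ^ n * (1 / 2) ^ n) * μ.real C := by rw [hpow']; gcongr
        _ = _ := by ring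
  have hlim : Tendsto (fun n : ℕ ↦ (1 / 2 : ℝ) ^ n) atTop (𝓝 0) :=
    tendsto_pow_atTop_nhds_zero_of_lt_one (by norm_num) (by norm_num)
  have hreal : μ.real (C ∩ U ⁻¹' Iic x) = x * μ.real C := by
    have l₁ := (hlim.const_sub x).mul_const (μ.real C)
    have l₂ := (hlim.const_add x).mul_const (μ.real C)
    rw [sub_zero] at l₁
    rw [add_zero] at l₂
    exact le_antisymm (ge_of_tendsto' l₂ fun n ↦ (hbounds n).2)
      (le_of_tendsto' l₁ fun n ↦ (hbounds n).1)
  rw [← ofReal_measureReal (s := C ∩ U ⁻¹' Iic x), hreal, ENNReal.ofReal_mul hx₀,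
    ofReal_measureReal, mul_comm]

end Dyadic

/-- If `𝒯` is nowhere equivalent to `ℱ`, then there exists a `𝒯`-measurable
`U : T → [0,1]` whose law is Lebesgue measure on `[0,1]` and whose generated
σ-algebra is independent of `ℱ`. -/
theorem nowhereEquivalent_implies_uniform_independent
    {T : Type*} [𝒯 : MeasurableSpace T] (μ : Measure T) [IsProbabilityMeasure μ]
    (hatomless : ∀ D : Set T, MeasurableSet[𝒯] D → 0 < μ D →
      ∃ D₀ ⊆ D, MeasurableSet[𝒯] D₀ ∧ 0 < μ D₀ ∧ μ D₀ < μ D)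
    (ℱ : MeasurableSpace T) (hℱ : ℱ ≤ 𝒯)
    (hNE : ∀ D : Set T, MeasurableSet[𝒯] D → 0 < μ D →
      ∃ D₀ ⊆ D, MeasurableSet[𝒯] D₀ ∧
        ∀ E : Set T, MeasurableSet[ℱ] E → 0 < μ (symmDiff D₀ (D ∩ E))) :
    ∃ U : T → ℝ, Measurable[𝒯] U ∧ (∀ t, U t ∈ Set.Icc (0 : ℝ) 1) ∧
      -- the law of `U` is Lebesgue measure on `[0,1]`
      @Measure.map T ℝ 𝒯 _ U μ = volume.restrict (Set.Icc (0 : ℝ) 1) ∧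
      -- the σ-algebra generated by `U` is independent of `ℱ`
      (∀ C₁ : Set T, MeasurableSet[ℱ] C₁ → ∀ B : Set ℝ, MeasurableSet B →
        μ (C₁ ∩ U ⁻¹' B) = μ C₁ * (volume.restrict (Set.Icc (0 : ℝ) 1)) B) := by
  have h_half := fun (D : Set T) (hD : MeasurableSet[𝒯] D) ↦ exists_subset_two_mul_eq hℱ hNE hD
  obtain ⟨U, hU, hU_mem, h⟩ := exists_uniform_of_halving hℱ h_half
  refine ⟨U, hU, hU_mem, ?_, fun C hC B hB ↦ ?_⟩
  · simpa using h univ MeasurableSet.univ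
  · have hB' := congrArg (fun ν : Measure ℝ ↦ ν B) (h C hC)
    simp only [Measure.map_apply hU hB, Measure.restrict_apply (hU hB), Measure.smul_apply,
      smul_eq_mul] at hB'
    rwa [inter_comm]
end

section
/- Let (T, 𝒯, λ) be a complete atomless probability space, ℱ ⊆ 𝒯 a sub-σ-algebra, and X a Polish space. If 𝒯 is nowhere equivalent to ℱ, then for every sub-σ-algebra 𝒢 ⊆ ℱ and every 𝒢-measurable transition probability G from T to X, there exists a 𝒯-measurable function g : T → X such that G is a regular conditional distribution of g given 𝒢, i.e., for every Borel B ⊆ X and every A ∈ 𝒢, λ(A ∩ g⁻¹(B)) = ∫_A G(t)(B) dλ(t). -/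
open MeasureTheory Set Filter Topology ENNReal

namespace MeasureTheory

section Exhaustion

variable {T : Type*} [MeasurableSpace T] {μ : Measure T} [IsFiniteMeasure μ]

theorem measureReal_inter_add_inter_compl {S : Set T} (hS : MeasurableSet S) (A D : Set T) :
    μ.real (A ∩ S ∩ D) + μ.real (A ∩ Sᶜ ∩ D) = μ.real (A ∩ D) := by
  rw [← measureReal_inter_add_sdiff (s := A ∩ D) hS, sdiff_eq, inter_right_comm A S,
    inter_right_comm A Sᶜ]

/-- Exhaustion: a class of sets closed under increasing countable unions has a member that cannot
be enlarged within the class by a set of positive measure. -/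
theorem exists_measure_maximal {P : Set T → Prop} {C₀ : Set T} (hC₀ : P C₀)
    (hP : ∀ C : ℕ → Set T, Monotone C → (∀ n, P (C n)) → P (⋃ n, C n)) :
    ∃ C, P C ∧ ∀ C', P C' → C ⊆ C' → μ.real C' ≤ μ.real C := by
  have step : ∀ (C : {C // P C}) (n : ℕ), ∃ C₁ : {C // P C}, C.1 ⊆ C₁.1 ∧
      ∀ C', P C' → C.1 ⊆ C' → μ.real C' < μ.real C₁.1 + 1 / ((n : ℝ) + 1) := by
    intro C n
    set V : Set ℝ := μ.real '' {C' | P C' ∧ C.1 ⊆ C'}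
    have hne : V.Nonempty := ⟨_, C.1, ⟨C.2, Subset.rfl⟩, rfl⟩
    have hbdd : BddAbove V :=
      ⟨μ.real univ, by rintro _ ⟨C', -, rfl⟩; exact measureReal_mono (subset_univ _)⟩
    obtain ⟨_, ⟨C₁, ⟨hPC₁, hCC₁⟩, rfl⟩, hlt⟩ :=
      exists_lt_of_lt_csSup hne (sub_lt_self (sSup V) (Nat.one_div_pos_of_nat (α := ℝ) (n := n)))
    refine ⟨⟨C₁, hPC₁⟩, hCC₁, fun C' hPC' hCC' => ?_⟩
    have := le_csSup hbdd ⟨C', ⟨hPC', hCC'⟩, rfl⟩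
    linarith
  choose next hsub hlt using step
  let C : ℕ → {C // P C} := fun n => Nat.rec ⟨C₀, hC₀⟩ (fun n C => next C n) n
  have hmono : Monotone fun n => (C n).1 := monotone_nat_of_le_succ fun n => hsub (C n) n
  refine ⟨⋃ n, (C n).1, hP _ hmono fun n => (C n).2, fun C' hPC' hCC' => ?_⟩
  refine le_of_forall_pos_le_add fun ε hε => ?_
  obtain ⟨n, hn⟩ := exists_nat_one_div_lt hε
  have h₁ := hlt (C n) n C' hPC' ((subset_iUnion (fun n => (C n).1) n).trans hCC')
  have h₂ : μ.real (C (n + 1)).1 ≤ μ.real (⋃ n, (C n).1) :=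
    measureReal_mono (subset_iUnion (fun n => (C n).1) (n + 1))
  have h₃ : μ.real (next (C n) n).1 = μ.real (C (n + 1)).1 := rfl
  linarith

end Exhaustion

section NowhereEquivalent

variable {T : Type*} {m m0 : MeasurableSpace T} {μ : Measure T}

/-- The ambient σ-algebra is nowhere equivalent to `m`: every set of positive measure has a
measurable subset that is not, up to a null set, the trace of an `m`-measurable set. -/
def NowhereEquivalent (m : MeasurableSpace T) {m0 : MeasurableSpace T} (μ : Measure T) : Prop :=
  ∀ D : Set T, MeasurableSet[m0] D → 0 < μ D →
    ∃ D₀ ⊆ D, MeasurableSet[m0] D₀ ∧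
      ∀ E : Set T, MeasurableSet[m] E → 0 < μ (symmDiff D₀ (D ∩ E))

variable [IsFiniteMeasure μ]

/-- Hahn decomposition relative to a sub-σ-algebra. -/
theorem exists_hahn_decomposition_trim (hm : m ≤ m0) (ν₁ ν₂ : Measure T) [IsFiniteMeasure ν₁]
    [IsFiniteMeasure ν₂] :
    ∃ S, MeasurableSet[m] S ∧ (∀ A, MeasurableSet[m] A → A ⊆ S → ν₁.real A ≤ ν₂.real A) ∧
      ∀ A, MeasurableSet[m] A → A ⊆ Sᶜ → ν₂.real A ≤ ν₁.real A := by
  obtain ⟨S, hS, h₁, h₂⟩ := @hahn_decomposition T m (ν₂.trim hm) (ν₁.trim hm) _ _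
  refine ⟨S, hS, fun A hA hAS => ?_, fun A hA hAS => ?_⟩
  · have := h₁ A hA hAS
    rw [trim_measurableSet_eq hm hA, trim_measurableSet_eq hm hA] at this
    exact ENNReal.toReal_mono (measure_ne_top _ _) this
  · have := h₂ A hA hAS
    rw [trim_measurableSet_eq hm hA, trim_measurableSet_eq hm hA] at this
    exact ENNReal.toReal_mono (measure_ne_top _ _) this

theorem NowhereEquivalent.exists_subset_le_half (h : NowhereEquivalent m μ) (hm : m ≤ m0)
    {D : Set T} (hD : MeasurableSet D) (hpos : 0 < μ.real D) :
    ∃ D₁ ⊆ D, MeasurableSet D₁ ∧ 0 < μ.real D₁ ∧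
      ∀ A, MeasurableSet[m] A → μ.real (A ∩ D₁) ≤ μ.real (A ∩ D) / 2 := by
  obtain ⟨D₀, hD₀D, hD₀, hne⟩ := h D hD (ENNReal.toReal_pos_iff.1 hpos).1
  obtain ⟨S, hS, h₁, h₂⟩ :=
    exists_hahn_decomposition_trim hm (μ.restrict D₀) (μ.restrict (D \ D₀))
  have hS' := hm S hS
  have hsymm : symmDiff D₀ (D ∩ Sᶜ) = S ∩ D₀ ∪ Sᶜ ∩ (D \ D₀) := by
    ext x
    have := @hD₀D x
    simp only [Set.mem_symmDiff, mem_inter_iff, mem_union, mem_compl_iff, Set.mem_sdiff]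
    tauto
  have hmeas : MeasurableSet (S ∩ D₀ ∪ Sᶜ ∩ (D \ D₀)) :=
    (hS'.inter hD₀).union (hS'.compl.inter (hD.diff hD₀))
  refine ⟨S ∩ D₀ ∪ Sᶜ ∩ (D \ D₀), ?_, hmeas, ?_, fun A hA => ?_⟩
  · rintro x (hx | hx)
    exacts [hD₀D hx.2, hx.2.1]
  · rw [← hsymm]
    exact ENNReal.toReal_pos (hne Sᶜ hS.compl).ne' (measure_ne_top _ _)
  · have hA' := hm A hA
    have k₁ := h₁ (A ∩ S) (hA.inter hS) inter_subset_right
    have k₂ := h₂ (A ∩ Sᶜ) (hA.inter hS.compl) inter_subset_right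
    rw [measureReal_restrict_apply (hA'.inter hS'), measureReal_restrict_apply (hA'.inter hS')]
      at k₁
    rw [measureReal_restrict_apply (hA'.inter hS'.compl),
      measureReal_restrict_apply (hA'.inter hS'.compl)] at k₂
    have e₁ : μ.real (A ∩ (S ∩ D₀ ∪ Sᶜ ∩ (D \ D₀))) =
        μ.real (A ∩ S ∩ D₀) + μ.real (A ∩ Sᶜ ∩ (D \ D₀)) := by
      rw [inter_union_distrib_left, ← inter_assoc, ← inter_assoc]
      refine measureReal_union ?_ ((hA'.inter hS'.compl).inter (hD.diff hD₀))
      exact disjoint_left.2 fun x hx hx' => hx'.1.2 hx.1.2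
    have e₂ : ∀ B : Set T, μ.real (B ∩ D₀) + μ.real (B ∩ (D \ D₀)) = μ.real (B ∩ D) := by
      intro B
      rw [← measureReal_inter_add_sdiff (s := B ∩ D) hD₀, inter_assoc, inter_eq_right.2 hD₀D,
        inter_sdiff_assoc]
    linarith [e₂ (A ∩ S), e₂ (A ∩ Sᶜ), measureReal_inter_add_inter_compl (μ := μ) hS' A D]

theorem NowhereEquivalent.exists_subset_le_pow (h : NowhereEquivalent m μ) (hm : m ≤ m0)
    {D : Set T} (hD : MeasurableSet D) (hpos : 0 < μ.real D) (n : ℕ) :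
    ∃ D₁ ⊆ D, MeasurableSet D₁ ∧ 0 < μ.real D₁ ∧
      ∀ A, MeasurableSet[m] A → μ.real (A ∩ D₁) ≤ (1 / 2) ^ n * μ.real (A ∩ D) := by
  induction n with
  | zero => exact ⟨D, Subset.rfl, hD, hpos, fun A _ => by simp⟩
  | succ n ih =>
    obtain ⟨D₁, hsub, hD₁, hpos₁, hle⟩ := ih
    obtain ⟨D₂, hsub₂, hD₂, hpos₂, hle₂⟩ := h.exists_subset_le_half hm hD₁ hpos₁
    refine ⟨D₂, hsub₂.trans hsub, hD₂, hpos₂, fun A hA => (hle₂ A hA).trans ?_⟩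
    rw [pow_succ]
    linarith [hle A hA]

/-- Every measurable set can be split into halves, uniformly over `m`-measurable sets. -/
theorem NowhereEquivalent.exists_subset_eq_half (h : NowhereEquivalent m μ) (hm : m ≤ m0)
    {D : Set T} (hD : MeasurableSet D) :
    ∃ C ⊆ D, MeasurableSet C ∧
      ∀ A, MeasurableSet[m] A → μ.real (A ∩ C) = μ.real (A ∩ D) / 2 := by
  obtain ⟨C, ⟨hCD, hC, hle⟩, hmax⟩ := exists_measure_maximal (μ := μ) (C₀ := ∅)
    (P := fun C => C ⊆ D ∧ MeasurableSet C ∧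
      ∀ A, MeasurableSet[m] A → μ.real (A ∩ C) ≤ μ.real (A ∩ D) / 2)
    ⟨empty_subset _, MeasurableSet.empty, fun A _ => by simp; positivity⟩ <| by
      intro C hmono hP
      refine ⟨iUnion_subset fun n => (hP n).1, MeasurableSet.iUnion fun n => (hP n).2.1,
        fun A hA => ?_⟩
      rw [inter_iUnion]
      refine le_of_tendsto' ((ENNReal.tendsto_toReal (measure_ne_top μ _)).comp
        (tendsto_measure_iUnion_atTop fun i j hij => ?_)) fun n => (hP n).2.2 A hA
      exact inter_subset_inter_right _ (hmono hij)
  refine ⟨C, hCD, hC, fun A hA => (hle A hA).antisymm ?_⟩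
  by_contra! hlt
  have hA' := hm A hA
  obtain ⟨n, hn⟩ : ∃ n : ℕ, (1 / 2 : ℝ) ^ n * μ.real A < μ.real (A ∩ D) / 2 - μ.real (A ∩ C) := by
    have : Tendsto (fun n : ℕ => (1 / 2 : ℝ) ^ n * μ.real A) atTop (𝓝 (0 * μ.real A)) :=
      (_root_.tendsto_pow_atTop_nhds_zero_of_lt_one (by norm_num) (by norm_num)).mul_const _
    rw [zero_mul] at this
    exact (this.eventually_lt_const (sub_pos.2 hlt)).exists
  obtain ⟨S, hS, h₁, h₂⟩ := exists_hahn_decomposition_trim hm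
    ((2 : NNReal) • μ.restrict C + (2 * (1 / 2) ^ n : NNReal) • μ) (μ.restrict D)
  have hS' := hm S hS
  have hν : ∀ B, MeasurableSet[m] B →
      ((2 : NNReal) • μ.restrict C + (2 * (1 / 2) ^ n : NNReal) • μ).real B =
        2 * μ.real (B ∩ C) + 2 * (1 / 2) ^ n * μ.real B := by
    intro B hB
    rw [measureReal_add_apply, measureReal_nnreal_smul_apply, measureReal_nnreal_smul_apply,
      measureReal_restrict_apply (hm B hB)]
    simp
  have split := measureReal_inter_add_inter_compl (μ := μ) hS'
  have hpos : 0 < μ.real (S ∩ (D \ C)) := by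
    have k := h₂ (A ∩ Sᶜ) (hA.inter hS.compl) inter_subset_right
    rw [hν _ (hA.inter hS.compl), measureReal_restrict_apply (hA'.inter hS'.compl)] at k
    have e₁ := split A C
    have e₂ := split A D
    have e₃ : μ.real (A ∩ Sᶜ) ≤ μ.real A := measureReal_mono inter_subset_left
    have e₄ := mul_le_mul_of_nonneg_left e₃ (by positivity : (0 : ℝ) ≤ (1 / 2) ^ n)
    have e₅ : μ.real (A ∩ S ∩ D) ≤ μ.real (A ∩ S ∩ C) + μ.real (S ∩ (D \ C)) := by
      refine (measureReal_mono ?_).trans (measureReal_union_le _ _)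
      intro x hx
      by_cases hxC : x ∈ C
      exacts [Or.inl ⟨hx.1, hxC⟩, Or.inr ⟨hx.1.2, hx.2, hxC⟩]
    have e₆ : 0 ≤ μ.real (A ∩ S ∩ C) := measureReal_nonneg
    linarith
  obtain ⟨D₁, hsub, hD₁, hpos₁, hle₁⟩ :=
    h.exists_subset_le_pow hm (hS'.inter (hD.diff hC)) hpos n
  have hdisj : Disjoint C D₁ := disjoint_left.2 fun x hx hx' => (hsub hx').2.2 hx
  have hbig := hmax (C ∪ D₁)
    ⟨union_subset hCD fun x hx => (hsub hx).2.1, hC.union hD₁, fun B hB => ?_⟩ subset_union_left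
  · rw [measureReal_union hdisj hD₁] at hbig
    linarith
  · have hB' := hm B hB
    rw [inter_union_distrib_left, measureReal_union
      (hdisj.mono inter_subset_right inter_subset_right) (hB'.inter hD₁)]
    have k := h₁ (B ∩ S) (hB.inter hS) inter_subset_right
    rw [hν _ (hB.inter hS), measureReal_restrict_apply (hB'.inter hS')] at k
    have k₂ := hle (B ∩ Sᶜ) (hB.inter hS.compl)
    have k₃ := hle₁ B hB
    have k₄ : μ.real (B ∩ (S ∩ (D \ C))) ≤ μ.real (B ∩ S) :=
      measureReal_mono (by rw [← inter_assoc]; exact inter_subset_left)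
    have k₅ := mul_le_mul_of_nonneg_left k₄ (by positivity : (0 : ℝ) ≤ (1 / 2) ^ n)
    linarith [split B C, split B D]

end NowhereEquivalent

section DyadicChain

variable {T : Type*} {m m0 : MeasurableSpace T} {μ : Measure T}

/-- The increasing chain of sets indexed by `k / 2 ^ n`, obtained from `∅ ⊆ univ` by repeatedly
inserting the halves `h` of the successive differences. -/
def dyadicChain (h : Set T → Set T) : ℕ → ℕ → Set T
  | 0, k => if k = 0 then ∅ else univ
  | n + 1, k =>
    if Even k then dyadicChain h n (k / 2)
    else dyadicChain h n (k / 2) ∪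
      h (dyadicChain h n (k / 2 + 1) \ dyadicChain h n (k / 2))

variable {h : Set T → Set T}

theorem dyadicChain_succ_two_mul (n k : ℕ) :
    dyadicChain h (n + 1) (2 * k) = dyadicChain h n k := by
  simp [dyadicChain]

theorem dyadicChain_succ_two_mul_add_one (n k : ℕ) :
    dyadicChain h (n + 1) (2 * k + 1) =
      dyadicChain h n k ∪ h (dyadicChain h n (k + 1) \ dyadicChain h n k) := by
  have : (2 * k + 1) / 2 = k := by omega
  simp [dyadicChain, this]

theorem dyadicChain_mul_pow (n k p : ℕ) :
    dyadicChain h (n + p) (k * 2 ^ p) = dyadicChain h n k := by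
  induction p with
  | zero => simp
  | succ p ih =>
    rw [← ih, ← add_assoc, ← dyadicChain_succ_two_mul (n + p)]
    congr 1
    ring

theorem measurableSet_dyadicChain (hmeas : ∀ D, MeasurableSet D → MeasurableSet (h D)) (n k : ℕ) :
    MeasurableSet (dyadicChain h n k) := by
  induction n generalizing k with
  | zero => unfold dyadicChain; split_ifs <;> simp
  | succ n ih =>
    obtain ⟨i, rfl | rfl⟩ := k.even_or_odd'
    · rw [dyadicChain_succ_two_mul]
      exact ih i
    · rw [dyadicChain_succ_two_mul_add_one]
      exact (ih i).union (hmeas _ ((ih _).diff (ih i)))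

theorem monotone_dyadicChain (hmeas : ∀ D, MeasurableSet D → MeasurableSet (h D))
    (hsub : ∀ D, MeasurableSet D → h D ⊆ D) (n : ℕ) : Monotone (dyadicChain h n) := by
  refine monotone_nat_of_le_succ fun k => ?_
  induction n generalizing k with
  | zero => unfold dyadicChain; split_ifs <;> simp_all
  | succ n ih =>
    obtain ⟨i, rfl | rfl⟩ := k.even_or_odd'
    · rw [dyadicChain_succ_two_mul, dyadicChain_succ_two_mul_add_one]
      exact subset_union_left
    · rw [dyadicChain_succ_two_mul_add_one, show 2 * i + 1 + 1 = 2 * (i + 1) by ring,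
        dyadicChain_succ_two_mul]
      exact union_subset (ih i) ((hsub _ ((measurableSet_dyadicChain hmeas _ _).diff
        (measurableSet_dyadicChain hmeas _ _))).trans sdiff_subset)

theorem dyadicChain_subset (hmeas : ∀ D, MeasurableSet D → MeasurableSet (h D))
    (hsub : ∀ D, MeasurableSet D → h D ⊆ D) {n k p j : ℕ}
    (hle : (k : ℝ) / 2 ^ n ≤ j / 2 ^ p) : dyadicChain h n k ⊆ dyadicChain h p j := by
  rw [← dyadicChain_mul_pow n k p, ← dyadicChain_mul_pow p j n, add_comm p n]
  apply monotone_dyadicChain hmeas hsub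
  rw [div_le_div_iff₀ (by positivity) (by positivity)] at hle
  exact_mod_cast hle

variable [IsFiniteMeasure μ]

theorem measureReal_inter_dyadicChain_odd (hm : m ≤ m0)
    (hmeas : ∀ D, MeasurableSet D → MeasurableSet (h D))
    (hsub : ∀ D, MeasurableSet D → h D ⊆ D)
    (hhalf : ∀ D, MeasurableSet D → ∀ A, MeasurableSet[m] A →
      μ.real (A ∩ h D) = μ.real (A ∩ D) / 2) {A : Set T} (hA : MeasurableSet[m] A) (n k : ℕ) :
    μ.real (A ∩ dyadicChain h (n + 1) (2 * k + 1)) =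
      (μ.real (A ∩ dyadicChain h n k) + μ.real (A ∩ dyadicChain h n (k + 1))) / 2 := by
  have hC := measurableSet_dyadicChain hmeas n k
  have hC' := measurableSet_dyadicChain hmeas n (k + 1)
  have hdiff := hC'.diff hC
  rw [dyadicChain_succ_two_mul_add_one, inter_union_distrib_left, measureReal_union
    (disjoint_left.2 fun x hx hx' => (hsub _ hdiff hx'.2).2 hx.2)
    ((hm A hA).inter (hmeas _ hdiff)), hhalf _ hdiff A hA,
    ← measureReal_inter_add_sdiff (s := A ∩ dyadicChain h n (k + 1)) hC, inter_assoc,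
    inter_eq_right.2 (monotone_dyadicChain hmeas hsub n k.le_succ), inter_sdiff_assoc]
  ring

theorem measureReal_inter_dyadicChain_le (hm : m ≤ m0)
    (hmeas : ∀ D, MeasurableSet D → MeasurableSet (h D))
    (hsub : ∀ D, MeasurableSet D → h D ⊆ D)
    (hhalf : ∀ D, MeasurableSet D → ∀ A, MeasurableSet[m] A →
      μ.real (A ∩ h D) = μ.real (A ∩ D) / 2) {A : Set T} (hA : MeasurableSet[m] A) (n k : ℕ) :
    μ.real (A ∩ dyadicChain h n k) ≤ k / 2 ^ n * μ.real A := by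
  induction n generalizing k with
  | zero =>
    rcases Nat.eq_zero_or_pos k with rfl | hk
    · simp [dyadicChain]
    · have : (1 : ℝ) ≤ k := by exact_mod_cast hk
      simpa [dyadicChain, hk.ne'] using le_mul_of_one_le_left measureReal_nonneg this
  | succ n ih =>
    obtain ⟨i, rfl | rfl⟩ := k.even_or_odd'
    · rw [dyadicChain_succ_two_mul]
      refine (ih i).trans_eq ?_
      push_cast
      field_simp
      ring
    · rw [measureReal_inter_dyadicChain_odd hm hmeas hsub hhalf hA]
      have h₁ := ih i
      have h₂ := ih (i + 1)
      calc _ ≤ (i / 2 ^ n * μ.real A + (i + 1 : ℕ) / 2 ^ n * μ.real A) / 2 := by linarith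
        _ = _ := by push_cast; field_simp; ring

theorem measureReal_inter_dyadicChain_eq (hm : m ≤ m0)
    (hmeas : ∀ D, MeasurableSet D → MeasurableSet (h D))
    (hsub : ∀ D, MeasurableSet D → h D ⊆ D)
    (hhalf : ∀ D, MeasurableSet D → ∀ A, MeasurableSet[m] A →
      μ.real (A ∩ h D) = μ.real (A ∩ D) / 2) {A : Set T} (hA : MeasurableSet[m] A) {n k : ℕ}
    (hk : k ≤ 2 ^ n) :
    μ.real (A ∩ dyadicChain h n k) = k / 2 ^ n * μ.real A := by
  induction n generalizing k with
  | zero =>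
    rcases Nat.eq_zero_or_pos k with rfl | hk'
    · simp [dyadicChain]
    · obtain rfl : k = 1 := by simp at hk; omega
      simp [dyadicChain]
  | succ n ih =>
    rw [pow_succ] at hk
    obtain ⟨i, rfl | rfl⟩ := k.even_or_odd'
    · rw [dyadicChain_succ_two_mul, ih (by omega)]
      push_cast
      field_simp
      ring
    · rw [measureReal_inter_dyadicChain_odd hm hmeas hsub hhalf hA, ih (by omega), ih (by omega)]
      push_cast
      field_simp
      ring

end DyadicChain

section Uniform

open unitInterval

variable {T : Type*} {m m0 : MeasurableSpace T} {μ : Measure T} [IsFiniteMeasure μ]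

/-- A random variable that is uniform on the unit interval and independent of `m`. -/
theorem NowhereEquivalent.exists_uniform (hNE : NowhereEquivalent m μ) (hm : m ≤ m0) :
    ∃ U : T → I, Measurable U ∧ ∀ A, MeasurableSet[m] A → ∀ V, MeasurableSet V →
      μ (A ∩ U ⁻¹' V) = μ A * volume V := by
  have hex : ∀ D, ∃ C, MeasurableSet D → C ⊆ D ∧ MeasurableSet C ∧
      ∀ A, MeasurableSet[m] A → μ.real (A ∩ C) = μ.real (A ∩ D) / 2 := fun D => by
    by_cases hD : MeasurableSet D
    · obtain ⟨C, hC⟩ := hNE.exists_subset_eq_half hm hD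
      exact ⟨C, fun _ => hC⟩
    · exact ⟨∅, fun hD' => absurd hD' hD⟩
  choose h hh using hex
  have hsub := fun D hD => (hh D hD).1
  have hmeas := fun D hD => (hh D hD).2.1
  have hhalf := fun D hD => (hh D hD).2.2
  let R : T → Set ℝ := fun t => {x | ∃ n k : ℕ, t ∈ dyadicChain h n k ∧ (k : ℝ) / 2 ^ n = x}
  have hR0 : ∀ t, ∀ x ∈ R t, 0 ≤ x := by
    rintro t _ ⟨n, k, -, rfl⟩
    positivity
  have hbdd : ∀ t, BddBelow (R t) := fun t => ⟨0, hR0 t⟩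
  have h1R : ∀ t, 1 ∈ R t := fun t => ⟨0, 1, by simp [dyadicChain], by simp⟩
  have hlt : ∀ t x, sInf (R t) < x ↔ ∃ n k : ℕ, (k : ℝ) / 2 ^ n < x ∧ t ∈ dyadicChain h n k := by
    intro t x
    rw [csInf_lt_iff (hbdd t) ⟨1, h1R t⟩]
    constructor
    · rintro ⟨_, ⟨n, k, ht, rfl⟩, hx⟩
      exact ⟨n, k, hx, ht⟩
    · rintro ⟨n, k, hx, ht⟩
      exact ⟨_, ⟨n, k, ht, rfl⟩, hx⟩
  let U : T → I := fun t => ⟨sInf (R t), Real.sInf_nonneg (hR0 t), csInf_le (hbdd t) (h1R t)⟩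
  have hU : Measurable U := by
    refine Measurable.subtype_mk (measurable_of_Iio fun x => ?_)
    have : (fun t => sInf (R t)) ⁻¹' Iio x =
        ⋃ (n : ℕ) (k : ℕ) (_ : (k : ℝ) / 2 ^ n < x), dyadicChain h n k := by
      ext t
      simp [hlt]
    rw [this]
    exact MeasurableSet.iUnion fun n => MeasurableSet.iUnion fun k => MeasurableSet.iUnion fun _ =>
      measurableSet_dyadicChain hmeas n k
  refine ⟨U, hU, fun A hA => ?_⟩
  have hA' := hm A hA
  have hIic : ∀ x : I, μ.real (A ∩ U ⁻¹' Iic x) = x * μ.real A := by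
    intro x
    have key : ∀ n : ℕ, |μ.real (A ∩ U ⁻¹' Iic x) - x * μ.real A| ≤ (1 / 2) ^ n * μ.real A := by
      intro n
      have hpow : (0 : ℝ) < 2 ^ n := by positivity
      set k := ⌊(x : ℝ) * 2 ^ n⌋₊
      have hk₁ : (k : ℝ) ≤ x * 2 ^ n := Nat.floor_le (mul_nonneg x.2.1 hpow.le)
      have hk₂ : (x : ℝ) * 2 ^ n < k + 1 := Nat.lt_floor_add_one _
      have hk : k ≤ 2 ^ n := by
        have := hk₁.trans (mul_le_of_le_one_left hpow.le x.2.2)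
        exact_mod_cast this
      have hk₁' : (k : ℝ) / 2 ^ n ≤ x := (div_le_iff₀ hpow).2 hk₁
      have hk₂' : (x : ℝ) < (k + 1 : ℕ) / 2 ^ n := (lt_div_iff₀ hpow).2 (by exact_mod_cast hk₂)
      have hlow : k / 2 ^ n * μ.real A ≤ μ.real (A ∩ U ⁻¹' Iic x) := by
        rw [← measureReal_inter_dyadicChain_eq hm hmeas hsub hhalf hA hk]
        exact measureReal_mono (inter_subset_inter_right _ fun t ht =>
          (csInf_le (hbdd t) ⟨n, k, ht, rfl⟩).trans hk₁')
      have hupp : μ.real (A ∩ U ⁻¹' Iic x) ≤ (k + 1 : ℕ) / 2 ^ n * μ.real A := by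
        refine le_trans (measureReal_mono (inter_subset_inter_right _ fun t ht => ?_))
          (measureReal_inter_dyadicChain_le hm hmeas hsub hhalf hA n (k + 1))
        have ht' : sInf (R t) ≤ x := ht
        obtain ⟨p, j, hj, hmem⟩ := (hlt t _).1 (ht'.trans_lt hk₂')
        exact dyadicChain_subset hmeas hsub hj.le hmem
      have hstep : ((k + 1 : ℕ) : ℝ) / 2 ^ n = k / 2 ^ n + (1 / 2) ^ n := by
        push_cast
        rw [one_div_pow]
        ring
      rw [hstep] at hupp hk₂'
      have hA0 : 0 ≤ μ.real A := measureReal_nonneg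
      rw [abs_le]
      constructor <;> nlinarith
    have hlim : Tendsto (fun n : ℕ => (1 / 2 : ℝ) ^ n * μ.real A) atTop (𝓝 0) := by
      simpa using (_root_.tendsto_pow_atTop_nhds_zero_of_lt_one (r := (1 / 2 : ℝ)) (by norm_num)
        (by norm_num)).mul_const (μ.real A)
    exact sub_eq_zero.1 (abs_nonpos_iff.1 (ge_of_tendsto' hlim key))
  have hmap : (μ.restrict A).map U = μ A • volume := by
    have : IsFiniteMeasure ((μ.restrict A).map U) := inferInstance
    refine Measure.ext_of_Iic _ _ fun x => ?_
    rw [Measure.map_apply hU measurableSet_Iic, Measure.restrict_apply (hU measurableSet_Iic),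
      inter_comm, ← ofReal_measureReal, hIic, Measure.smul_apply, unitInterval.volume_Iic,
      smul_eq_mul, ENNReal.ofReal_mul x.2.1, ofReal_measureReal, mul_comm]
  intro V hV
  rw [inter_comm, ← Measure.restrict_apply (hU hV), ← Measure.map_apply hU hV, hmap,
    Measure.smul_apply, smul_eq_mul]

end Uniform

section Realization

open ProbabilityTheory unitInterval

variable {T : Type*} {m m0 : MeasurableSpace T} {μ : Measure T} [IsFiniteMeasure μ]
  {X : Type*} [Nonempty X] [MeasurableSpace X] [StandardBorelSpace X]

/-- Every `m`-measurable Markov kernel is a regular conditional distribution given `m`. -/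
theorem NowhereEquivalent.exists_measure_inter_preimage_eq (hNE : NowhereEquivalent m μ)
    (hm : m ≤ m0) (κ : @Kernel T X m _) (hκ : @IsMarkovKernel T X m _ κ) :
    ∃ g : T → X, Measurable g ∧ ∀ B, MeasurableSet B → ∀ A, MeasurableSet[m] A →
      μ (A ∩ g ⁻¹' B) = ∫⁻ t in A, κ t B ∂μ := by
  obtain ⟨U, hU, hUind⟩ := hNE.exists_uniform hm
  obtain ⟨f, hf, hfκ⟩ := @Kernel.exists_measurable_map_eq_unitInterval T X m _ _ _ κ hκ
  have hpair : @Measurable T (T × I) m0 (m.prod _) fun t => (t, U t) :=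
    (measurable_id'' hm).prodMk hU
  have hprod : @Measure.prod T I m _ (μ.trim hm) volume =
      @Measure.map T (T × I) m0 (m.prod _) (fun t => (t, U t)) μ := by
    refine @Measure.prod_eq T I m _ _ _ _ _ _ fun A V hA hV => ?_
    rw [Measure.map_apply hpair (@MeasurableSet.prod T I m _ _ _ hA hV),
      trim_measurableSet_eq hm hA, ← hUind A hA V hV]
    rfl
  refine ⟨fun t => f t (U t), hf.comp hpair, fun B hB A hA => ?_⟩
  have hW : @MeasurableSet (T × I) (m.prod _) (Prod.fst ⁻¹' A ∩ Function.uncurry f ⁻¹' B) :=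
    (@measurable_fst T I m _ _ hA).inter (hf hB)
  have hκB : Measurable[m] fun t => κ t B := @Kernel.measurable_coe T X m _ κ B hB
  have hf_sec : ∀ t, Measurable (f t) := fun t => hf.comp (@measurable_prodMk_left T I m _ t)
  calc μ (A ∩ (fun t => f t (U t)) ⁻¹' B)
      = @Measure.map T (T × I) m0 (m.prod _) (fun t => (t, U t)) μ
          (Prod.fst ⁻¹' A ∩ Function.uncurry f ⁻¹' B) := by
        rw [Measure.map_apply hpair hW]; rfl
    _ = @lintegral T m (μ.trim hm) (A.indicator fun t => κ t B) := by
        rw [← hprod, @Measure.prod_apply T I m _ _ _ _ _ hW]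
        refine @lintegral_congr T m _ _ _ fun t => ?_
        by_cases ht : t ∈ A
        · rw [indicator_of_mem ht, ← hfκ t, Measure.map_apply (hf_sec t) hB]
          congr 1
          ext u
          simp [ht]
        · rw [indicator_of_notMem ht]
          convert measure_empty (μ := (volume : Measure I))
          ext u
          simp [ht]
    _ = ∫⁻ t in A, κ t B ∂μ := by
        rw [lintegral_trim hm (hκB.indicator hA), lintegral_indicator (hm A hA)]

end Realization

end MeasureTheory

/-- (NE ⇒ B5) If `𝒯` is nowhere equivalent to `ℱ`, then for every sub-σ-algebra
`𝒢 ⊆ ℱ` and every `𝒢`-measurable transition probability `G` from `T` to a Polish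
space `X`, there is a `𝒯`-measurable `g : T → X` whose regular conditional
distribution given `𝒢` is `G`. -/
theorem nowhereEquivalent_implies_rcd_realization
    {T : Type*} [𝒯 : MeasurableSpace T] (μ : Measure T) [IsProbabilityMeasure μ]
    (hcomplete : μ.IsComplete)
    (hatomless : ∀ D : Set T, MeasurableSet[𝒯] D → 0 < μ D →
      ∃ D₀ ⊆ D, MeasurableSet[𝒯] D₀ ∧ 0 < μ D₀ ∧ μ D₀ < μ D)
    (ℱ : MeasurableSpace T) (hℱ : ℱ ≤ 𝒯)
    {X : Type*} [TopologicalSpace X] [PolishSpace X] [MeasurableSpace X] [BorelSpace X]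
    (hNE : ∀ D : Set T, MeasurableSet[𝒯] D → 0 < μ D →
      ∃ D₀ ⊆ D, MeasurableSet[𝒯] D₀ ∧
        ∀ E : Set T, MeasurableSet[ℱ] E → 0 < μ (symmDiff D₀ (D ∩ E))) :
    ∀ 𝒢 : MeasurableSpace T, 𝒢 ≤ ℱ →
      ∀ G : T → Measure X, (∀ t, IsProbabilityMeasure (G t)) →
        (∀ B : Set X, MeasurableSet B → Measurable[𝒢] fun t => G t B) →
        ∃ g : T → X, Measurable[𝒯] g ∧
          ∀ B : Set X, MeasurableSet B → ∀ A : Set T, MeasurableSet[𝒢] A →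
            μ (A ∩ g ⁻¹' B) = ∫⁻ t in A, G t B ∂μ := by
  intro 𝒢 h𝒢 G hGprob hG
  have hne : Nonempty X := by
    obtain ⟨t⟩ := μ.nonempty_of_neZero
    exact (G t).nonempty_of_neZero
  let κ : @ProbabilityTheory.Kernel T X 𝒢 _ :=
    @ProbabilityTheory.Kernel.mk T X 𝒢 _ G (@Measure.measurable_of_measurable_coe X T _ 𝒢 G hG)
  refine NowhereEquivalent.exists_measure_inter_preimage_eq (m := 𝒢) (m0 := 𝒯) ?_
    (h𝒢.trans hℱ) κ (@ProbabilityTheory.IsMarkovKernel.mk T X 𝒢 _ κ hGprob)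
  intro D hD hpos
  obtain ⟨D₀, hsub, hD₀, h⟩ := hNE D hD hpos
  exact ⟨D₀, hsub, hD₀, fun E hE => h E (h𝒢 E hE)⟩
end

section
/- Let (T, 𝒯, λ) be a complete atomless probability space, ℱ ⊆ 𝒯 a sub-σ-algebra, and X an infinite Polish space. Suppose that for every sub-σ-algebra 𝒢 ⊆ ℱ and every 𝒢-measurable transition probability G from T to X there exists a 𝒯-measurable g : T → X with μ^{g|𝒢} = G (i.e., for every Borel B ⊆ X and every A ∈ 𝒢, λ(A ∩ g⁻¹(B)) = ∫_A G(t)(B) dλ(t)). Then 𝒯 is nowhere equivalent to ℱ. -/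
open MeasureTheory Set Filter Topology ENNReal

/-- If the sets `S i`, `i < n`, are pairwise disjoint, cover `D` up to a null set, are traced on `D`
by `ℱ`-measurable sets, and satisfy `μ (A ∩ S i) ≤ c * μ A` for `ℱ`-measurable `A`, then
`μ D ≤ c`. -/
theorem measure_le_of_trace_eq_of_measure_inter_le
    {T : Type*} [𝒯 : MeasurableSpace T] {μ : Measure T} [IsProbabilityMeasure μ]
    {ℱ : MeasurableSpace T} (hℱ : ℱ ≤ 𝒯) {D : Set T} {S E : ℕ → Set T} {n : ℕ} {c : ℝ≥0∞}
    (hS : Pairwise (Function.onFun Disjoint S))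
    (hcover : ∀ᵐ t ∂μ, ∃ i < n, t ∈ S i)
    (hE : ∀ i, MeasurableSet[ℱ] (E i))
    (htrace : ∀ i, μ (symmDiff (D ∩ S i) (D ∩ E i)) = 0)
    (hindep : ∀ i < n, ∀ A, MeasurableSet[ℱ] A → μ (A ∩ S i) ≤ c * μ A) :
    μ D ≤ c := by
  have hE' : ∀ i, MeasurableSet[ℱ] (disjointed E i) := fun i =>
    MeasurableSet.disjointed hE i
  have hsub : D ≤ᵐ[μ] ⋃ i ∈ Finset.range n, disjointed E i ∩ S i := by
    have hae : ∀ᵐ t ∂μ, ∀ i, t ∈ D ∩ S i ↔ t ∈ D ∩ E i := by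
      rw [ae_all_iff]
      intro i
      filter_upwards [measure_symmDiff_eq_zero_iff.mp (htrace i)] with t ht
      exact iff_of_eq ht
    filter_upwards [hcover, hae] with t ht hiff htD
    obtain ⟨i, hi, hti⟩ := ht
    have htE : t ∈ E i := ((hiff i).mp ⟨htD, hti⟩).2
    refine mem_iUnion₂.mpr ⟨i, Finset.mem_range.mpr hi, ?_, hti⟩
    rw [disjointed_eq_inter_compl]
    refine ⟨htE, mem_iInter₂.mpr fun j hj htj => ?_⟩
    exact disjoint_left.mp (hS hj.ne) ((hiff j).mpr ⟨htD, htj⟩).2 hti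
  calc μ D ≤ μ (⋃ i ∈ Finset.range n, disjointed E i ∩ S i) := measure_mono_ae hsub
    _ ≤ ∑ i ∈ Finset.range n, μ (disjointed E i ∩ S i) := measure_biUnion_finset_le _ _
    _ ≤ ∑ i ∈ Finset.range n, c * μ (disjointed E i) :=
      Finset.sum_le_sum fun i hi => hindep i (Finset.mem_range.mp hi) _ (hE' i)
    _ = c * μ (⋃ i ∈ Finset.range n, disjointed E i) := by
      rw [← Finset.mul_sum, measure_biUnion_finset
        (fun i _ j _ hij => disjoint_disjointed E hij) fun i _ => hℱ _ (hE' i)]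
    _ ≤ c := mul_le_of_le_one_right' prob_le_one

/-- (B5 ⇒ NE) If for every sub-σ-algebra `𝒢 ⊆ ℱ` and every `𝒢`-measurable transition
probability `G` from `T` to the infinite Polish space `X` there is a `𝒯`-measurable
`g : T → X` with `μ^{g|𝒢} = G`, then `𝒯` is nowhere equivalent to `ℱ`. -/
theorem rcd_realization_implies_nowhereEquivalent
    {T : Type*} [𝒯 : MeasurableSpace T] (μ : Measure T) [IsProbabilityMeasure μ]
    (hcomplete : μ.IsComplete)
    (hatomless : ∀ D : Set T, MeasurableSet[𝒯] D → 0 < μ D →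
      ∃ D₀ ⊆ D, MeasurableSet[𝒯] D₀ ∧ 0 < μ D₀ ∧ μ D₀ < μ D)
    (ℱ : MeasurableSpace T) (hℱ : ℱ ≤ 𝒯)
    {X : Type*} [TopologicalSpace X] [PolishSpace X] [MeasurableSpace X] [BorelSpace X]
    [Infinite X]
    (hB5 : ∀ 𝒢 : MeasurableSpace T, 𝒢 ≤ ℱ →
      ∀ G : T → Measure X, (∀ t, IsProbabilityMeasure (G t)) →
        (∀ B : Set X, MeasurableSet B → Measurable[𝒢] fun t => G t B) →
        ∃ g : T → X, Measurable[𝒯] g ∧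
          ∀ B : Set X, MeasurableSet B → ∀ A : Set T, MeasurableSet[𝒢] A →
            μ (A ∩ g ⁻¹' B) = ∫⁻ t in A, G t B ∂μ) :
    ∀ D : Set T, MeasurableSet[𝒯] D → 0 < μ D →
      ∃ D₀ ⊆ D, MeasurableSet[𝒯] D₀ ∧
        ∀ E : Set T, MeasurableSet[ℱ] E → 0 < μ (symmDiff D₀ (D ∩ E)) := by
  intro D hD hDpos
  by_contra! hcon
  have htrace : ∀ S, MeasurableSet[𝒯] S →
      ∃ E, MeasurableSet[ℱ] E ∧ μ (symmDiff (D ∩ S) (D ∩ E)) = 0 := fun S hS =>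
    (hcon (D ∩ S) inter_subset_left (hD.inter hS)).imp fun _ h => ⟨h.1, nonpos_iff_eq_zero.mp h.2⟩
  obtain ⟨m, hm⟩ := ENNReal.exists_inv_nat_lt hDpos.ne'
  have hm0 : m ≠ 0 := by
    rintro rfl
    simp at hm
  let e := Infinite.natEmbedding X
  let s : Finset X := (Finset.range m).map e
  have hs : s.Nonempty := by simpa [s] using hm0
  have hcard : s.card = m := by simp [s]
  let P : Measure X := (PMF.uniformOfFinset s hs).toMeasure
  obtain ⟨g, hg, hgP⟩ := hB5 ℱ le_rfl (fun _ => P) (fun _ => inferInstance)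
    (fun _ _ => measurable_const)
  have hsingle : ∀ x ∈ s, P {x} = (m : ℝ≥0∞)⁻¹ := fun x hx => by
    rw [PMF.toMeasure_apply_singleton _ _ (measurableSet_singleton x),
      PMF.uniformOfFinset_apply_of_mem hs hx, hcard]
  have hcompl : P (s : Set X)ᶜ = 0 := by
    rw [PMF.toMeasure_apply_eq_zero_iff _ s.measurableSet.compl, PMF.support_uniformOfFinset]
    exact disjoint_compl_right
  choose E hE hDE using fun i => htrace (g ⁻¹' {e i}) (hg (measurableSet_singleton _))
  refine hm.not_ge (measure_le_of_trace_eq_of_measure_inter_le (𝒯 := 𝒯) hℱ (n := m) ?_ ?_ hE hDE ?_)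
  · intro i j hij
    exact Disjoint.preimage g (disjoint_singleton.mpr (e.injective.ne hij))
  · have hnull : μ (g ⁻¹' (s : Set X)ᶜ) = 0 := by
      simpa [hcompl] using hgP _ s.measurableSet.compl univ MeasurableSet.univ
    filter_upwards [measure_eq_zero_iff_ae_notMem.mp hnull] with t ht
    have hts : g t ∈ s := by simpa using ht
    obtain ⟨i, hi, hit⟩ := Finset.mem_map.mp hts
    exact ⟨i, Finset.mem_range.mp hi, hit.symm⟩
  · intro i hi A hA
    rw [hgP _ (measurableSet_singleton _) A hA, lintegral_const, Measure.restrict_apply_univ,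
      hsingle _ (Finset.mem_map_of_mem e (Finset.mem_range.mpr hi))]
end

section
/- Let (T, 𝒯, λ) be a complete atomless probability space, ℱ ⊆ 𝒯 a sub-σ-algebra, and X an infinite Polish space. Then 𝒯 is nowhere equivalent to ℱ if and only if for every sub-σ-algebra 𝒢 ⊆ ℱ and every 𝒢-measurable transition probability G from T to X, there exists a 𝒯-measurable g : T → X such that μ^{g|𝒢} = G (i.e., for every Borel B ⊆ X and every A ∈ 𝒢, λ(A ∩ g⁻¹(B)) = ∫_A G(t)(B) dλ(t)). -/
open MeasureTheory Set Filter Topology ENNReal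

/-- The σ-algebra `mT` is nowhere equivalent to `m` with respect to `μ`: no measurable set `D` of
positive measure has all its measurable subsets of the form `D ∩ E`, with `E` in `m`, up to null
sets. -/
def IsNowhereEquivalent {T : Type*} (m : MeasurableSpace T) {mT : MeasurableSpace T}
    (μ : Measure T) : Prop :=
  ∀ D : Set T, MeasurableSet[mT] D → 0 < μ D → ∃ D₀ ⊆ D, MeasurableSet[mT] D₀ ∧
    ∀ E : Set T, MeasurableSet[m] E → 0 < μ (symmDiff D₀ (D ∩ E))

/-- Exhaustion principle: a nonempty family of sets closed under increasing countable unions has a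
member whose measure cannot be increased by enlarging it within the family. -/
theorem exists_measure_maximal {T : Type*} {mT : MeasurableSpace T} (μ : Measure T)
    [IsFiniteMeasure μ] {P : Set T → Prop} (hne : ∃ E, P E)
    (hUnion : ∀ E : ℕ → Set T, Monotone E → (∀ n, P (E n)) → P (⋃ n, E n)) :
    ∃ E, P E ∧ ∀ F, E ⊆ F → P F → μ F ≤ μ E := by
  have step : ∀ (n : ℕ) (E : {E // P E}), ∃ F : {F // P F}, E.1 ⊆ F.1 ∧
      ∀ F', E.1 ⊆ F' → P F' → μ F' ≤ μ F.1 + (n : ℝ≥0∞)⁻¹ := by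
    intro n E
    by_contra! h
    set S : Set ℝ≥0∞ := {x | ∃ F, E.1 ⊆ F ∧ P F ∧ μ F = x}
    have hfin : sSup S ≠ ∞ := by
      refine ne_top_of_le_ne_top (measure_ne_top μ univ) (sSup_le ?_)
      rintro _ ⟨F, -, -, rfl⟩
      exact measure_mono (subset_univ F)
    have hSne : S.Nonempty := ⟨_, E.1, subset_rfl, E.2, rfl⟩
    obtain ⟨x, ⟨F, hEF, hF, rfl⟩, hx⟩ : ∃ x ∈ S, sSup S ≤ x + (n : ℝ≥0∞)⁻¹ := by
      by_cases h0 : sSup S = 0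
      · exact ⟨_, hSne.some_mem, by simp [h0]⟩
      · obtain ⟨x, hxS, hx⟩ := exists_lt_of_lt_csSup hSne
          (ENNReal.sub_lt_self hfin h0 (ENNReal.inv_ne_zero.2 (ENNReal.natCast_ne_top n)))
        exact ⟨x, hxS, tsub_le_iff_right.1 hx.le⟩
    obtain ⟨F', hEF', hF', hlt⟩ := h ⟨F, hF⟩ hEF
    exact hlt.not_ge ((le_sSup (show μ F' ∈ S from ⟨F', hEF', hF', rfl⟩)).trans hx)
  choose next hsub hmax using step
  obtain ⟨E₀, hE₀⟩ := hne
  let E : ℕ → {E // P E} := fun n => Nat.rec ⟨E₀, hE₀⟩ next n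
  have hmono : Monotone fun n => (E n).1 := monotone_nat_of_le_succ fun n => hsub n (E n)
  refine ⟨⋃ n, (E n).1, hUnion _ hmono fun n => (E n).2, fun F hF hPF => ?_⟩
  have hle : ∀ n : ℕ, μ F ≤ μ (⋃ n, (E n).1) + (n : ℝ≥0∞)⁻¹ := fun n =>
    (hmax n (E n) F ((subset_iUnion (fun n => (E n).1) n).trans hF) hPF).trans
      (by gcongr; exact subset_iUnion (fun n => (E n).1) (n + 1))
  refine ge_of_tendsto' (f := fun n : ℕ => μ (⋃ n, (E n).1) + (n : ℝ≥0∞)⁻¹) (x := atTop) ?_ hle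
  simpa using ENNReal.tendsto_inv_nat_nhds_zero.const_add (μ (⋃ n, (E n).1))

section Halving

variable {T : Type*} {m mT : MeasurableSpace T} {μ : Measure T}

theorem exists_hahn_decomposition_of_le (hm : m ≤ mT) (μ ν : Measure T) [IsFiniteMeasure μ]
    [IsFiniteMeasure ν] :
    ∃ H, MeasurableSet[m] H ∧ (∀ A, MeasurableSet[m] A → A ⊆ H → μ A ≤ ν A) ∧
      ∀ A, MeasurableSet[m] A → A ⊆ Hᶜ → ν A ≤ μ A := by
  obtain ⟨H, hH, h₁, h₂⟩ := hahn_decomposition (ν.trim hm) (μ.trim hm)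
  refine ⟨H, hH, fun A hA hAH => ?_, fun A hA hAH => ?_⟩
  · simpa [trim_measurableSet_eq hm hA] using h₁ A hA hAH
  · simpa [trim_measurableSet_eq hm hA] using h₂ A hA hAH

namespace IsNowhereEquivalent

theorem mono {m' : MeasurableSpace T} (h : IsNowhereEquivalent m μ) (hle : m' ≤ m) :
    IsNowhereEquivalent m' μ := fun D hD hpos =>
  let ⟨D₀, hsub, hD₀, hE⟩ := h D hD hpos
  ⟨D₀, hsub, hD₀, fun E hE' => hE E (hle E hE')⟩

theorem exists_subset_two_mul_le [IsFiniteMeasure μ] (h : IsNowhereEquivalent m μ) (hm : m ≤ mT)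
    {D : Set T} (hD : MeasurableSet D) (hpos : 0 < μ D) :
    ∃ S ⊆ D, MeasurableSet S ∧ 0 < μ S ∧
      ∀ A, MeasurableSet[m] A → 2 * μ (A ∩ S) ≤ μ (A ∩ D) := by
  obtain ⟨D₀, hsub, hD₀, hne⟩ := h D hD hpos
  obtain ⟨H, hH, h₁, h₂⟩ :=
    exists_hahn_decomposition_of_le hm (μ.restrict D₀) (μ.restrict (D \ D₀))
  have hS : MeasurableSet (symmDiff D₀ (D ∩ Hᶜ)) :=
    hD₀.symmDiff (hD.inter (hm _ hH).compl)
  have hSD : symmDiff D₀ (D ∩ Hᶜ) ⊆ D := by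
    intro t; simp only [mem_symmDiff]; grind
  refine ⟨symmDiff D₀ (D ∩ Hᶜ), hSD, hS, hne _ hH.compl, fun A hA => ?_⟩
  have e₁ := h₁ (A ∩ H) (hA.inter hH) inter_subset_right
  have e₂ := h₂ (A ∩ Hᶜ) (hA.inter hH.compl) inter_subset_right
  rw [Measure.restrict_apply (hm _ (hA.inter hH)),
    Measure.restrict_apply (hm _ (hA.inter hH))] at e₁
  rw [Measure.restrict_apply (hm _ (hA.inter hH.compl)),
    Measure.restrict_apply (hm _ (hA.inter hH.compl))] at e₂
  have key : μ (A ∩ symmDiff D₀ (D ∩ Hᶜ)) ≤ μ ((A ∩ D) \ symmDiff D₀ (D ∩ Hᶜ)) := by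
    rw [← measure_inter_add_sdiff (A ∩ symmDiff D₀ (D ∩ Hᶜ)) (hm _ hH),
      ← measure_inter_add_sdiff ((A ∩ D) \ symmDiff D₀ (D ∩ Hᶜ)) (hm _ hH)]
    refine add_le_add ((measure_mono ?_).trans (e₁.trans (measure_mono ?_)))
      ((measure_mono ?_).trans (e₂.trans (measure_mono ?_))) <;>
    · intro t; simp only [mem_inter_iff, Set.mem_sdiff, mem_symmDiff, mem_compl_iff]; grind
  have hsplit := measure_inter_add_sdiff (μ := μ) (A ∩ D) hS
  rw [inter_assoc, inter_eq_self_of_subset_right hSD] at hsplit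
  rw [two_mul, ← hsplit]
  gcongr

theorem exists_subset_le_mul [IsFiniteMeasure μ] (h : IsNowhereEquivalent m μ) (hm : m ≤ mT)
    {D : Set T} (hD : MeasurableSet D) (hpos : 0 < μ D) {c : ℝ≥0∞} (hc : c ≠ 0) :
    ∃ S ⊆ D, MeasurableSet S ∧ 0 < μ S ∧
      ∀ A, MeasurableSet[m] A → μ (A ∩ S) ≤ c * μ (A ∩ D) := by
  have hpow : ∀ n : ℕ, ∃ S ⊆ D, MeasurableSet S ∧ 0 < μ S ∧
      ∀ A, MeasurableSet[m] A → 2 ^ n * μ (A ∩ S) ≤ μ (A ∩ D) := by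
    intro n
    induction n with
    | zero => exact ⟨D, subset_rfl, hD, hpos, fun A _ => by simp⟩
    | succ n ih =>
      obtain ⟨S, hSD, hS, hSpos, hle⟩ := ih
      obtain ⟨S', hS'S, hS', hS'pos, hle'⟩ := h.exists_subset_two_mul_le hm hS hSpos
      refine ⟨S', hS'S.trans hSD, hS', hS'pos, fun A hA => ?_⟩
      rw [pow_succ, mul_assoc]
      exact (mul_le_mul_right (hle' A hA) _).trans (hle A hA)
  obtain ⟨n, hn⟩ := ENNReal.exists_inv_two_pow_lt hc
  obtain ⟨S, hSD, hS, hSpos, hle⟩ := hpow n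
  refine ⟨S, hSD, hS, hSpos, fun A hA => ?_⟩
  calc μ (A ∩ S) = 2⁻¹ ^ n * (2 ^ n * μ (A ∩ S)) := by
        rw [← mul_assoc, ← mul_pow, ENNReal.inv_mul_cancel (by simp) (by simp), one_pow, one_mul]
    _ ≤ c * μ (A ∩ D) := mul_le_mul' hn.le (hle A hA)

theorem exists_half [IsProbabilityMeasure μ] (h : IsNowhereEquivalent m μ) (hm : m ≤ mT)
    {D : Set T} (hD : MeasurableSet D) :
    ∃ S ⊆ D, MeasurableSet S ∧ ∀ A, MeasurableSet[m] A → 2 * μ (A ∩ S) = μ (A ∩ D) := by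
  obtain ⟨S, ⟨hSD, hS, hle⟩, hmax⟩ := exists_measure_maximal μ
    (P := fun S => S ⊆ D ∧ MeasurableSet S ∧
      ∀ A, MeasurableSet[m] A → 2 * μ (A ∩ S) ≤ μ (A ∩ D))
    ⟨∅, empty_subset D, .empty, by simp⟩ (by
      intro E hE hP
      refine ⟨iUnion_subset fun n => (hP n).1, .iUnion fun n => (hP n).2.1, fun A hA => ?_⟩
      have hmono : Monotone fun n => A ∩ E n := fun i j hij => inter_subset_inter_right A (hE hij)
      rw [inter_iUnion, hmono.measure_iUnion, ENNReal.mul_iSup]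
      exact iSup_le fun n => (hP n).2.2 A hA)
  have htotal : 2 * μ S = μ D := by
    by_contra hne
    have hlt : 2 * μ S < μ D :=
      lt_of_le_of_ne (by simpa using hle univ .univ) hne
    obtain ⟨c, hc0, hc⟩ : ∃ c : NNReal, 0 < c ∧ 2 * μ S + c < μ D := by
      obtain ⟨c, hc0, hc⟩ := ENNReal.lt_iff_exists_add_pos_lt.1 hlt
      exact ⟨c, hc0, hc⟩
    obtain ⟨H, hH, h₁, h₂⟩ := exists_hahn_decomposition_of_le hm
      ((2 : NNReal) • μ.restrict S + c • μ.restrict (D \ S)) (μ.restrict D)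
    simp only [Measure.coe_add, Pi.add_apply, Measure.coe_nnreal_smul_apply] at h₁ h₂
    have hpos : 0 < μ (H ∩ (D \ S)) := by
      rw [pos_iff_ne_zero]
      intro h0
      have e₁ : μ (H ∩ D) ≤ 2 * μ (S ∩ H) := by
        have : μ (H ∩ D) ≤ μ (S ∩ H) + μ (H ∩ (D \ S)) :=
          (measure_mono (by
            intro t; simp only [mem_inter_iff, mem_union, Set.mem_sdiff]; grind)).trans
            (measure_union_le _ _)
        rw [h0, add_zero] at this
        refine this.trans ?_
        rw [two_mul]; exact le_self_add
      have e₂ := h₂ Hᶜ hH.compl subset_rfl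
      rw [Measure.restrict_apply (hm _ hH.compl), Measure.restrict_apply (hm _ hH.compl),
        Measure.restrict_apply (hm _ hH.compl)] at e₂
      refine hc.not_ge ?_
      calc μ D = μ (D ∩ H) + μ (D \ H) := (measure_inter_add_sdiff D (hm _ hH)).symm
        _ ≤ 2 * μ (S ∩ H) + (2 * μ (S \ H) + c * 1) := by
          rw [inter_comm D H, Set.sdiff_eq D H, inter_comm D Hᶜ, Set.sdiff_eq S H, inter_comm S Hᶜ]
          refine add_le_add e₁ (e₂.trans ?_)
          push_cast
          gcongr
          exact prob_le_one
        _ = 2 * μ S + c := by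
          rw [← add_assoc, ← mul_add, measure_inter_add_sdiff S (hm _ hH), mul_one]
    obtain ⟨S', hS'sub, hS', hS'pos, hS'le⟩ := h.exists_subset_le_mul hm
      ((hm _ hH).inter (hD.diff hS)) hpos (c := c / 2) (by simp [hc0.ne'])
    have hdisj : Disjoint S S' := by
      rw [Set.disjoint_left]; intro t ht ht'; exact (hS'sub ht').2.2 ht
    refine (hmax (S ∪ S') subset_union_left ⟨?_, hS.union hS', fun A hA => ?_⟩).not_gt ?_
    · exact union_subset hSD fun t ht => (hS'sub ht).2.1
    · have hAH := h₁ (A ∩ H) (hA.inter hH) inter_subset_right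
      rw [Measure.restrict_apply (hm _ (hA.inter hH)), Measure.restrict_apply (hm _ (hA.inter hH)),
        Measure.restrict_apply (hm _ (hA.inter hH))] at hAH
      have hAHc := hle (A \ H) (hA.diff hH)
      have hc2 : 2 * μ (A ∩ S') ≤ c * μ (A ∩ H ∩ (D \ S)) := by
        calc 2 * μ (A ∩ S') ≤ 2 * (c / 2 * μ (A ∩ (H ∩ (D \ S)))) := by
              gcongr; exact hS'le A hA
          _ = _ := by
              rw [← mul_assoc, ENNReal.mul_div_cancel (by simp) (by simp), inter_assoc]
      calc 2 * μ (A ∩ (S ∪ S')) ≤ 2 * (μ (A ∩ S) + μ (A ∩ S')) := by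
            rw [inter_union_distrib_left]; gcongr; exact measure_union_le _ _
        _ = 2 * μ (A ∩ H ∩ S) + 2 * μ ((A \ H) ∩ S) + 2 * μ (A ∩ S') := by
            rw [← measure_inter_add_sdiff (A ∩ S) (hm _ hH), inter_right_comm,
              inter_sdiff_right_comm, mul_add, mul_add]
        _ ≤ 2 * μ (A ∩ H ∩ S) + μ ((A \ H) ∩ D) + c * μ (A ∩ H ∩ (D \ S)) := by gcongr
        _ = (2 * μ (A ∩ H ∩ S) + c * μ (A ∩ H ∩ (D \ S))) + μ ((A \ H) ∩ D) := by ring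
        _ ≤ μ (A ∩ H ∩ D) + μ ((A \ H) ∩ D) := by gcongr; exact_mod_cast hAH
        _ = μ (A ∩ D) := by
            rw [← measure_inter_add_sdiff (A ∩ D) (hm _ hH), inter_right_comm,
              inter_sdiff_right_comm]
    · rw [measure_union hdisj hS']
      exact ENNReal.lt_add_right (measure_ne_top μ S) hS'pos.ne'
  refine ⟨S, hSD, hS, fun A hA => (hle A hA).antisymm ?_⟩
  have e₁ := measure_inter_add_sdiff (μ := μ) D (hm _ hA)
  have e₂ := measure_inter_add_sdiff (μ := μ) S (hm _ hA)
  have e₃ := hle Aᶜ hA.compl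
  rw [Set.sdiff_eq, inter_comm D, inter_comm D] at e₁
  rw [Set.sdiff_eq, inter_comm S, inter_comm S] at e₂
  refine (ENNReal.add_le_add_iff_right (measure_ne_top μ (Aᶜ ∩ D))).1 ?_
  rw [e₁, ← htotal, ← e₂, mul_add]
  gcongr

end IsNowhereEquivalent

end Halving

section Randomization

variable {T : Type*} {m mT : MeasurableSpace T} {μ : Measure T}

/-- `V` takes values in `{0, …, 2 ^ n - 1}` and is uniformly distributed there, independently
of `m`. -/
def IsDyadicUniform (m : MeasurableSpace T) {mT : MeasurableSpace T} (μ : Measure T) (n : ℕ)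
    (V : T → ℕ) : Prop :=
  Measurable[mT] V ∧ (∀ t, V t < 2 ^ n) ∧
    ∀ A, MeasurableSet[m] A → ∀ k < 2 ^ n, 2 ^ n * μ (A ∩ V ⁻¹' {k}) = μ A

namespace IsDyadicUniform

variable {n : ℕ} {V : T → ℕ}

theorem exists_refinement [IsProbabilityMeasure μ] (h : IsNowhereEquivalent m μ) (hm : m ≤ mT)
    (hV : IsDyadicUniform m μ n V) :
    ∃ V', IsDyadicUniform m μ (n + 1) V' ∧ ∀ t, V' t / 2 = V t := by
  classical
  obtain ⟨hVm, hVlt, hVμ⟩ := hV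
  choose S hSV hS hSμ using fun k : ℕ => h.exists_half hm (hVm (measurableSet_singleton k))
  have hSU : MeasurableSet (⋃ k, S k) := .iUnion hS
  have hmem : ∀ t, t ∈ ⋃ k, S k ↔ t ∈ S (V t) := fun t => by
    refine ⟨fun ht => ?_, fun ht => mem_iUnion.2 ⟨_, ht⟩⟩
    obtain ⟨k, hk⟩ := mem_iUnion.1 ht
    have : V t = k := hSV k hk
    rwa [this]
  have hdiff : ∀ A, MeasurableSet[m] A → ∀ k,
      2 * μ (A ∩ (V ⁻¹' {k} \ S k)) = μ (A ∩ V ⁻¹' {k}) := by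
    intro A hA k
    have e := measure_inter_add_sdiff (μ := μ) (A ∩ V ⁻¹' {k}) (hS k)
    rw [inter_assoc, inter_eq_self_of_subset_right (hSV k), inter_sdiff_assoc] at e
    have e' := hSμ k A hA
    rw [← e, two_mul] at e'
    rw [← e, two_mul, (ENNReal.add_right_inj (measure_ne_top μ _)).1 e']
  have hV' : Measurable fun t => 2 * V t + if t ∈ ⋃ k, S k then 0 else 1 :=
    (hVm.const_mul 2).add (Measurable.ite hSU measurable_const measurable_const)
  refine ⟨_, ⟨hV', fun t => ?_, fun A hA j hj => ?_⟩, fun t => ?_⟩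
  · have := hVlt t
    rw [pow_succ]
    split_ifs <;> omega
  · have hk : j / 2 < 2 ^ n := by rw [pow_succ] at hj; omega
    rw [← hVμ A hA _ hk, pow_succ, mul_assoc]
    rcases Nat.even_or_odd' j with ⟨k, rfl | rfl⟩
    · rw [show 2 * k / 2 = k by omega, ← hSμ k A hA]
      congr 4
      ext t
      simp only [mem_preimage, mem_singleton_iff, hmem]
      refine ⟨fun ht => ?_, fun ht => ?_⟩
      · split_ifs at ht with h1
        · rwa [show V t = k by omega] at h1
        · omega
      · have hVt : V t = k := hSV k ht
        rw [hVt, if_pos ht]; rfl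
    · rw [show (2 * k + 1) / 2 = k by omega, ← hdiff A hA k]
      congr 4
      ext t
      simp only [mem_preimage, mem_singleton_iff, hmem, Set.mem_sdiff]
      refine ⟨fun ht => ?_, fun ⟨hVt, ht⟩ => ?_⟩
      · split_ifs at ht with h1
        · omega
        · have hVt : V t = k := by omega
          exact ⟨hVt, hVt ▸ h1⟩
      · rw [hVt, if_neg ht]
  · split_ifs <;> omega

theorem measureReal_inter_lt [IsFiniteMeasure μ] (hV : IsDyadicUniform m μ n V) (hm : m ≤ mT)
    {A : Set T} (hA : MeasurableSet[m] A) {j : ℕ} (hj : j ≤ 2 ^ n) :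
    2 ^ n * μ.real (A ∩ {t | V t < j}) = j * μ.real A := by
  induction j with
  | zero => simp
  | succ j ih =>
    have hsplit : A ∩ {t | V t < j + 1} = (A ∩ {t | V t < j}) ∪ (A ∩ V ⁻¹' {j}) := by
      ext t; simp only [mem_inter_iff, mem_union, mem_ofPred_eq, mem_preimage, mem_singleton_iff]
      grind
    have hdisj : Disjoint (A ∩ {t | V t < j}) (A ∩ V ⁻¹' {j}) := by
      rw [Set.disjoint_left]
      rintro t ⟨-, ht⟩ ⟨-, ht'⟩
      exact ht.ne ht'
    have e : 2 ^ n * μ.real (A ∩ V ⁻¹' {j}) = μ.real A := by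
      simpa [Measure.real] using congrArg ENNReal.toReal (hV.2.2 A hA j hj)
    rw [hsplit, measureReal_union hdisj ((hm _ hA).inter (hV.1 (measurableSet_singleton j))),
      mul_add, ih (by omega), e]
    push_cast; ring

theorem measureReal_inter_lt_le [IsFiniteMeasure μ] (hV : IsDyadicUniform m μ n V) (hm : m ≤ mT)
    {A : Set T} (hA : MeasurableSet[m] A) (j : ℕ) :
    2 ^ n * μ.real (A ∩ {t | V t < j}) ≤ j * μ.real A := by
  rcases le_total j (2 ^ n) with hj | hj
  · exact (hV.measureReal_inter_lt hm hA hj).le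
  · have hj' : (2 : ℝ) ^ n ≤ j := by exact_mod_cast hj
    exact mul_le_mul hj' (measureReal_mono (μ := μ) inter_subset_left) measureReal_nonneg
      (Nat.cast_nonneg j)

end IsDyadicUniform

open unitInterval

/-- If `mT` is nowhere equivalent to `m`, there is a `mT`-measurable random variable that is
uniform on the unit interval and independent of `m`. -/
theorem IsNowhereEquivalent.exists_uniform [IsProbabilityMeasure μ]
    (h : IsNowhereEquivalent m μ) (hm : m ≤ mT) :
    ∃ U : T → I, Measurable[mT] U ∧ ∀ A, MeasurableSet[m] A → ∀ B, MeasurableSet B →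
      μ (A ∩ U ⁻¹' B) = μ A * volume B := by
  obtain ⟨V, hV, hdiv⟩ : ∃ V : ℕ → T → ℕ, (∀ n, IsDyadicUniform m μ n (V n)) ∧
      ∀ n t, V (n + 1) t / 2 = V n t := by
    choose! next hnext using fun n V (hV : IsDyadicUniform m μ n V) => hV.exists_refinement h hm
    let V : ℕ → T → ℕ := fun n => Nat.rec (fun _ => 0) next n
    have hV : ∀ n, IsDyadicUniform m μ n (V n) := by
      intro n
      induction n with
      | zero =>
        refine ⟨measurable_const, by simp [V], fun A _ k hk => ?_⟩
        obtain rfl : k = 0 := by simpa using hk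
        simp [V]
      | succ n ih => exact (hnext n (V n) ih).1
    exact ⟨V, hV, fun n t => (hnext n (V n) (hV n)).2 t⟩
  have hlow : ∀ t, Monotone fun n => (V n t : ℝ) / 2 ^ n := fun t =>
    monotone_nat_of_le_succ fun n => by
      have : 2 * V n t ≤ V (n + 1) t := by have := hdiv n t; omega
      have : (2 : ℝ) * V n t ≤ V (n + 1) t := by exact_mod_cast this
      rw [div_le_div_iff₀ (by positivity) (by positivity), pow_succ]
      nlinarith [pow_pos (two_pos : (0 : ℝ) < 2) n]
  have hupp : ∀ t, Antitone fun n => ((V n t : ℝ) + 1) / 2 ^ n := fun t =>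
    antitone_nat_of_succ_le fun n => by
      have : V (n + 1) t + 1 ≤ 2 * (V n t + 1) := by have := hdiv n t; omega
      have : (V (n + 1) t + 1 : ℝ) ≤ 2 * (V n t + 1) := by exact_mod_cast this
      rw [div_le_div_iff₀ (by positivity) (by positivity), pow_succ]
      nlinarith [pow_pos (two_pos : (0 : ℝ) < 2) n]
  have hlu : ∀ t i j, (V i t : ℝ) / 2 ^ i ≤ (V j t + 1) / 2 ^ j := fun t i j =>
    (hlow t (le_max_left i j)).trans <|
      (show (V (max i j) t : ℝ) / 2 ^ max i j ≤ (V (max i j) t + 1) / 2 ^ max i j by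
        gcongr; linarith).trans (hupp t (le_max_right i j))
  set W : T → ℝ := fun t => ⨆ n, (V n t : ℝ) / 2 ^ n
  have hbdd : ∀ t, BddAbove (range fun n => (V n t : ℝ) / 2 ^ n) := fun t =>
    ⟨_, by rintro _ ⟨n, rfl⟩; exact hlu t n 0⟩
  have hW_low : ∀ t n, (V n t : ℝ) / 2 ^ n ≤ W t := fun t n => le_ciSup (hbdd t) n
  have hW_upp : ∀ t n, W t ≤ (V n t + 1) / 2 ^ n := fun t n => ciSup_le fun i => hlu t i n
  have hV0 : ∀ t, V 0 t = 0 := fun t => by have := (hV 0).2.1 t; omega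
  have hWI : ∀ t, W t ∈ I := fun t =>
    ⟨by simpa [hV0] using hW_low t 0, by simpa [hV0] using hW_upp t 0⟩
  have hWm : Measurable W := by
    refine Measurable.iSup fun n => ?_
    exact (measurable_from_top.comp (hV n).1).div_const _
  refine ⟨fun t => ⟨W t, hWI t⟩, hWm.subtype_mk, fun A hA B hB => ?_⟩
  have hUm : Measurable fun t => (⟨W t, hWI t⟩ : I) := hWm.subtype_mk
  have hlaw : (μ.restrict A).map (fun t => (⟨W t, hWI t⟩ : I)) = (μ A).toNNReal • volume := by
    refine Measure.ext_of_Iic _ _ fun x => ?_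
    rw [Measure.map_apply hUm measurableSet_Iic,
      Measure.restrict_apply (hUm measurableSet_Iic), Measure.coe_nnreal_smul_apply,
      ENNReal.coe_toNNReal (measure_ne_top μ A), unitInterval.volume_Iic, inter_comm,
      ← ofReal_measureReal, ← ofReal_measureReal (μ := μ), ← ENNReal.ofReal_mul measureReal_nonneg]
    congr 1
    set r := μ.real (A ∩ (fun t => (⟨W t, hWI t⟩ : I)) ⁻¹' Iic x)
    have hx0 : (0 : ℝ) ≤ x := x.2.1
    have hx1 : (x : ℝ) ≤ 1 := x.2.2
    have hm0 : 0 ≤ μ.real A := measureReal_nonneg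
    have hbound : ∀ n : ℕ, |r - μ.real A * x| ≤ μ.real A * (1 / 2) ^ n := by
      intro n
      have hp : (0 : ℝ) < 2 ^ n := by positivity
      set j := ⌊(x : ℝ) * 2 ^ n⌋₊
      have hj_le : (j : ℝ) ≤ x * 2 ^ n := Nat.floor_le (by positivity)
      have hj_lt : x * 2 ^ n < (j : ℝ) + 1 := Nat.lt_floor_add_one _
      have hj : j ≤ 2 ^ n := by
        have : (j : ℝ) ≤ 2 ^ n := hj_le.trans (mul_le_of_le_one_left hp.le hx1)
        exact_mod_cast this
      have h₁ : j * μ.real A ≤ 2 ^ n * r := by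
        rw [← (hV n).measureReal_inter_lt hm hA hj]
        refine mul_le_mul_of_nonneg_left
          (measureReal_mono (inter_subset_inter_right A fun t ht => ?_)) hp.le
        have : ((V n t : ℝ) + 1) ≤ j := by exact_mod_cast Nat.succ_le_of_lt ht
        refine (hW_upp t n).trans ?_
        rw [div_le_iff₀ hp]
        linarith
      have h₂ : 2 ^ n * r ≤ (j + 1) * μ.real A := by
        have h₃ := (hV n).measureReal_inter_lt_le hm hA (j + 1)
        push_cast at h₃
        refine le_trans (mul_le_mul_of_nonneg_left ?_ hp.le) h₃
        refine measureReal_mono (inter_subset_inter_right A fun t ht => ?_)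
        have hWx : W t ≤ x := ht
        have hVx := (hW_low t n).trans hWx
        rw [div_le_iff₀ hp] at hVx
        have : (V n t : ℝ) < j + 1 := hVx.trans_lt hj_lt
        exact_mod_cast this
      rw [one_div, inv_pow, ← div_eq_mul_inv, le_div_iff₀ hp]
      nth_rewrite 1 [← abs_of_pos hp]
      rw [← abs_mul, abs_le]
      constructor <;> nlinarith
    have hlim : Tendsto (fun n : ℕ => μ.real A * (1 / 2 : ℝ) ^ n) atTop (𝓝 0) := by
      simpa using (tendsto_pow_atTop_nhds_zero_of_lt_one (r := (1 / 2 : ℝ)) (by norm_num)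
        (by norm_num)).const_mul (μ.real A)
    exact sub_eq_zero.1 (abs_nonpos_iff.1 (ge_of_tendsto' hlim hbound))
  have := congrArg (fun ν => ν B) hlaw
  simp only [Measure.coe_nnreal_smul_apply, ENNReal.coe_toNNReal (measure_ne_top μ A)] at this
  rw [← this, Measure.map_apply hUm hB, Measure.restrict_apply (hUm hB), inter_comm]

open ProbabilityTheory in
/-- A `mT`-measurable uniform random variable independent of `m` realizes every `m`-measurable
transition probability as a conditional distribution. -/
theorem exists_realization_of_uniform [IsProbabilityMeasure μ] (hm : m ≤ mT) {U : T → I}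
    (hU : Measurable[mT] U) (hind : ∀ A, MeasurableSet[m] A → ∀ B, MeasurableSet B →
      μ (A ∩ U ⁻¹' B) = μ A * volume B)
    {X : Type*} [MeasurableSpace X] [StandardBorelSpace X] [Nonempty X] (G : T → Measure X)
    (hG : ∀ t, IsProbabilityMeasure (G t))
    (hGm : ∀ B : Set X, MeasurableSet B → Measurable[m] fun t => G t B) :
    ∃ g : T → X, Measurable[mT] g ∧ ∀ B : Set X, MeasurableSet B → ∀ A : Set T,
      MeasurableSet[m] A → μ (A ∩ g ⁻¹' B) = ∫⁻ t in A, G t B ∂μ := by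
  let κ : @Kernel T X m _ := @Kernel.mk _ _ m _ G (Measure.measurable_of_measurable_coe _ hGm)
  have hκ : @IsMarkovKernel _ _ m _ κ := @IsMarkovKernel.mk _ _ m _ κ hG
  obtain ⟨f, hf, hfκ⟩ := @Kernel.exists_measurable_map_eq_unitInterval _ _ m _ _ _ κ hκ
  have hpair : @Measurable _ _ mT (m.prod inferInstance) fun t => (t, U t) :=
    (measurable_id'' hm).prodMk hU
  have hlaw : @Measure.map _ _ mT (m.prod inferInstance) (fun t => (t, U t)) μ =
      @Measure.prod _ _ m _ (μ.trim hm) volume := by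
    refine (@Measure.prod_eq _ _ m _ _ _ _ _ _ fun A B hA hB => ?_).symm
    rw [Measure.map_apply hpair (hA.prod hB), trim_measurableSet_eq hm hA, ← hind A hA B hB]
    rfl
  refine ⟨fun t => f t (U t), hf.comp hpair, fun B hB A hA => ?_⟩
  have hset : @MeasurableSet _ (m.prod inferInstance)
      (Prod.fst ⁻¹' A ∩ Function.uncurry f ⁻¹' B) :=
    ((@measurable_fst _ _ m _) hA).inter (hf hB)
  have hpre : A ∩ (fun t => f t (U t)) ⁻¹' B =
      (fun t => (t, U t)) ⁻¹' (Prod.fst ⁻¹' A ∩ Function.uncurry f ⁻¹' B) := rfl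
  rw [hpre, ← Measure.map_apply hpair hset, hlaw, @Measure.prod_apply _ _ m _ _ _ _ _ hset,
    ← lintegral_indicator (hm _ hA), ← lintegral_trim hm ((hGm B hB).indicator hA)]
  refine lintegral_congr fun t => ?_
  by_cases ht : t ∈ A
  · have hft : Measurable (f t) := hf.comp (@measurable_prodMk_left _ _ m _ t)
    rw [indicator_of_mem ht, show G t = volume.map (f t) from (hfκ t).symm,
      Measure.map_apply hft hB]
    congr 1
    ext u
    simp [ht]
  · rw [indicator_of_notMem ht]
    refine (congrArg volume (?_ : _ = (∅ : Set I))).trans measure_empty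
    ext u
    simp [ht]

end Randomization

section Converse

variable {T : Type*} {m mT : MeasurableSpace T} {μ : Measure T}

/-- If for every `N` the space splits into finitely many sets having conditional probability at
most `1 / (N + 1)` given `m`, then `mT` is nowhere equivalent to `m`. -/
theorem isNowhereEquivalent_of_partitions [IsProbabilityMeasure μ] (hm : m ≤ mT)
    (h : ∀ N : ℕ, ∃ S : Fin (N + 1) → Set T, (∀ i, MeasurableSet[mT] (S i)) ∧
      μ (⋃ i, S i)ᶜ = 0 ∧
      ∀ i A, MeasurableSet[m] A → (N + 1) * μ (A ∩ S i) ≤ μ A) :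
    IsNowhereEquivalent m μ := by
  intro D hD hpos
  by_contra! hD'
  obtain ⟨c, hc0, hc⟩ : ∃ c : NNReal, 0 < c ∧ c < μ D := by
    obtain ⟨c, hc0, hc⟩ := ENNReal.lt_iff_exists_nnreal_btwn.1 hpos
    exact ⟨c, by exact_mod_cast hc0, hc⟩
  obtain ⟨N, hN⟩ := ENNReal.exists_inv_nat_lt (a := c) (by exact_mod_cast hc0.ne')
  obtain ⟨S, hS, hcover, hSμ⟩ := h N
  choose E hE hE0 using fun i =>
    hD' (D ∩ S i) inter_subset_left (hD.inter (hS i))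
  simp only [nonpos_iff_eq_zero, measure_symmDiff_eq_zero_iff] at hE0
  obtain ⟨H, hH, h₁, h₂⟩ := exists_hahn_decomposition_of_le hm (c • μ) (μ.restrict D)
  simp only [Measure.coe_nnreal_smul_apply] at h₁ h₂
  have hnull : ∀ i, μ (D ∩ H ∩ S i) = 0 := by
    intro i
    have hHE := hH.inter (hE i)
    have e₁ := h₁ _ hHE inter_subset_left
    rw [Measure.restrict_apply (hm _ hHE)] at e₁
    have e₂ : μ (H ∩ E i ∩ D) ≤ μ (H ∩ E i ∩ S i) := by
      have : (H ∩ E i ∩ D : Set T) ≤ᵐ[μ] (H ∩ E i ∩ S i : Set T) := by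
        filter_upwards [(hE0 i).mem_iff] with t ht hmem
        exact ⟨hmem.1, (ht.2 ⟨hmem.2, hmem.1.2⟩).2⟩
      exact measure_mono_ae this
    have e₃ := hSμ i _ hHE
    have hHE0 : μ (H ∩ E i) = 0 := by
      by_contra hne
      have hlt : (N : ℝ≥0∞)⁻¹ * μ (H ∩ E i) < c * μ (H ∩ E i) :=
        ENNReal.mul_lt_mul_left hne (measure_ne_top μ _) hN
      refine hlt.not_ge ((e₁.trans e₂).trans ?_)
      calc μ (H ∩ E i ∩ S i)
          = ((N : ℝ≥0∞) + 1)⁻¹ * ((N + 1) * μ (H ∩ E i ∩ S i)) := by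
            rw [← mul_assoc, ENNReal.inv_mul_cancel (by simp) (by finiteness), one_mul]
        _ ≤ (N : ℝ≥0∞)⁻¹ * μ (H ∩ E i) :=
            mul_le_mul' (ENNReal.inv_le_inv.2 le_self_add) e₃
    have : (D ∩ H ∩ S i : Set T) ≤ᵐ[μ] (H ∩ E i : Set T) := by
      filter_upwards [(hE0 i).mem_iff] with t ht hmem
      exact ⟨hmem.1.2, (ht.1 ⟨hmem.1.1, hmem.2⟩).2⟩
    exact le_antisymm ((measure_mono_ae this).trans hHE0.le) zero_le
  have hDH : μ (D ∩ H) = 0 := by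
    refine measure_mono_null (t := (⋃ i, D ∩ H ∩ S i) ∪ (⋃ i, S i)ᶜ) ?_
      (measure_union_null (measure_iUnion_null hnull) hcover)
    intro t ht
    rw [← inter_iUnion]
    by_cases h : t ∈ ⋃ i, S i
    · exact Or.inl ⟨ht, h⟩
    · exact Or.inr h
  refine hc.not_ge ?_
  have e := h₂ Hᶜ hH.compl subset_rfl
  rw [Measure.restrict_apply (hm _ hH.compl)] at e
  rw [← measure_inter_add_sdiff D (hm _ hH), hDH, zero_add, Set.sdiff_eq, inter_comm]
  exact e.trans (mul_le_of_le_one_right' prob_le_one)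

end Converse

/-- (NE ⇔ B5) For a complete atomless probability space `(T, 𝒯, μ)`, a sub-σ-algebra
`ℱ ⊆ 𝒯`, and an infinite Polish space `X`: `𝒯` is nowhere equivalent to `ℱ` iff for
every sub-σ-algebra `𝒢 ⊆ ℱ` and every `𝒢`-measurable transition probability `G` from
`T` to `X` there is a `𝒯`-measurable `g : T → X` with `μ^{g|𝒢} = G`. -/
theorem nowhereEquivalent_iff_rcd_realization
    {T : Type*} [𝒯 : MeasurableSpace T] (μ : Measure T) [IsProbabilityMeasure μ]
    (hcomplete : μ.IsComplete)
    (hatomless : ∀ D : Set T, MeasurableSet[𝒯] D → 0 < μ D →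
      ∃ D₀ ⊆ D, MeasurableSet[𝒯] D₀ ∧ 0 < μ D₀ ∧ μ D₀ < μ D)
    (ℱ : MeasurableSpace T) (hℱ : ℱ ≤ 𝒯)
    {X : Type*} [TopologicalSpace X] [PolishSpace X] [MeasurableSpace X] [BorelSpace X]
    [Infinite X] :
    (∀ D : Set T, MeasurableSet[𝒯] D → 0 < μ D →
      ∃ D₀ ⊆ D, MeasurableSet[𝒯] D₀ ∧
        ∀ E : Set T, MeasurableSet[ℱ] E → 0 < μ (symmDiff D₀ (D ∩ E)))
    ↔
    (∀ 𝒢 : MeasurableSpace T, 𝒢 ≤ ℱ →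
      ∀ G : T → Measure X, (∀ t, IsProbabilityMeasure (G t)) →
        (∀ B : Set X, MeasurableSet B → Measurable[𝒢] fun t => G t B) →
        ∃ g : T → X, Measurable[𝒯] g ∧
          ∀ B : Set X, MeasurableSet B → ∀ A : Set T, MeasurableSet[𝒢] A →
            μ (A ∩ g ⁻¹' B) = ∫⁻ t in A, G t B ∂μ) := by
  change IsNowhereEquivalent ℱ μ ↔ _
  refine ⟨fun h 𝒢 h𝒢 G hG hGm => ?_, fun h => isNowhereEquivalent_of_partitions hℱ fun N => ?_⟩
  · obtain ⟨U, hU, hind⟩ := (h.mono h𝒢).exists_uniform (h𝒢.trans hℱ)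
    exact exists_realization_of_uniform (h𝒢.trans hℱ) hU hind G hG hGm
  · let x : Fin (N + 1) → X := fun i => Infinite.natEmbedding X i
    have hx : Function.Injective x :=
      (Infinite.natEmbedding X).injective.comp Fin.val_injective
    let ν : Measure X := (PMF.uniformOfFintype (Fin (N + 1))).toMeasure.map x
    have hν : IsProbabilityMeasure ν := Measure.isProbabilityMeasure_map (by fun_prop)
    have hνx : ∀ i, ν {x i} = ((N : ℝ≥0∞) + 1)⁻¹ := fun i => by
      rw [Measure.map_apply (by fun_prop) (measurableSet_singleton _), ← image_singleton,
        preimage_image_eq _ hx, PMF.toMeasure_apply_singleton _ _ (measurableSet_singleton _)]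
      simp
    obtain ⟨g, hg, hgν⟩ := h ℱ le_rfl (fun _ => ν) (fun _ => hν) fun B _ => measurable_const
    refine ⟨fun i => g ⁻¹' {x i}, fun i => hg (measurableSet_singleton _), ?_, fun i A hA => ?_⟩
    · have hmeas : MeasurableSet (range x)ᶜ := (finite_range x).measurableSet.compl
      have e := hgν (range x)ᶜ hmeas univ .univ
      rw [univ_inter, setLIntegral_const, Measure.map_apply (by fun_prop) hmeas] at e
      rw [← preimage_iUnion, iUnion_singleton_eq_range, ← preimage_compl, e]
      simp
    · rw [hgν _ (measurableSet_singleton _) A hA, setLIntegral_const, hνx, ← mul_assoc,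
        ENNReal.mul_inv_cancel (by simp) (by finiteness), one_mul]
end

section
/- Let (T, 𝒯, λ) be a complete atomless probability space, ℱ ⊆ 𝒯 a sub-σ-algebra, and X a Polish space. Suppose that for every sub-σ-algebra 𝒢 ⊆ ℱ and every 𝒢-measurable transition probability G from T to X there exists a 𝒯-measurable g with μ^{g|𝒢} = G. Then for every sub-σ-algebra 𝒢 ⊆ ℱ, every closed-valued ℱ-measurable correspondence F : T ⇉ X, every pair f₁, f₂ of 𝒯-measurable selections of F, and every α ∈ (0,1), there exists a 𝒯-measurable selection f of F such that for every Borel B ⊆ X and every A ∈ 𝒢, λ(A ∩ f⁻¹(B)) = α·λ(A ∩ f₁⁻¹(B)) + (1−α)·λ(A ∩ f₂⁻¹(B)); equivalently, the set of regular conditional distributions given 𝒢 of 𝒯-measurable selections of F is convex. -/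
open MeasureTheory Set Filter Topology ENNReal

theorem map_prodMk_eq_smul_add_smul {T S X : Type*} [MeasurableSpace T] [MeasurableSpace S]
    [MeasurableSpace X] (μ : Measure T) [IsFiniteMeasure μ] {φ : T → S} (hφ : Measurable φ)
    {g f₁ f₂ : T → X} (hg : Measurable g) (hf₁ : Measurable f₁) (hf₂ : Measurable f₂)
    {a b : ℝ≥0∞}
    (h : ∀ A, MeasurableSet A → ∀ B, MeasurableSet B →
      μ (φ ⁻¹' A ∩ g ⁻¹' B) = a * μ (φ ⁻¹' A ∩ f₁ ⁻¹' B) + b * μ (φ ⁻¹' A ∩ f₂ ⁻¹' B)) :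
    μ.map (fun t => (φ t, g t))
      = a • μ.map (fun t => (φ t, f₁ t)) + b • μ.map (fun t => (φ t, f₂ t)) := by
  refine Measure.ext_prod fun {A B} hA hB => ?_
  simpa [Measure.map_apply, hφ.prodMk hg, hφ.prodMk hf₁, hφ.prodMk hf₂, hA.prod hB,
    mk_preimage_prod] using h A hA B hB

open ProbabilityTheory in
theorem exists_measurable_kernel_mixture {T S X : Type*} [MeasurableSpace T] [MeasurableSpace S]
    [MeasurableSpace X] [StandardBorelSpace X] [Nonempty X]
    (μ : Measure T) [IsFiniteMeasure μ] {φ : T → S} (hφ : Measurable φ)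
    {f₁ f₂ : T → X} (hf₁ : Measurable f₁) (hf₂ : Measurable f₂)
    {a b : ℝ≥0∞} (hab : a + b = 1) :
    ∃ κ : S → Measure X, (∀ s, IsProbabilityMeasure (κ s)) ∧
      (∀ B, MeasurableSet B → Measurable fun s => κ s B) ∧
      ∀ A, MeasurableSet A → ∀ B, MeasurableSet B →
        ∫⁻ t in φ ⁻¹' A, κ (φ t) B ∂μ
          = a * μ (φ ⁻¹' A ∩ f₁ ⁻¹' B) + b * μ (φ ⁻¹' A ∩ f₂ ⁻¹' B) := by
  refine ⟨fun s => a • condDistrib f₁ φ μ s + b • condDistrib f₂ φ μ s,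
    fun s => ⟨by simp [hab]⟩, fun B hB => ?_, fun A hA B hB => ?_⟩
  · have h₁ := Kernel.measurable_coe (condDistrib f₁ φ μ) hB
    have h₂ := Kernel.measurable_coe (condDistrib f₂ φ μ) hB
    exact (h₁.const_mul a).add (h₂.const_mul b)
  · have h₁ : Measurable fun t => condDistrib f₁ φ μ (φ t) B :=
      (Kernel.measurable_coe _ hB).comp hφ
    have h₂ : Measurable fun t => condDistrib f₂ φ μ (φ t) B :=
      (Kernel.measurable_coe _ hB).comp hφ
    simp only [Measure.add_apply, Measure.smul_apply, smul_eq_mul]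
    rw [lintegral_add_left (h₁.const_mul a), lintegral_const_mul a h₁, lintegral_const_mul b h₂,
      setLIntegral_preimage_condDistrib hφ hf₁.aemeasurable hB hA,
      setLIntegral_preimage_condDistrib hφ hf₂.aemeasurable hB hA]

/-- (B5 ⇒ B1) If for every sub-σ-algebra `𝒢 ⊆ ℱ` and every `𝒢`-measurable transition
probability `G` from `T` to the Polish space `X` there is a `𝒯`-measurable `g` with
`μ^{g|𝒢} = G`, then for every sub-σ-algebra `𝒢 ⊆ ℱ`, every closed-valued
`ℱ`-measurable correspondence `F : T ⇉ X`, every pair of `𝒯`-measurable selections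
`f₁, f₂` of `F` and every `α ∈ (0,1)` there is a `𝒯`-measurable selection `f` of `F`
whose RCD given `𝒢` is the `α`-mixture of those of `f₁` and `f₂`; i.e. the set of
RCDs of selections is convex. -/
theorem rcd_realization_implies_convexity
    {T : Type*} [𝒯 : MeasurableSpace T] (μ : Measure T) [IsProbabilityMeasure μ]
    (hcomplete : μ.IsComplete)
    (hatomless : ∀ D : Set T, MeasurableSet[𝒯] D → 0 < μ D →
      ∃ D₀ ⊆ D, MeasurableSet[𝒯] D₀ ∧ 0 < μ D₀ ∧ μ D₀ < μ D)
    (ℱ : MeasurableSpace T) (hℱ : ℱ ≤ 𝒯)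
    {X : Type*} [TopologicalSpace X] [PolishSpace X] [MeasurableSpace X] [BorelSpace X]
    (hB5 : ∀ 𝒢 : MeasurableSpace T, 𝒢 ≤ ℱ →
      ∀ G : T → Measure X, (∀ t, IsProbabilityMeasure (G t)) →
        (∀ B : Set X, MeasurableSet B → Measurable[𝒢] fun t => G t B) →
        ∃ g : T → X, Measurable[𝒯] g ∧
          ∀ B : Set X, MeasurableSet B → ∀ A : Set T, MeasurableSet[𝒢] A →
            μ (A ∩ g ⁻¹' B) = ∫⁻ t in A, G t B ∂μ) :
    ∀ 𝒢 : MeasurableSpace T, 𝒢 ≤ ℱ →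
      ∀ F : T → Set X,
        MeasurableSet[ℱ.prod inferInstance] {p : T × X | p.2 ∈ F p.1} →
        (∀ᵐ t ∂μ, IsClosed (F t) ∧ (F t).Nonempty) →
        ∀ f₁ f₂ : T → X, Measurable[𝒯] f₁ → Measurable[𝒯] f₂ →
          (∀ᵐ t ∂μ, f₁ t ∈ F t) → (∀ᵐ t ∂μ, f₂ t ∈ F t) →
          ∀ α : ℝ≥0∞, 0 < α → α < 1 →
            ∃ f : T → X, Measurable[𝒯] f ∧ (∀ᵐ t ∂μ, f t ∈ F t) ∧
              ∀ B : Set X, MeasurableSet B → ∀ A : Set T, MeasurableSet[𝒢] A →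
                μ (A ∩ f ⁻¹' B)
                  = α * μ (A ∩ f₁ ⁻¹' B) + (1 - α) * μ (A ∩ f₂ ⁻¹' B) := by
  intro 𝒢 h𝒢 F hF _ f₁ f₂ hf₁ hf₂ hF₁ hF₂ α _ hα
  have : Nonempty X := (nonempty_of_isProbabilityMeasure μ).map f₁
  have hid : Measurable[𝒯, ℱ] (id : T → T) := measurable_id'' hℱ
  obtain ⟨κ, hκ, hκm, hκi⟩ := @exists_measurable_kernel_mixture T T X 𝒯 ℱ _ _ _ μ _ id hid
    f₁ f₂ hf₁ hf₂ α (1 - α) (add_tsub_cancel_of_le hα.le)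
  obtain ⟨g, hg, hgi⟩ := hB5 ℱ le_rfl κ hκ hκm
  have hmix : ∀ A, MeasurableSet[ℱ] A → ∀ B, MeasurableSet B → μ (A ∩ g ⁻¹' B)
      = α * μ (A ∩ f₁ ⁻¹' B) + (1 - α) * μ (A ∩ f₂ ⁻¹' B) :=
    fun A hA B hB => (hgi B hB A hA).trans (hκi A hA B hB)
  refine ⟨g, hg, ?_, fun B hB A hA => hmix A (h𝒢 A hA) B hB⟩
  have hmap := @map_prodMk_eq_smul_add_smul T T X 𝒯 ℱ _ μ _ id hid g f₁ f₂ hg hf₁ hf₂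
    α (1 - α) hmix
  have hnull : ∀ f : T → X, Measurable[𝒯] f →
      (@Measure.map T (T × X) 𝒯 (ℱ.prod inferInstance) (fun t => (id t, f t)) μ
        {p : T × X | p.2 ∈ F p.1}ᶜ = 0 ↔ ∀ᵐ t ∂μ, f t ∈ F t) := by
    intro f hf
    have hpair : Measurable[𝒯, ℱ.prod inferInstance] fun t => (id t, f t) :=
      Measurable.prodMk hid hf
    rw [Measure.map_apply hpair hF.compl]
    rfl
  rw [← hnull g hg, hmap]
  simp only [Measure.add_apply, Measure.smul_apply]
  rw [(hnull f₁ hf₁).2 hF₁, (hnull f₂ hf₂).2 hF₂]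
  simp
end
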